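/- arXiv:1710.08308 — 3 statements merged into one kernel-verified Lean document; each statement's English description precedes it below -/
import Mathlib

section
/- Theorem 1 (tubal-sampling energy estimation, transform-domain form). Let δ > 0 and suppose the sample size m satisfies m ≥ (8/3)·n₂·μ·log(2n₂n₃/δ) and γ := √(8c²n₂μ·log(2n₂n₃/δ)/(3m)) < 1. Define α := √(2(n₁B_∞ − B)/(mB)·log(1/δ)) + (2(n₁B_∞ − B)/(3mB))·log(1/δ) and β := (1 + 2√(log(1/δ)))². Then with probability at least 1 − 4δ the matrix G := Σ_{k=1}^m A_{Ω(k)}ᴴ A_{Ω(k)} is invertible and the sampled residual energy Q := Σ_{k=1}^m ‖b_{Ω(k)}‖₂² − vᴴ G⁻¹ v, where v := Σ_{k=1}^m A_{Ω(k)}ᴴ b_{Ω(k)}, satisfies ((m(1−α) − c²n₂μ·β/(1−γ))/n₁)·B ≤ Q ≤ (1+α)·(m/n₁)·B. -/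
open Matrix Real
open scoped BigOperators

/-- Iteration of a one-step inequality over i.i.d. samples. -/
lemma sum_iterate {ι E : Type*} [Fintype ι] [AddCommMonoid E] (P : E → Prop) (Φ : E → ℝ)
    (X : ι → E) (ρ : ℝ) (hρ : 0 ≤ ρ) (hP : ∀ s j, P s → P (s + X j))
    (h : ∀ s, P s → ∑ j, Φ (s + X j) ≤ ρ * Φ s) (m : ℕ) :
    ∀ s, P s → ∑ ω : Fin m → ι, Φ (s + ∑ k, X (ω k)) ≤ ρ ^ m * Φ s := by
  induction m with
  | zero => intro s _; simp
  | succ m ih =>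
    intro s hs
    have e : ∑ ω : Fin (m+1) → ι, Φ (s + ∑ k, X (ω k))
        = ∑ j, ∑ ω : Fin m → ι, Φ ((s + X j) + ∑ k, X (ω k)) := by
      rw [← (Fin.consEquiv (fun _ : Fin (m+1) => ι)).sum_comp, Fintype.sum_prod_type]
      simp [Fin.consEquiv, Fin.sum_univ_succ, add_assoc]
    rw [e]
    calc _ ≤ ∑ j, ρ ^ m * Φ (s + X j) := Finset.sum_le_sum fun j _ => ih _ (hP s j hs)
      _ = ρ ^ m * ∑ j, Φ (s + X j) := by rw [Finset.mul_sum]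
      _ ≤ ρ ^ m * (ρ * Φ s) := mul_le_mul_of_nonneg_left (h s hs) (pow_nonneg hρ m)
      _ = _ := by ring

/-- The Markov inequality for counting. -/
lemma markov_count {α : Type*} [Fintype α] (f : α → ℝ) (hf : ∀ a, 0 ≤ f a) (S : Set α)
    (hS : ∀ a ∈ S, 1 ≤ f a) : (S.ncard : ℝ) ≤ ∑ a, f a := by
  classical
  rw [Set.ncard_eq_toFinset_card' S, Finset.card_eq_sum_ones]
  push_cast
  calc _ ≤ ∑ a ∈ S.toFinset, f a := Finset.sum_le_sum fun a ha => hS a (by simpa using ha)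
    _ ≤ _ := Finset.sum_le_univ_sum_of_nonneg hf

lemma exp_hasSum (z : ℝ) : HasSum (fun n : ℕ => z ^ n / n.factorial) (exp z) := by
  rw [Real.exp_eq_exp_ℝ]; exact NormedSpace.expSeries_div_hasSum_exp z

lemma exp_hasSum2 (z : ℝ) : HasSum (fun n : ℕ => z ^ (n+2) / (n+2).factorial) (exp z - 1 - z) := by
  have := (hasSum_nat_add_iff' 2).2 (exp_hasSum z)
  simpa [Finset.sum_range_succ, sub_sub] using this

lemma exp_neg_quad {z : ℝ} (hz : z ≤ 0) : exp z ≤ 1 + z + z ^ 2 / 2 := by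
  have h := Real.quadratic_le_exp_of_nonneg (x := -z) (by linarith)
  have h2 : exp z * exp (-z) = 1 := by rw [← exp_add]; simp
  have h3 := exp_pos z
  have h5 : 0 < 1 + -z + (-z)^2/2 := by nlinarith [sq_nonneg z]
  have h6 : exp z * (1 + -z + (-z)^2/2) ≤ 1 := by nlinarith
  by_contra hc
  push Not at hc
  have : (1 + z + z^2/2) * (1 + -z + (-z)^2/2) < exp z * (1 + -z + (-z)^2/2) :=
    mul_lt_mul_of_pos_right hc h5
  nlinarith [sq_nonneg (z^2)]

lemma fact_ge (n : ℕ) : (2 : ℝ) * 3 ^ n ≤ (n+2).factorial := by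
  have := Nat.factorial_mul_pow_le_factorial (m := 2) (n := n)
  have h2 : Nat.factorial 2 * (2+1)^n ≤ (2+n).factorial := this
  rw [add_comm 2 n] at h2
  have : ((Nat.factorial 2 * (2+1)^n : ℕ) : ℝ) ≤ ((n+2).factorial : ℕ) := by exact_mod_cast h2
  simpa [Nat.factorial] using this

lemma exp_bernstein {z w : ℝ} (hzw : z ≤ w) (hw0 : 0 ≤ w) (hw : w < 3) :
    exp z ≤ 1 + z + z ^ 2 / (2 * (1 - w / 3)) := by
  rcases le_total z 0 with hz | hz
  · refine (exp_neg_quad hz).trans ?_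
    gcongr
    · linarith
    · linarith
  · have hg := (hasSum_geometric_of_lt_one (r := w/3) (by positivity) (by linarith)).mul_left (z^2/2)
    have := hasSum_le (fun n => ?_) (exp_hasSum2 z) hg
    · have e : z^2/2 * (1 - w/3)⁻¹ = z ^ 2 / (2 * (1 - w / 3)) := by
        rw [div_mul_eq_div_div]; rfl
      rw [e] at this; linarith
    · calc z^(n+2) / (n+2).factorial ≤ z^(n+2) / (2 * 3^n) := by
            gcongr; exact fact_ge n
        _ = z^2/2 * (z/3)^n := by rw [div_pow]; field_simp; ring
        _ ≤ _ := by gcongr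

lemma exp_key (z : ℝ) : exp z - 1 - z ≤ z ^ 2 / 3 + z ^ 2 * exp z / 6 := by
  rcases le_total 0 z with hz | hz
  · have h1 := (exp_hasSum z).mul_left (z^2/6)
    have h2 := (hasSum_ite_eq 0 (z^2/3)).add h1
    have := hasSum_le (fun n => ?_) (exp_hasSum2 z) h2
    · linarith
    · have hf : (0:ℝ) < n.factorial := by positivity
      have e : ((n+2).factorial : ℝ) = (n+2) * (n+1) * n.factorial := by
        rw [Nat.factorial_succ, Nat.factorial_succ]; push_cast; ring
      rcases Nat.eq_zero_or_pos n with rfl | hn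
      · simp; nlinarith [sq_nonneg z]
      · rw [if_neg (by omega), e]
        have hn' : (1:ℝ) ≤ n := by exact_mod_cast hn
        rw [zero_add, div_mul_div_comm, ← pow_add, add_comm 2 n]
        gcongr
        nlinarith
  · obtain ⟨y, rfl⟩ : ∃ y, z = -y := ⟨-z, by simp⟩
    have hy : 0 ≤ y := by linarith
    have hL : HasSum (fun n : ℕ => y * (y^(n+1) / (n+1).factorial)) (y * (exp y - 1)) := by
      have := (hasSum_nat_add_iff' 1).2 (exp_hasSum y)
      simpa using this.mul_left y
    have hR := ((exp_hasSum2 y).add ((exp_hasSum y).mul_left (y^2/3))).add (hasSum_ite_eq 0 (y^2/6))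
    have := hasSum_le (fun n => ?_) hL hR
    · have h2 : exp (-y) * exp y = 1 := by rw [← exp_add]; simp
      have h3 := exp_pos (-y)
      have h4 := mul_le_mul_of_nonneg_left this h3.le
      have e1 : exp (-y) * (y * (exp y - 1)) = y * 1 - y * exp (-y) := by linear_combination y * h2
      have e2 : exp (-y) * (exp y - 1 - y + y ^ 2 / 3 * exp y + y ^ 2 / 6)
        = 1 - exp (-y) - y * exp (-y) + y^2/3 * 1 + y^2/6 * exp (-y) := by linear_combination (1 + y^2/3) * h2
      rw [e1, e2] at h4
      linarith
    · have hf : (0:ℝ) < n.factorial := by positivity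
      have e : ((n+2).factorial : ℝ) = (n+2) * (n+1) * n.factorial := by
        rw [Nat.factorial_succ, Nat.factorial_succ]; push_cast; ring
      have e' : ((n+1).factorial : ℝ) = (n+1) * n.factorial := by
        rw [Nat.factorial_succ]; push_cast; ring
      rcases Nat.eq_zero_or_pos n with rfl | hn
      · simp; nlinarith [sq_nonneg y]
      · rw [if_neg (by omega), e, e']
        have hn' : (1:ℝ) ≤ n := by exact_mod_cast hn
        have : y ^ (n + 2) / ((n + 2) * (n + 1) * n.factorial) + y ^ 2 / 3 * (y ^ n / n.factorial) + 0
          - y * (y ^ (n + 1) / ((n + 1) * n.factorial)) = y^(n+2) / (3 * ((n + 2) * (n + 1) * n.factorial)) * (3 + (n+2)*(n+1) - 3 * (n+2)) := by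
          field_simp; ring
        have h0 : 0 ≤ y^(n+2) / (3 * ((n + 2) * (n + 1) * n.factorial)) * (3 + (n+2)*(n+1) - 3 * (n+2) : ℝ) := by
          apply mul_nonneg (by positivity); nlinarith
        linarith

/-- The optimal choice of the parameter in the sub-gamma tail bound. -/
lemma subgamma_param (v b L : ℝ) (hv : 0 < v) (hb : 0 ≤ b) (hL : 0 < L) :
    ∃ l : ℝ, 0 < l ∧ l * b < 3 ∧
      -l * (√(2 * v * L) + b * L / 3) + v * l ^ 2 / (2 * (1 - l * b / 3)) = - L := by
  set r := √(v / (2 * L)) with hr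
  have hr0 : 0 < r := by positivity
  have hr2 : v = 2 * L * r ^ 2 := by rw [hr, sq_sqrt (by positivity)]; field_simp
  have hs : √(2 * v * L) = 2 * L * r := by
    rw [hr2, show 2 * (2 * L * r^2) * L = (2 * L * r)^2 by ring, sqrt_sq (by positivity)]
  have hpos : 0 < b/3 + r := by positivity
  refine ⟨1 / (b/3 + r), by positivity, ?_, ?_⟩
  · rw [div_mul_eq_mul_div, div_lt_iff₀ hpos]; nlinarith
  · have : 1 - 1 / (b/3+r) * b / 3 = r / (b/3+r) := by field_simp; ring
    rw [this, hs, hr2]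
    field_simp
    ring

lemma bernstein_count {n m : ℕ} (hn : 0 < n) (X : Fin n → ℝ) (b s L : ℝ)
    (hX0 : ∑ j, X j = 0) (hXb : ∀ j, X j ≤ b) (hb : 0 ≤ b) (hX2 : ∑ j, X j ^ 2 ≤ n * s)
    (hs : 0 < m * s) (hL : 0 < L) :
    (Set.ncard {ω : Fin m → Fin n | √(2 * (m * s) * L) + b * L / 3 < ∑ k, X (ω k)} : ℝ)
      ≤ exp (-L) * n ^ m := by
  obtain ⟨l, hl0, hlb, hl⟩ := subgamma_param (m * s) b L hs hb hL
  set t := √(2 * (m * s) * L) + b * L / 3 with ht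
  have hn' : (0:ℝ) < n := by exact_mod_cast hn
  have hden : 0 < 2 * (1 - l * b / 3) := by linarith
  set ψ := s * l ^ 2 / (2 * (1 - l * b / 3)) with hψ
  have step : ∀ x : ℝ, ∑ j, exp (l * (x + X j)) ≤ (n * exp ψ) * exp (l * x) := by
    intro x
    have h1 : ∀ j, exp (l * X j) ≤ 1 + l * X j + (l * X j) ^ 2 / (2 * (1 - l * b / 3)) := fun j =>
      exp_bernstein (mul_le_mul_of_nonneg_left (hXb j) hl0.le) (by positivity) hlb
    have h2 : ∑ j, exp (l * X j) ≤ n * exp ψ := by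
      calc _ ≤ ∑ j, (1 + l * X j + (l * X j) ^ 2 / (2 * (1 - l * b / 3))) :=
            Finset.sum_le_sum fun j _ => h1 j
        _ = n + l * ∑ j, X j + l^2 / (2 * (1 - l * b / 3)) * ∑ j, X j ^ 2 := by
            rw [Finset.sum_add_distrib, Finset.sum_add_distrib, Finset.mul_sum, Finset.mul_sum]
            simp
            refine Finset.sum_congr rfl fun j _ => by ring
        _ ≤ n + l * 0 + l^2 / (2 * (1 - l * b / 3)) * (n * s) := by rw [hX0]; gcongr
        _ = n * (ψ + 1) := by rw [hψ]; ring
        _ ≤ _ := by gcongr; exact add_one_le_exp ψ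
    calc _ = (∑ j, exp (l * X j)) * exp (l * x) := by
          rw [Finset.sum_mul]; refine Finset.sum_congr rfl fun j _ => ?_
          rw [← exp_add]; ring_nf
      _ ≤ _ := by gcongr
  have it := sum_iterate (fun _ => True) (fun x => exp (l * x)) X (n * exp ψ) (by positivity)
    (fun _ _ _ => trivial) (fun x _ => step x) m 0 trivial
  have mk := markov_count (fun ω : Fin m → Fin n => exp (-l * t) * exp (l * (0 + ∑ k, X (ω k))))
    (fun _ => by positivity) {ω : Fin m → Fin n | t < ∑ k, X (ω k)} (by
      intro ω hω
      simp only [Set.mem_ofPred_eq] at hω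
      rw [← exp_add]; apply one_le_exp; nlinarith)
  refine mk.trans ?_
  rw [← Finset.mul_sum]
  refine (mul_le_mul_of_nonneg_left it (exp_pos _).le).trans (le_of_eq ?_)
  rw [mul_zero, exp_zero, mul_one, mul_pow, ← exp_nat_mul, ← hl, exp_add]
  rw [show m * ψ = m * s * l ^ 2 / (2 * (1 - l * b / 3)) by rw [hψ]; ring]
  ring

lemma cosh_convex (a x τ w : ℝ) (h1 : -1 ≤ τ) (h2 : τ ≤ 1)
    (hw : w ^ 2 = a ^ 2 + x ^ 2 + 2 * (a * x) * τ) :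
    cosh w ≤ cosh a * cosh x + τ * (sinh a * sinh x) := by
  have e : cosh a * cosh x + τ * (sinh a * sinh x)
      = (1 + τ) / 2 * cosh (a + x) + (1 - τ) / 2 * cosh (a - x) := by
    rw [cosh_add, cosh_sub]; ring
  rw [e]
  refine hasSum_le (fun k => ?_) (Real.hasSum_cosh w)
    (((Real.hasSum_cosh (a+x)).mul_left ((1+τ)/2)).add
      ((Real.hasSum_cosh (a-x)).mul_left ((1-τ)/2)))
  have ha : (0:ℝ) ≤ (1+τ)/2 := by linarith
  have hb : (0:ℝ) ≤ (1-τ)/2 := by linarith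
  have hab : (1+τ)/2 + (1-τ)/2 = 1 := by ring
  have hc := (convexOn_pow (𝕜 := ℝ) k).2 (sq_nonneg (a+x)) (sq_nonneg (a-x)) ha hb hab
  simp only [smul_eq_mul] at hc
  have : (1 + τ) / 2 * (a + x) ^ 2 + (1 - τ) / 2 * (a - x) ^ 2 = w ^ 2 := by rw [hw]; ring
  rw [this] at hc
  rw [pow_mul, pow_mul, pow_mul, ← mul_div_assoc, ← mul_div_assoc, ← add_div]
  gcongr

lemma sinh_ge {x : ℝ} (hx : 0 ≤ x) : x ≤ sinh x := Real.self_le_sinh_iff.2 hx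

lemma cosh_step {E : Type*} [NormedAddCommGroup E] [InnerProductSpace ℂ E] (s X : E) :
    cosh ‖s + X‖ ≤ cosh ‖s‖ * (exp ‖X‖ - ‖X‖)
      + sinh ‖s‖ / ‖s‖ * (inner ℂ s X).re := by
  set a := ‖s‖ with ha
  set x := ‖X‖ with hx
  set p := (inner ℂ s X).re with hp
  have ha0 : 0 ≤ a := norm_nonneg s
  have hx0 : 0 ≤ x := norm_nonneg X
  have hpa : |p| ≤ a * x := (Complex.abs_re_le_norm _).trans (norm_inner_le_norm s X)
  have hsq : ‖s + X‖ ^ 2 = a ^ 2 + x ^ 2 + 2 * p := by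
    have := @norm_add_sq ℂ E _ _ _ s X
    rw [this]; simp only [RCLike.re_to_complex]; ring
  have hex : exp x = cosh x + sinh x := (cosh_add_sinh x).symm
  have hsx := sinh_ge hx0
  have hsa := Real.sinh_nonneg_iff.2 ha0
  have hca : sinh a ≤ cosh a := (sinh_lt_cosh a).le
  rcases eq_or_lt_of_le (mul_nonneg ha0 hx0) with h0 | h0
  · have hp0 : p = 0 := by rw [← h0] at hpa; exact abs_nonpos_iff.1 hpa
    rw [hp0, mul_zero, add_zero]
    have := cosh_convex a x 0 ‖s + X‖ (by norm_num) (by norm_num) (by rw [hsq, hp0]; ring)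
    rw [zero_mul, add_zero] at this
    refine this.trans ?_
    have := cosh_pos a
    gcongr; linarith
  · have hap : 0 < a := by
      rcases eq_or_lt_of_le ha0 with h | h
      · rw [← h] at h0; simp at h0
      · exact h
    have hxp : 0 < x := by
      rcases eq_or_lt_of_le hx0 with h | h
      · rw [← h] at h0; simp at h0
      · exact h
    have hτ := abs_le.1 hpa
    have := cosh_convex a x (p / (a * x)) ‖s + X‖ (by rw [le_div_iff₀ h0]; linarith)
      (by rw [div_le_one h0]; linarith) (by rw [hsq]; field_simp)
    refine this.trans ?_
    have e : p / (a * x) * (sinh a * sinh x)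
        = sinh a / a * p + sinh a * (p / (a * x)) * (sinh x - x) := by
      field_simp; ring
    rw [e, hex]
    have hle : p / (a * x) ≤ 1 := by rw [div_le_one h0]; linarith
    have h3 : sinh a * (p / (a * x)) * (sinh x - x) ≤ cosh a * (sinh x - x) := by
      apply mul_le_mul_of_nonneg_right _ (by linarith)
      nlinarith
    linarith

lemma pinelis_count {E : Type*} [NormedAddCommGroup E] [InnerProductSpace ℂ E]
    {n m : ℕ} (hn : 0 < n) (X : Fin n → E) (b s L : ℝ)
    (hX0 : ∑ j, X j = 0) (hXb : ∀ j, ‖X j‖ ≤ b) (hb : 0 ≤ b) (hX2 : ∑ j, ‖X j‖ ^ 2 ≤ n * s)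
    (hs : 0 < m * s) (hL : 0 < L) :
    (Set.ncard {ω : Fin m → Fin n | √(2 * (m * s) * L) + b * L / 3 < ‖∑ k, X (ω k)‖} : ℝ)
      ≤ 2 * exp (-L) * n ^ m := by
  obtain ⟨l, hl0, hlb, hl⟩ := subgamma_param (m * s) b L hs hb hL
  set t := √(2 * (m * s) * L) + b * L / 3 with ht
  have hn' : (0:ℝ) < n := by exact_mod_cast hn
  have hden : 0 < 2 * (1 - l * b / 3) := by linarith
  set ψ := s * l ^ 2 / (2 * (1 - l * b / 3)) with hψ
  have hnl : ∀ x : E, ‖(l:ℂ) • x‖ = l * ‖x‖ := fun x => by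
    rw [norm_smul]; simp [abs_of_pos hl0]
  have step : ∀ x : E, ∑ j, cosh ‖x + (l:ℂ) • X j‖ ≤ (n * exp ψ) * cosh ‖x‖ := by
    intro x
    have h1 : ∀ j, exp (l * ‖X j‖) - l * ‖X j‖ ≤ 1 + (l * ‖X j‖) ^ 2 / (2 * (1 - l * b / 3)) := by
      intro j
      have := exp_bernstein (mul_le_mul_of_nonneg_left (hXb j) hl0.le) (by positivity) hlb
      linarith
    have h2 : ∑ j, (exp (l * ‖X j‖) - l * ‖X j‖) ≤ n * exp ψ := by
      calc _ ≤ ∑ j, (1 + (l * ‖X j‖) ^ 2 / (2 * (1 - l * b / 3))) :=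
            Finset.sum_le_sum fun j _ => h1 j
        _ = n + l^2 / (2 * (1 - l * b / 3)) * ∑ j, ‖X j‖ ^ 2 := by
            rw [Finset.sum_add_distrib, Finset.mul_sum]
            simp
            refine Finset.sum_congr rfl fun j _ => by ring
        _ ≤ n + l^2 / (2 * (1 - l * b / 3)) * (n * s) := by gcongr
        _ = n * (ψ + 1) := by rw [hψ]; ring
        _ ≤ _ := by gcongr; exact add_one_le_exp ψ
    have h3 : ∑ j, (inner ℂ x ((l:ℂ) • X j)).re = 0 := by
      rw [← Complex.re_sum, ← inner_sum, ← Finset.smul_sum, hX0]; simp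
    calc _ ≤ ∑ j, (cosh ‖x‖ * (exp ‖(l:ℂ) • X j‖ - ‖(l:ℂ) • X j‖)
      + sinh ‖x‖ / ‖x‖ * (inner ℂ x ((l:ℂ) • X j)).re) :=
          Finset.sum_le_sum fun j _ => cosh_step x _
      _ = cosh ‖x‖ * ∑ j, (exp (l * ‖X j‖) - l * ‖X j‖) := by
          rw [Finset.sum_add_distrib, ← Finset.mul_sum, ← Finset.mul_sum, h3, mul_zero, add_zero]
          simp only [hnl]
      _ ≤ cosh ‖x‖ * (n * exp ψ) := by
          have := cosh_pos ‖x‖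
          gcongr
      _ = _ := by ring
  have it := sum_iterate (fun _ => True) (fun x : E => cosh ‖x‖) (fun j => (l:ℂ) • X j)
    (n * exp ψ) (by positivity)
    (fun _ _ _ => trivial) (fun x _ => step x) m 0 trivial
  have mk := markov_count (fun ω : Fin m → Fin n =>
      2 * exp (-l * t) * cosh ‖0 + ∑ k, (l:ℂ) • X (ω k)‖)
    (fun _ => by have := cosh_pos; positivity) {ω : Fin m → Fin n | t < ‖∑ k, X (ω k)‖} (by
      intro ω hω
      simp only [Set.mem_ofPred_eq] at hω
      rw [zero_add, ← Finset.smul_sum, hnl, cosh_eq]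
      have h1 : 1 ≤ exp (-l * t) * exp (l * ‖∑ k, X (ω k)‖) := by
        rw [← exp_add]; apply one_le_exp; nlinarith
      have h2 : 0 ≤ exp (-l * t) * exp (-(l * ‖∑ k, X (ω k)‖)) := by positivity
      linarith)
  refine mk.trans ?_
  rw [← Finset.mul_sum]
  refine (mul_le_mul_of_nonneg_left it (by positivity)).trans (le_of_eq ?_)
  rw [norm_zero, cosh_zero, mul_one, mul_pow, ← exp_nat_mul, ← hl, exp_add]
  rw [show m * ψ = m * s * l ^ 2 / (2 * (1 - l * b / 3)) by rw [hψ]; ring]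
  ring

section MatrixChernoff
variable {E : Type*} [NormedAddCommGroup E] [InnerProductSpace ℂ E]

lemma re_inner_self' (u : E) : (inner ℂ u u).re = ‖u‖ ^ 2 :=
  inner_self_eq_norm_sq (𝕜 := ℂ) u

lemma spec_inner {ι : Type*} [Fintype ι] (a : OrthonormalBasis ι ℂ E) (T : E →ₗ[ℂ] E)
    (hT : T.IsSymmetric) (x : ι → ℝ) (hx : ∀ i, T (a i) = (x i : ℂ) • a i) (e : E) (y : ℝ) (i : ι) :
    inner ℂ (a i) (T e - (y:ℂ) • e) = ((x i - y : ℝ) : ℂ) * inner ℂ (a i) e := by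
  rw [inner_sub_right, ← hT, hx, inner_smul_left, inner_smul_right]
  simp; ring

lemma spec_sum2 {ι : Type*} [Fintype ι] (a : OrthonormalBasis ι ℂ E) (T : E →ₗ[ℂ] E)
    (hT : T.IsSymmetric) (x : ι → ℝ) (hx : ∀ i, T (a i) = (x i : ℂ) • a i) (e : E) (y : ℝ) :
    ∑ i, ‖inner ℂ (a i) e‖ ^ 2 * (x i - y) ^ 2 = ‖T e - (y:ℂ) • e‖ ^ 2 := by
  rw [← a.sum_sq_norm_inner_right]
  refine Finset.sum_congr rfl fun i _ => ?_
  rw [spec_inner a T hT x hx, norm_mul, mul_pow, Complex.norm_real, Real.norm_eq_abs, sq_abs]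
  ring

lemma spec_sum1 {ι : Type*} [Fintype ι] (a : OrthonormalBasis ι ℂ E) (T : E →ₗ[ℂ] E)
    (hT : T.IsSymmetric) (x : ι → ℝ) (hx : ∀ i, T (a i) = (x i : ℂ) • a i) (e : E) (y : ℝ) :
    ∑ i, ‖inner ℂ (a i) e‖ ^ 2 * (x i - y) = (inner ℂ e (T e - (y:ℂ) • e)).re := by
  rw [← a.sum_inner_mul_inner, Complex.re_sum]
  refine Finset.sum_congr rfl fun i _ => ?_
  rw [spec_inner a T hT x hx]
  have : inner ℂ e (a i) = (starRingEnd ℂ) (inner ℂ (a i) e) := (inner_conj_symm _ _).symm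
  rw [this, mul_left_comm, Complex.re_ofReal_mul, Complex.conj_mul']
  norm_cast
  ring

lemma trexp_step [FiniteDimensional ℂ E] {d : ℕ} (a b : OrthonormalBasis (Fin d) ℂ E)
    (H Y : E →ₗ[ℂ] E) (hH : H.IsSymmetric) (hHY : (H + Y).IsSymmetric) (x y : Fin d → ℝ)
    (hx : ∀ i, (H + Y) (a i) = (x i : ℂ) • a i) (hy : ∀ i, H (b i) = (y i : ℂ) • b i)
    (ρ : ℝ) (hρ : 0 ≤ ρ)
    (hY2 : ∀ u, ‖Y u‖ ^ 2 ≤ ρ * -(inner ℂ u (Y u)).re) :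
    ∑ i, exp (x i) ≤ ∑ j, exp (y j) - (1 - ρ / 2) * ∑ j, exp (y j) * -(inner ℂ (b j) (Y (b j))).re := by
  set w : Fin d → Fin d → ℝ := fun i j => ‖inner ℂ (a i) (b j)‖ ^ 2 with hw
  have hw0 : ∀ i j, 0 ≤ w i j := fun i j => by positivity
  have hwc : ∀ i j, ‖inner ℂ (b j) (a i)‖ ^ 2 = w i j := fun i j => by rw [hw]; simp only; rw [norm_inner_symm]
  have hb1 : ∀ j, ∑ i, w i j = 1 := fun j => by
    have := a.sum_sq_norm_inner_right (b j); rw [this]; simp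
  have ha1 : ∀ i, ∑ j, w i j = 1 := fun i => by
    have := a.sum_sq_norm_inner_right (b i)
    have := b.sum_sq_norm_inner_right (a i); simp only [hwc] at this; rw [this]; simp
  have eb : ∀ j, (H + Y) (b j) - (y j : ℂ) • b j = Y (b j) := fun j => by
    rw [LinearMap.add_apply, hy]; abel
  have ea : ∀ i, H (a i) - (x i : ℂ) • a i = - Y (a i) := fun i => by
    rw [← hx, LinearMap.add_apply]; abel
  have b1 : ∀ j, ∑ i, w i j * (x i - y j) = (inner ℂ (b j) (Y (b j))).re := fun j => by
    rw [← eb]; exact spec_sum1 a _ hHY x hx _ _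
  have b2 : ∀ j, ∑ i, w i j * (x i - y j)^2 = ‖Y (b j)‖^2 := fun j => by
    rw [← eb]; exact spec_sum2 a _ hHY x hx _ _
  have a1 : ∀ i, ∑ j, w i j * (y j - x i) = - (inner ℂ (a i) (Y (a i))).re := fun i => by
    have := spec_sum1 b _ hH y hy (a i) (x i)
    simp only [hwc, ea] at this; rw [this]; simp
  have a2 : ∀ i, ∑ j, w i j * (y j - x i)^2 = ‖Y (a i)‖^2 := fun i => by
    have := spec_sum2 b _ hH y hy (a i) (x i)
    simp only [hwc, ea] at this; rw [this]; simp
  set p := ∑ j, exp (y j) * -(inner ℂ (b j) (Y (b j))).re with hp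
  set q := ∑ i, exp (x i) * -(inner ℂ (a i) (Y (a i))).re with hq
  -- all as double sums
  have eX : ∑ i, exp (x i) = ∑ i, ∑ j, w i j * exp (x i) :=
    Finset.sum_congr rfl fun i _ => by rw [← Finset.sum_mul, ha1, one_mul]
  have eY : ∑ j, exp (y j) = ∑ i, ∑ j, w i j * exp (y j) := by
    rw [Finset.sum_comm]
    exact Finset.sum_congr rfl fun i _ => by rw [← Finset.sum_mul, hb1, one_mul]
  have ep : p = ∑ i, ∑ j, w i j * (exp (y j) * (y j - x i)) := by
    rw [Finset.sum_comm, hp]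
    refine Finset.sum_congr rfl fun j _ => ?_
    rw [← b1, ← Finset.sum_neg_distrib, Finset.mul_sum]
    exact Finset.sum_congr rfl fun i _ => by ring
  have eq' : q = ∑ i, ∑ j, w i j * (exp (x i) * (y j - x i)) := by
    rw [hq]
    refine Finset.sum_congr rfl fun j _ => ?_
    rw [← a1, Finset.mul_sum]
    exact Finset.sum_congr rfl fun i _ => by ring
  have ep2 : ∑ i, ∑ j, w i j * (exp (y j) * (y j - x i)^2) ≤ ρ * p := by
    rw [Finset.sum_comm, hp, Finset.mul_sum]
    refine Finset.sum_le_sum fun j _ => ?_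
    calc _ = exp (y j) * ‖Y (b j)‖^2 := by
          rw [← b2, Finset.mul_sum]; exact Finset.sum_congr rfl fun i _ => by ring
      _ ≤ exp (y j) * (ρ * -(inner ℂ (b j) (Y (b j))).re) := by gcongr; exact hY2 _
      _ = _ := by ring
  have eq2 : ∑ i, ∑ j, w i j * (exp (x i) * (y j - x i)^2) ≤ ρ * q := by
    rw [hq, Finset.mul_sum]
    refine Finset.sum_le_sum fun i _ => ?_
    calc _ = exp (x i) * ‖Y (a i)‖^2 := by
          rw [← a2, Finset.mul_sum]; exact Finset.sum_congr rfl fun i _ => by ring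
      _ ≤ exp (x i) * (ρ * -(inner ℂ (a i) (Y (a i))).re) := by gcongr; exact hY2 _
      _ = _ := by ring
  have hqp : q ≤ p := by
    rw [ep, eq']
    refine Finset.sum_le_sum fun i _ => Finset.sum_le_sum fun j _ => ?_
    apply mul_le_mul_of_nonneg_left _ (hw0 i j)
    rcases le_total (x i) (y j) with h | h
    · exact mul_le_mul_of_nonneg_right (exp_le_exp.2 h) (by linarith)
    · exact mul_le_mul_of_nonpos_right (exp_le_exp.2 h) (by linarith)
  have main : ∑ i, exp (x i) ≤ ∑ j, exp (y j) - p
      + (∑ i, ∑ j, w i j * (exp (y j) * (y j - x i)^2)) / 3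
      + (∑ i, ∑ j, w i j * (exp (x i) * (y j - x i)^2)) / 6 := by
    rw [eX, eY, ep, Finset.sum_div, Finset.sum_div, ← Finset.sum_sub_distrib,
      ← Finset.sum_add_distrib, ← Finset.sum_add_distrib]
    refine Finset.sum_le_sum fun i _ => ?_
    rw [Finset.sum_div, Finset.sum_div, ← Finset.sum_sub_distrib,
      ← Finset.sum_add_distrib, ← Finset.sum_add_distrib]
    refine Finset.sum_le_sum fun j _ => ?_
    have k := mul_le_mul_of_nonneg_left (exp_key (x i - y j)) (exp_pos (y j)).le
    have ee : exp (x i) = exp (y j) * exp (x i - y j) := by rw [← exp_add]; ring_nf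
    have := mul_le_mul_of_nonneg_left k (hw0 i j)
    rw [ee]
    linarith
  have : ρ * q ≤ ρ * p := by gcongr
  linarith

open Classical in
/-- The trace exponential of a symmetric operator. -/
noncomputable def trexp [FiniteDimensional ℂ E] (T : E →ₗ[ℂ] E) : ℝ :=
  if h : T.IsSymmetric then ∑ i, exp (h.eigenvalues rfl i) else 0

lemma chernoff_count {F : Type*} [NormedAddCommGroup F] [InnerProductSpace ℂ F]
    [FiniteDimensional ℂ E] [FiniteDimensional ℂ F]
    {n m : ℕ} (hn : 0 < n) (A : Fin n → E →ₗ[ℂ] F) (R γ : ℝ) (hR : 0 < R) (hγ : 0 ≤ γ)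
    (hA : ∀ u, ∑ j, ‖A j u‖ ^ 2 = ‖u‖ ^ 2)
    (hAR : ∀ j w, ‖(A j).adjoint w‖ ^ 2 ≤ R * ‖w‖ ^ 2) :
    (Set.ncard {ω : Fin m → Fin n | ∃ u : E,
        ∑ k, ‖A (ω k) u‖ ^ 2 < (1 - γ) * (m / n) * ‖u‖ ^ 2} : ℝ)
      ≤ Module.finrank ℂ E * exp (-(m / n * γ ^ 2 / (2 * R))) * n ^ m := by
  have hn' : (0:ℝ) < n := by exact_mod_cast hn
  set θ := γ / R with hθ
  have hθ0 : 0 ≤ θ := by positivity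
  set Y : Fin n → E →ₗ[ℂ] E := fun j => (-(θ:ℂ)) • ((A j).adjoint ∘ₗ (A j)) with hY
  have hYi : ∀ j u v, inner ℂ u (Y j v) = -(θ:ℂ) * inner ℂ (A j u) (A j v) := by
    intro j u v
    simp only [hY, LinearMap.smul_apply, LinearMap.comp_apply, inner_smul_right,
      LinearMap.adjoint_inner_right]
  have hYre : ∀ j u, -(inner ℂ u (Y j u)).re = θ * ‖A j u‖ ^ 2 := by
    intro j u
    rw [hYi, ← Complex.ofReal_neg, Complex.re_ofReal_mul, re_inner_self']; ring
  have hYs : ∀ j, (Y j).IsSymmetric := by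
    intro j u v
    rw [hYi, ← inner_conj_symm, hYi, map_mul, inner_conj_symm]; simp
  have hY2 : ∀ j u, ‖Y j u‖ ^ 2 ≤ (θ * R) * -(inner ℂ u (Y j u)).re := by
    intro j u
    rw [hYre]
    have : ‖Y j u‖ = θ * ‖(A j).adjoint (A j u)‖ := by
      simp only [hY, LinearMap.smul_apply, LinearMap.comp_apply]
      rw [norm_smul]; simp [abs_of_nonneg hθ0]
    rw [this, mul_pow]
    calc _ ≤ θ^2 * (R * ‖A j u‖^2) := by gcongr; exact hAR _ _
      _ = _ := by ring
  set κ := θ * (1 - θ * R / 2) / n with hκ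
  have step : ∀ s : E →ₗ[ℂ] E, s.IsSymmetric → ∑ j, trexp (s + Y j) ≤ (n * exp (-κ)) * trexp s := by
    intro s hs
    have h1 : ∀ j, trexp (s + Y j) ≤ trexp s - (1 - θ * R / 2) *
        ∑ i, exp (hs.eigenvalues rfl i) * (θ * ‖A j (hs.eigenvectorBasis rfl i)‖^2) := by
      intro j
      have hsj := hs.add (hYs j)
      have := trexp_step (hsj.eigenvectorBasis rfl) (hs.eigenvectorBasis rfl) s (Y j) hs hsj
        (hsj.eigenvalues rfl) (hs.eigenvalues rfl) (fun i => hsj.apply_eigenvectorBasis rfl i)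
        (fun i => hs.apply_eigenvectorBasis rfl i) (θ * R) (by positivity) (hY2 j)
      simp only [hYre] at this
      rw [trexp, trexp, dif_pos hsj, dif_pos hs]
      exact this
    have h2 : ∑ j, ∑ i, exp (hs.eigenvalues rfl i) * (θ * ‖A j (hs.eigenvectorBasis rfl i)‖^2)
        = θ * trexp s := by
      rw [Finset.sum_comm, trexp, dif_pos hs, Finset.mul_sum]
      refine Finset.sum_congr rfl fun i _ => ?_
      rw [← Finset.mul_sum, ← Finset.mul_sum, hA]
      simp; ring
    have h0 : 0 ≤ trexp s := by
      rw [trexp, dif_pos hs]; positivity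
    calc _ ≤ ∑ j, (trexp s - (1 - θ * R / 2) *
        ∑ i, exp (hs.eigenvalues rfl i) * (θ * ‖A j (hs.eigenvectorBasis rfl i)‖^2)) :=
          Finset.sum_le_sum fun j _ => h1 j
      _ = (n * (-κ + 1)) * trexp s := by
          rw [Finset.sum_sub_distrib, ← Finset.mul_sum, h2, hκ]
          simp
          field_simp
          ring
      _ ≤ _ := by
          gcongr
          exact add_one_le_exp (-κ)
  have it := sum_iterate (fun s : E →ₗ[ℂ] E => s.IsSymmetric) trexp Y
    (n * exp (-κ)) (by positivity)
    (fun s j hs => hs.add (hYs j)) step m 0 (by intro u v; simp)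
  set g := (1 - γ) * (m / n : ℝ) with hg
  have hnn : ∀ T : E →ₗ[ℂ] E, 0 ≤ trexp T := by
    intro T; rw [trexp]; split_ifs
    · positivity
    · exact le_rfl
  have mk := markov_count (fun ω : Fin m → Fin n =>
      exp (θ * g) * trexp (0 + ∑ k, Y (ω k)))
    (fun ω => mul_nonneg (exp_pos _).le (hnn _)) {ω : Fin m → Fin n | ∃ u : E,
        ∑ k, ‖A (ω k) u‖ ^ 2 < g * ‖u‖ ^ 2} (by
      rintro ω ⟨u, hu⟩
      have hS : (0 + ∑ k, Y (ω k)).IsSymmetric := by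
        rw [zero_add]
        intro u v
        simp only [LinearMap.sum_apply, sum_inner, inner_sum]
        exact Finset.sum_congr rfl fun k _ => hYs _ u v
      rw [trexp, dif_pos hS]
      obtain ⟨i, hi⟩ : ∃ i, -(θ * g) ≤ hS.eigenvalues rfl i := by
        by_contra hcon
        push Not at hcon
        have e1 := spec_sum1 (hS.eigenvectorBasis rfl) _ hS (hS.eigenvalues rfl)
          (fun i => hS.apply_eigenvectorBasis rfl i) u (-(θ * g))
        have e2 := (hS.eigenvectorBasis rfl).sum_sq_norm_inner_right u
        have e3 : (inner ℂ u ((0 + ∑ k, Y (ω k)) u - ((-(θ * g) : ℝ) : ℂ) • u)).re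
            = θ * (g * ‖u‖^2 - ∑ k, ‖A (ω k) u‖ ^ 2) := by
          rw [zero_add, inner_sub_right, LinearMap.sum_apply, inner_sum, Complex.sub_re,
            Complex.re_sum, inner_smul_right, Complex.re_ofReal_mul]
          have : ∀ k, (inner ℂ u (Y (ω k) u)).re = -(θ * ‖A (ω k) u‖ ^ 2) := fun k => by
            rw [← hYre]; ring
          simp only [this]
          rw [Finset.sum_neg_distrib, ← Finset.mul_sum, re_inner_self']
          ring
        have e4 : ∑ i, ‖inner ℂ (hS.eigenvectorBasis rfl i) u‖ ^ 2 *
            (hS.eigenvalues rfl i - -(θ * g)) ≤ 0 :=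
          Finset.sum_nonpos fun i _ => mul_nonpos_of_nonneg_of_nonpos (by positivity)
            (by linarith [hcon i])
        rw [e1, e3] at e4
        -- u nonzero
        have hupos : 0 < ‖u‖ ^ 2 := by
          rcases eq_or_ne u 0 with h | h
          · rw [h] at hu; simp at hu
          · positivity
        rw [← e2] at hupos
        obtain ⟨i, -, hi⟩ := Finset.exists_ne_zero_of_sum_ne_zero hupos.ne'
        have e5 : ∑ i, ‖inner ℂ (hS.eigenvectorBasis rfl i) u‖ ^ 2 *
            (hS.eigenvalues rfl i - -(θ * g)) < 0 := by
          refine Finset.sum_neg' ?_ ⟨i, Finset.mem_univ i, ?_⟩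
          · intro j _
            exact mul_nonpos_of_nonneg_of_nonpos (by positivity) (by linarith [hcon j])
          · exact mul_neg_of_pos_of_neg (lt_of_le_of_ne (by positivity) (Ne.symm hi))
              (by linarith [hcon i])
        rw [e1, e3] at e5
        have : 0 ≤ θ * (g * ‖u‖^2 - ∑ k, ‖A (ω k) u‖ ^ 2) :=
          mul_nonneg hθ0 (by linarith)
        linarith
      calc (1:ℝ) ≤ exp (θ * g) * exp (hS.eigenvalues rfl i) := by
            rw [← exp_add]; exact one_le_exp (by linarith)
        _ ≤ _ := by
            gcongr
            exact Finset.single_le_sum (f := fun i => exp (hS.eigenvalues rfl i))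
              (fun i _ => (exp_pos _).le) (Finset.mem_univ i))
  refine mk.trans ?_
  rw [← Finset.mul_sum]
  refine (mul_le_mul_of_nonneg_left it (exp_pos _).le).trans (le_of_eq ?_)
  have h0s : (0 : E →ₗ[ℂ] E).IsSymmetric := by intro u v; simp
  have ht0 : trexp (0 : E →ₗ[ℂ] E) = Module.finrank ℂ E := by
    have hz : ∀ i, h0s.eigenvalues rfl i = 0 := by
      intro i
      have := h0s.apply_eigenvectorBasis rfl i
      have h2 := (h0s.eigenvectorBasis rfl).orthonormal.ne_zero i
      simp only [LinearMap.zero_apply] at this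
      simpa [h2] using this.symm
    rw [trexp, dif_pos h0s]
    simp [hz]
  rw [ht0, mul_pow, ← exp_nat_mul]
  have : exp (-(m / n * γ ^ 2 / (2 * R))) = exp (θ * g) * exp (m * -κ) := by
    rw [← exp_add]; congr 1
    rw [hg, hκ, hθ]; field_simp; ring
  rw [this]; ring

end MatrixChernoff

lemma bernstein_count' {n m : ℕ} (hn : 0 < n) (hm : 0 < m) (X : Fin n → ℝ) (b s L : ℝ)
    (hX0 : ∑ j, X j = 0) (hXb : ∀ j, X j ≤ b) (hb : 0 ≤ b) (hX2 : ∑ j, X j ^ 2 ≤ n * s)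
    (hs : 0 ≤ s) (hL : 0 < L) :
    (Set.ncard {ω : Fin m → Fin n | √(2 * (m * s) * L) + b * L / 3 < ∑ k, X (ω k)} : ℝ)
      ≤ exp (-L) * n ^ m := by
  have hm' : (0:ℝ) < m := by exact_mod_cast hm
  rcases eq_or_lt_of_le hs with h | h
  · rw [← h, mul_zero] at hX2
    have hz : ∀ j, X j = 0 := by
      intro j
      have h1 : X j ^ 2 ≤ ∑ j, X j ^ 2 :=
        Finset.single_le_sum (f := fun j => X j ^ 2) (fun i _ => sq_nonneg _) (Finset.mem_univ j)
      exact pow_eq_zero_iff (two_ne_zero) |>.1 (le_antisymm (h1.trans hX2) (sq_nonneg _))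
    have : {ω : Fin m → Fin n | √(2 * (m * s) * L) + b * L / 3 < ∑ k, X (ω k)} = ∅ := by
      ext ω
      simp only [Set.mem_ofPred_eq, Set.mem_empty_iff_false, iff_false, not_lt, hz]
      simp; positivity
    rw [this]; simp; positivity
  · exact bernstein_count hn X b s L hX0 hXb hb hX2 (by positivity) hL

lemma toEuclideanLin_adjoint_bound {p q : ℕ} (A : Matrix (Fin p) (Fin q) ℂ)
    (w : EuclideanSpace ℂ (Fin p)) :
    ‖(toEuclideanLin A).adjoint w‖ ^ 2 ≤ (∑ i, ∑ l, ‖A i l‖ ^ 2) * ‖w‖ ^ 2 := by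
  rw [← Matrix.toEuclideanLin_conjTranspose_eq_adjoint, EuclideanSpace.norm_sq_eq,
    EuclideanSpace.norm_sq_eq w, Finset.sum_comm, Finset.sum_mul]
  refine Finset.sum_le_sum fun l _ => ?_
  have e : (toEuclideanLin Aᴴ w) l = ∑ i, star (A i l) * w i := by
    simp [Matrix.toLpLin_apply, Matrix.mulVec, dotProduct]
  rw [e]
  calc ‖∑ i, star (A i l) * w i‖ ^ 2 ≤ (∑ i, ‖A i l‖ * ‖w i‖) ^ 2 := by
        gcongr
        refine (norm_sum_le _ _).trans (le_of_eq ?_)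
        simp
    _ ≤ _ := Finset.sum_mul_sq_le_sq_mul_sq _ _ _

lemma residual_facts {p q m : ℕ} (A : Fin m → Matrix (Fin p) (Fin q) ℂ) (b : Fin m → Fin p → ℂ)
    (g : ℝ) (hg : 0 < g)
    (h : ∀ u : EuclideanSpace ℂ (Fin q), g * ‖u‖ ^ 2 ≤ ∑ k, ‖toEuclideanLin (A k) u‖ ^ 2)
    (G : Matrix (Fin q) (Fin q) ℂ) (hG : G = ∑ k, (A k)ᴴ * A k)
    (v : Fin q → ℂ) (hv : v = ∑ k, (A k)ᴴ *ᵥ b k) :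
    IsUnit G ∧ 0 ≤ (star v ⬝ᵥ (G⁻¹ *ᵥ v)).re ∧
    (star v ⬝ᵥ (G⁻¹ *ᵥ v)).re ≤ ∑ k, ∑ i, ‖b k i‖ ^ 2 ∧
    (star v ⬝ᵥ (G⁻¹ *ᵥ v)).re
      ≤ ‖∑ k, (toEuclideanLin (A k)).adjoint (WithLp.toLp 2 (b k))‖ ^ 2 / g := by
  have hGv : ∀ u w : EuclideanSpace ℂ (Fin q), inner ℂ w (toEuclideanLin G u)
      = ∑ k, inner ℂ (toEuclideanLin (A k) w) (toEuclideanLin (A k) u) := by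
    intro u w
    have : toEuclideanLin G u = ∑ k, (toEuclideanLin (A k)).adjoint (toEuclideanLin (A k) u) := by
      rw [hG, map_sum, LinearMap.sum_apply]
      refine Finset.sum_congr rfl fun k _ => ?_
      rw [← Matrix.toEuclideanLin_conjTranspose_eq_adjoint]
      simp [Matrix.toLpLin_apply, Matrix.mulVec_mulVec]
    rw [this, inner_sum]
    exact Finset.sum_congr rfl fun k _ => LinearMap.adjoint_inner_right _ _ _
  have hGu : ∀ u : EuclideanSpace ℂ (Fin q), (inner ℂ u (toEuclideanLin G u)).re
      = ∑ k, ‖toEuclideanLin (A k) u‖ ^ 2 := by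
    intro u; rw [hGv, Complex.re_sum]
    exact Finset.sum_congr rfl fun k _ => re_inner_self' _
  have hunit : IsUnit G := by
    rw [← Matrix.mulVec_injective_iff_isUnit]
    refine (injective_iff_map_eq_zero G.mulVecLin).2 fun u hu => ?_
    have h1 := h (WithLp.toLp 2 u)
    rw [← hGu] at h1
    have : toEuclideanLin G (WithLp.toLp 2 u) = 0 := by
      rw [Matrix.toLpLin_apply]; simpa using hu
    rw [this, inner_zero_right, Complex.zero_re] at h1
    have h2 : ‖WithLp.toLp 2 u‖ ^ 2 ≤ 0 := by
      by_contra hc; push Not at hc; nlinarith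
    have h3 : ‖WithLp.toLp 2 u‖ = 0 := by
      exact pow_eq_zero_iff (two_ne_zero) |>.1 (le_antisymm h2 (sq_nonneg _))
    simpa using h3
  set x : EuclideanSpace ℂ (Fin q) := WithLp.toLp 2 (G⁻¹ *ᵥ v) with hx
  set v' : EuclideanSpace ℂ (Fin q) := WithLp.toLp 2 v with hv'
  have hGx : toEuclideanLin G x = v' := by
    rw [hx, Matrix.toLpLin_apply, Matrix.mulVec_mulVec,
      Matrix.mul_nonsing_inv _ ((Matrix.isUnit_iff_isUnit_det G).1 hunit), Matrix.one_mulVec]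
  have hvsum : v' = ∑ k, (toEuclideanLin (A k)).adjoint (WithLp.toLp 2 (b k)) := by
    rw [hv', hv, WithLp.toLp_sum]
    refine Finset.sum_congr rfl fun k _ => ?_
    rw [← Matrix.toEuclideanLin_conjTranspose_eq_adjoint, Matrix.toLpLin_apply]
  have hr : star v ⬝ᵥ (G⁻¹ *ᵥ v) = inner ℂ v' x := by
    rw [EuclideanSpace.inner_eq_star_dotProduct, dotProduct_comm]
  rw [hr]
  have hr1 : (inner ℂ v' x).re = ∑ k, ‖toEuclideanLin (A k) x‖ ^ 2 := by
    rw [← hGu, hGx, ← inner_conj_symm, Complex.conj_re]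
  have hr2 : (inner ℂ v' x).re
      = ∑ k, (inner ℂ (WithLp.toLp 2 (b k)) (toEuclideanLin (A k) x)).re := by
    rw [hvsum, sum_inner, Complex.re_sum]
    refine Finset.sum_congr rfl fun k _ => ?_
    rw [LinearMap.adjoint_inner_left]
  have h0 : 0 ≤ (inner ℂ v' x).re := by rw [hr1]; positivity
  refine ⟨hunit, h0, ?_, ?_⟩
  · have : 2 * (inner ℂ v' x).re ≤ ∑ k, ∑ i, ‖b k i‖ ^ 2 + (inner ℂ v' x).re := by
      nth_rw 2 [hr1]
      rw [hr2, ← Finset.sum_add_distrib, Finset.mul_sum]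
      refine Finset.sum_le_sum fun k _ => ?_
      have h1 := @norm_sub_sq ℂ _ _ _ _ (WithLp.toLp 2 (b k)) (toEuclideanLin (A k) x)
      have h2 := sq_nonneg ‖WithLp.toLp 2 (b k) - (toEuclideanLin (A k)) x‖
      rw [h1, EuclideanSpace.norm_sq_eq] at h2
      simp only [RCLike.re_to_complex] at h2
      linarith
    linarith
  · rw [← hvsum, le_div_iff₀ hg]
    have h1 : (inner ℂ v' x).re ≤ ‖v'‖ * ‖x‖ :=
      (Complex.re_le_norm _).trans (norm_inner_le_norm _ _)
    have h2 := h x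
    rw [← hr1] at h2
    set r := (inner ℂ v' x).re
    rcases eq_or_lt_of_le h0 with h3 | h3
    · rw [← h3]; simp
    · have h4 : r * r ≤ (‖v'‖ * ‖x‖) * (‖v'‖ * ‖x‖) := mul_self_le_mul_self h0 h1
      have h5 : r * (r * g) ≤ r * ‖v'‖ ^ 2 := by
        calc r * (r * g) ≤ (‖v'‖ * ‖x‖) * (‖v'‖ * ‖x‖) * g := by nlinarith
          _ = ‖v'‖ ^ 2 * (g * ‖x‖^2) := by ring
          _ ≤ ‖v'‖ ^ 2 * r := by gcongr
          _ = _ := by ring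
      exact le_of_mul_le_mul_left h5 h3

lemma isometry_sum {p q n : ℕ} (A : Fin n → Matrix (Fin p) (Fin q) ℂ)
    (hA : ∑ j, (A j)ᴴ * A j = 1) (u : EuclideanSpace ℂ (Fin q)) :
    ∑ j, ‖toEuclideanLin (A j) u‖ ^ 2 = ‖u‖ ^ 2 := by
  have h1 : u = ∑ k, (toEuclideanLin (A k)).adjoint (toEuclideanLin (A k) u) := by
    have : toEuclideanLin (1 : Matrix (Fin q) (Fin q) ℂ) u = u := by simp
    conv_lhs => rw [← this, ← hA]
    rw [map_sum, LinearMap.sum_apply]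
    refine Finset.sum_congr rfl fun k _ => ?_
    rw [← Matrix.toEuclideanLin_conjTranspose_eq_adjoint]
    simp [Matrix.toLpLin_apply, Matrix.mulVec_mulVec]
  rw [← re_inner_self' u]
  conv_rhs => arg 1; arg 3; rw [h1]
  rw [inner_sum, Complex.re_sum]
  refine Finset.sum_congr rfl fun k _ => ?_
  rw [LinearMap.adjoint_inner_right, re_inner_self']

lemma one_le_of_isometry {p q n : ℕ} (hq : 0 < q) (A : Fin n → Matrix (Fin p) (Fin q) ℂ)
    (hA : ∑ j, (A j)ᴴ * A j = 1) : 1 ≤ ∑ j, ∑ i, ∑ l, ‖A j i l‖ ^ 2 := by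
  have h := isometry_sum A hA (EuclideanSpace.single (⟨0, hq⟩ : Fin q) 1)
  rw [EuclideanSpace.norm_single] at h
  simp only [norm_one, one_pow] at h
  rw [← h]
  refine Finset.sum_le_sum fun j _ => ?_
  rw [EuclideanSpace.norm_sq_eq]
  refine Finset.sum_le_sum fun i _ => ?_
  have e : (toEuclideanLin (A j) (EuclideanSpace.single (⟨0, hq⟩ : Fin q) 1)) i = A j i ⟨0, hq⟩ := by
    simp [Matrix.toLpLin_apply]
  rw [e]
  exact Finset.single_le_sum (f := fun l => ‖A j i l‖ ^ 2) (fun _ _ => sq_nonneg _) (Finset.mem_univ _)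

lemma numeric_tail (L r : ℝ) (hL : 1 ≤ L) (hr : 0 ≤ r) (hrL : r * L ≤ 3 / 4) :
    √(2 * (L + log 2)) + √r * (L + log 2) / 3 ≤ 9 / 5 * √L + 1 := by
  set l := √L with hl
  have hl2 : L = l ^ 2 := (sq_sqrt (by linarith)).symm
  have hl1 : 1 ≤ l := by rw [hl]; exact one_le_sqrt.2 hL
  have h2 : log 2 ≤ 0.6932 := by have := log_two_lt_d9; linarith
  have h20 : 0 < log 2 := log_pos (by norm_num)
  have e1 : √(2 * (L + log 2)) ≤ 1.42 * l + 0.5 := by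
    apply sqrt_le_iff.2 ⟨by positivity, ?_⟩
    rw [hl2]; nlinarith
  have e2 : √r * l ≤ 0.87 := by
    rw [hl, ← sqrt_mul hr]
    apply sqrt_le_iff.2 ⟨by norm_num, ?_⟩
    linarith
  have e3 : √r ≤ 0.87 := by nlinarith [sqrt_nonneg r]
  have e4 : √r * (L + log 2) ≤ 0.87 * l + 0.87 * 0.6932 := by
    rw [hl2, mul_add]
    have : √r * log 2 ≤ 0.87 * 0.6932 := by
      apply mul_le_mul e3 h2 h20.le (by norm_num)
    nlinarith
  linarith

lemma num_beta (L : ℝ) (hL : 0 ≤ L) :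
    4 * L ≤ (1 + 2 * √L) ^ 2 ∧ L / 3 ≤ (1 + 2 * √L) ^ 2 - (9 / 5 * √L + 1) ^ 2 := by
  have h := sq_sqrt hL
  have h' := sqrt_nonneg L
  constructor <;> nlinarith

lemma num_m {K β γ m α L : ℝ} (hK : 1 ≤ K) (hL : 0 < L) (hβ : 4 * L ≤ β) (hγ0 : 0 ≤ γ)
    (hγ1 : 0 < 1 - γ) (hm : 0 < m) (hα : 0 ≤ α) (h : 0 < m * (1 - α) - K * β / (1 - γ)) :
    α ≤ 1 ∧ 4 * L ≤ m := by
  have hKβ : 0 ≤ K * β := by apply mul_nonneg <;> linarith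
  have h1 : K * β ≤ K * β / (1 - γ) := by
    rw [le_div_iff₀ hγ1]
    nlinarith
  have h2 : β ≤ K * β := by nlinarith
  have h3 : 4 * L ≤ m * (1 - α) := by linarith
  have h4 : 0 ≤ m * α := by positivity
  constructor
  · by_contra hc
    push Not at hc
    nlinarith
  · linarith

set_option maxHeartbeats 4000000 in
/-- **Theorem 1 (tubal-sampling energy estimation, transform-domain form).**
Sampling with replacement is modeled by the uniform distribution on the finite
sample space `Fin m → Fin n₁` of index sequences, probabilities being
`#(event) / n₁ ^ m`. -/
theorem tensor_matched_subspace_tubal_energy_estimation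
    (n₁ n₂ n₃ m : ℕ) (hn₁ : 0 < n₁) (hn₂ : 0 < n₂) (hn₃ : 0 < n₃) (hm : 0 < m)
    (c μ δ : ℝ) (hc : 0 < c) (hμ : 1 ≤ μ) (hδ : 0 < δ)
    -- transform-domain block rows of the orthogonal tensor `U`
    (A : Fin n₁ → Matrix (Fin n₃) (Fin (n₂ * n₃)) ℂ)
    (hA : ∑ j, (A j)ᴴ * A j = 1)
    (hAF : ∀ j, ∑ i, ∑ l, ‖A j i l‖ ^ 2 ≤ c ^ 2 * n₂ * μ / n₁)
    -- transform-domain tubes of the signal `Y ∈ S^⊥`, not all zero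
    (b : Fin n₁ → Fin n₃ → ℂ)
    (hb : ∃ j, b j ≠ 0)
    (horth : ∑ j, (A j)ᴴ *ᵥ b j = 0)
    (B Bmax : ℝ)
    (hB : B = ∑ j, ∑ i, ‖b j i‖ ^ 2)
    (hBmax : IsGreatest (Set.range fun j => ∑ i, ‖b j i‖ ^ 2) Bmax)
    -- sample-size requirement
    (hsize : (8 / 3 : ℝ) * n₂ * μ * Real.log (2 * n₂ * n₃ / δ) ≤ m)
    (γ α β : ℝ)
    (hγ : γ = Real.sqrt (8 * c ^ 2 * n₂ * μ * Real.log (2 * n₂ * n₃ / δ) / (3 * m)))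
    (hγ1 : γ < 1)
    (hα : α = Real.sqrt (2 * (n₁ * Bmax - B) / (m * B) * Real.log (1 / δ))
            + 2 * (n₁ * Bmax - B) / (3 * m * B) * Real.log (1 / δ))
    (hβ : β = (1 + 2 * Real.sqrt (Real.log (1 / δ))) ^ 2) :
    1 - 4 * δ ≤
      (Set.ncard {ω : Fin m → Fin n₁ |
        let G : Matrix (Fin (n₂ * n₃)) (Fin (n₂ * n₃)) ℂ := ∑ k, (A (ω k))ᴴ * A (ω k)
        let v : Fin (n₂ * n₃) → ℂ := ∑ k, (A (ω k))ᴴ *ᵥ b (ω k)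
        let Q : ℝ := (∑ k, ∑ i, ‖b (ω k) i‖ ^ 2) - (star v ⬝ᵥ (G⁻¹ *ᵥ v)).re
        IsUnit G ∧
        (m * (1 - α) - c ^ 2 * n₂ * μ * β / (1 - γ)) / n₁ * B ≤ Q ∧
        Q ≤ (1 + α) * (m / n₁) * B} : ℝ) / (n₁ : ℝ) ^ m := by
  have hn₁' : (0:ℝ) < n₁ := by exact_mod_cast hn₁
  have hn₂' : (0:ℝ) < n₂ := by exact_mod_cast hn₂
  have hn₃' : (0:ℝ) < n₃ := by exact_mod_cast hn₃
  have hm' : (0:ℝ) < m := by exact_mod_cast hm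
  have hN : (0:ℝ) < (n₁:ℝ) ^ m := by positivity
  rcases le_or_gt (1/4) δ with hδ4 | hδ4
  · have : 1 - 4 * δ ≤ 0 := by linarith
    exact this.trans (by positivity)
  set S : Set (Fin m → Fin n₁) := {ω : Fin m → Fin n₁ |
        let G : Matrix (Fin (n₂ * n₃)) (Fin (n₂ * n₃)) ℂ := ∑ k, (A (ω k))ᴴ * A (ω k)
        let v : Fin (n₂ * n₃) → ℂ := ∑ k, (A (ω k))ᴴ *ᵥ b (ω k)
        let Q : ℝ := (∑ k, ∑ i, ‖b (ω k) i‖ ^ 2) - (star v ⬝ᵥ (G⁻¹ *ᵥ v)).re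
        IsUnit G ∧
        (m * (1 - α) - c ^ 2 * n₂ * μ * β / (1 - γ)) / n₁ * B ≤ Q ∧
        Q ≤ (1 + α) * (m / n₁) * B} with hS
  -- basic quantities
  set L := Real.log (1 / δ) with hLdef
  have hexpL : exp (-L) = δ := by
    rw [hLdef, one_div, Real.log_inv, neg_neg, exp_log hδ]
  have hL1 : 1 ≤ L := by
    rw [hLdef, Real.le_log_iff_exp_le (by positivity)]
    have h1 := Real.exp_one_lt_d9
    have h2 : 4 ≤ 1 / δ := by rw [le_div_iff₀ hδ]; linarith
    linarith
  have hL0 : 0 < L := by linarith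
  set K : ℝ := c ^ 2 * n₂ * μ with hK
  have hK1 : 1 ≤ K := by
    refine (one_le_of_isometry (Nat.mul_pos hn₂ hn₃) A hA).trans ?_
    refine (Finset.sum_le_sum fun j _ => hAF j).trans (le_of_eq ?_)
    simp; field_simp
  have hK0 : 0 < K := by linarith
  set y : Fin n₁ → ℝ := fun j => ∑ i, ‖b j i‖ ^ 2 with hy
  have hy0 : ∀ j, 0 ≤ y j := fun j => by simp only [hy]; positivity
  have hyB : ∀ j, y j ≤ Bmax := fun j => hBmax.2 ⟨j, rfl⟩
  have hBy : B = ∑ j, y j := hB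
  have hBpos : 0 < B := by
    rw [hBy]
    obtain ⟨j, hj⟩ := hb
    refine Finset.sum_pos' (fun j _ => hy0 j) ⟨j, Finset.mem_univ j, ?_⟩
    obtain ⟨i, hi⟩ := Function.ne_iff.1 hj
    refine Finset.sum_pos' (fun i _ => by positivity) ⟨i, Finset.mem_univ i, ?_⟩
    have : 0 < ‖b j i‖ := norm_pos_iff.2 hi
    positivity
  have hBn : B ≤ n₁ * Bmax := by
    rw [hBy]
    refine (Finset.sum_le_sum fun j _ => hyB j).trans (le_of_eq ?_)
    simp
  have hBmax0 : 0 < Bmax := by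
    by_contra hc; push Not at hc
    nlinarith
  -- the scalar deviations
  set X : Fin n₁ → ℝ := fun j => y j - B / n₁ with hX
  have hX0 : ∑ j, X j = 0 := by
    simp only [hX]; rw [Finset.sum_sub_distrib, ← hBy]; simp; field_simp; simp
  set s : ℝ := B * (n₁ * Bmax - B) / n₁ ^ 2 with hs
  have hs0 : 0 ≤ s := by
    rw [hs]; apply div_nonneg (mul_nonneg hBpos.le (by linarith)) (by positivity)
  have hX2 : ∑ j, X j ^ 2 ≤ n₁ * s := by
    have e : ∀ j, X j ^ 2 ≤ Bmax * y j - 2 * (B / n₁) * y j + (B / n₁) ^ 2 := by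
      intro j; simp only [hX]
      nlinarith [mul_le_mul_of_nonneg_right (hyB j) (hy0 j)]
    refine (Finset.sum_le_sum fun j _ => e j).trans (le_of_eq ?_)
    rw [Finset.sum_add_distrib, Finset.sum_sub_distrib, ← Finset.mul_sum, ← Finset.mul_sum, ← hBy]
    simp [hs]; field_simp; ring
  have hαm : α * m * B / n₁ = √(2 * (m * s) * L) + 2 * ((Bmax - B / n₁) * L / 3) := by
    rw [hα, hs]
    have : √(2 * (m * (B * (n₁ * Bmax - B) / n₁ ^ 2)) * L)
        = √(2 * (n₁ * Bmax - B) / (m * B) * L) * (m * B / n₁) := by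
      rw [← sqrt_sq (show 0 ≤ m * B / n₁ by positivity), ← sqrt_mul' _ (by positivity)]
      congr 1
      field_simp
    rw [this]; field_simp
  have hb1 : 0 ≤ Bmax - B / n₁ := by
    rw [sub_nonneg, div_le_iff₀ hn₁']; linarith
  have hα0 : 0 ≤ α := by
    rw [hα]
    have : 0 ≤ n₁ * Bmax - B := by linarith
    positivity
  have hγ0 : 0 ≤ γ := by rw [hγ]; positivity
  -- bad event 1 and 2
  have bad1 := bernstein_count' (m := m) hn₁ hm X (Bmax - B / n₁) s L hX0
    (fun j => by simp only [hX]; linarith [hyB j]) hb1 hX2 hs0 hL0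
  have bad2 := bernstein_count' (m := m) hn₁ hm (fun j => - X j) (B / n₁) s L (by simp [hX0])
    (fun j => by simp only [hX]; linarith [hy0 j]) (by positivity) (by simpa using hX2) hs0 hL0
  set S1 := {ω : Fin m → Fin n₁ |
    √(2 * (m * s) * L) + (Bmax - B / n₁) * L / 3 < ∑ k, X (ω k)} with hS1
  set S2 := {ω : Fin m → Fin n₁ |
    √(2 * (m * s) * L) + (B / n₁) * L / 3 < ∑ k, - X (ω k)} with hS2
  -- bad event 4
  have bad4 := chernoff_count (m := m) hn₁ (fun j => toEuclideanLin (A j)) (K / n₁) γ (by positivity)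
    hγ0 (isometry_sum A hA) (fun j w => (toEuclideanLin_adjoint_bound (A j) w).trans
      (mul_le_mul_of_nonneg_right (hAF j) (by positivity)))
  set S4 := {ω : Fin m → Fin n₁ | ∃ u : EuclideanSpace ℂ (Fin (n₂ * n₃)),
        ∑ k, ‖toEuclideanLin (A (ω k)) u‖ ^ 2 < (1 - γ) * (m / n₁) * ‖u‖ ^ 2} with hS4
  have bad4' : (S4.ncard : ℝ) ≤ δ * n₁ ^ m := by
    refine bad4.trans ?_
    apply mul_le_mul_of_nonneg_right _ hN.le
    rw [finrank_euclideanSpace, Fintype.card_fin]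
    set ld := Real.log (2 * n₂ * n₃ / δ) with hld
    have hn2 : (1:ℝ) ≤ n₂ := by exact_mod_cast hn₂
    have hn3 : (1:ℝ) ≤ n₃ := by exact_mod_cast hn₃
    have hld0 : 0 ≤ ld := by
      apply Real.log_nonneg
      rw [le_div_iff₀ hδ, mul_assoc]
      have := one_le_mul_of_one_le_of_one_le hn2 hn3
      linarith
    have hγ2 : γ ^ 2 = 8 * K * ld / (3 * m) := by
      rw [hγ, sq_sqrt]
      · rw [hK]; ring
      · have : 8 * c ^ 2 * n₂ * μ * ld / (3 * m) = 8 * K * ld / (3 * m) := by rw [hK]; ring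
        rw [this]; positivity
    have e : -((m:ℝ) / n₁ * γ ^ 2 / (2 * (K / n₁))) ≤ -ld := by
      have : (m:ℝ) / n₁ * γ ^ 2 / (2 * (K / n₁)) = 4 / 3 * ld := by
        rw [hγ2]; field_simp; ring
      rw [this]; linarith
    calc ((n₂ * n₃ : ℕ) : ℝ) * exp (-((m:ℝ) / n₁ * γ ^ 2 / (2 * (K / n₁))))
        ≤ ((n₂ * n₃ : ℕ) : ℝ) * exp (-ld) := by gcongr
      _ = δ / 2 := by
        rw [Real.exp_neg, hld, Real.exp_log (by positivity)]
        push_cast; field_simp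
      _ ≤ δ := by linarith
  -- bad event 3
  set LB : ℝ := m * (1 - α) - K * β / (1 - γ) with hLB
  set τ : ℝ := 9 / 5 * √L + 1 with hτ
  set W : Fin n₁ → EuclideanSpace ℂ (Fin (n₂ * n₃)) :=
    fun j => (toEuclideanLin (A j)).adjoint (WithLp.toLp 2 (b j)) with hW
  set V : ℝ := m * (K * B / n₁ ^ 2) with hV
  have hV0 : 0 < V := by positivity
  have hLs : √L ^ 2 = L := sq_sqrt hL0.le
  have hβK : 4 * L ≤ β := by
    rw [hβ]; exact (num_beta L hL0.le).1
  obtain ⟨S3, bad3, hS3⟩ : ∃ S3 : Set (Fin m → Fin n₁), (S3.ncard : ℝ) ≤ δ * n₁ ^ m ∧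
      ∀ ω, ω ∉ S3 → LB ≤ 0 ∨ ‖∑ k, W (ω k)‖ ^ 2 ≤ τ ^ 2 * V := by
    rcases le_or_gt LB 0 with hLB0 | hLB0
    · exact ⟨∅, by simp; positivity, fun ω _ => Or.inl hLB0⟩
    · have hWsq : ∀ j, ‖W j‖ ^ 2 ≤ K / n₁ * y j := by
        intro j
        have h1 := (toEuclideanLin_adjoint_bound (A j) (WithLp.toLp 2 (b j)))
        rw [EuclideanSpace.norm_sq_eq (WithLp.toLp 2 (b j))] at h1
        exact h1.trans (mul_le_mul_of_nonneg_right (hAF j) (hy0 j))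
      have hW0 : ∑ j, W j = 0 := by
        have : ∀ j, W j = WithLp.toLp 2 ((A j)ᴴ *ᵥ b j) := fun j => by
          simp only [hW]
          rw [← Matrix.toEuclideanLin_conjTranspose_eq_adjoint, Matrix.toLpLin_apply]
        simp only [this]
        rw [← WithLp.toLp_sum, horth]; simp
      have hWb : ∀ j, ‖W j‖ ≤ √(K / n₁ * Bmax) := fun j => by
        apply Real.le_sqrt_of_sq_le
        refine (hWsq j).trans ?_
        gcongr; exact hyB j
      have hWs : ∑ j, ‖W j‖ ^ 2 ≤ n₁ * (K * B / n₁ ^ 2) := by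
        refine (Finset.sum_le_sum fun j _ => hWsq j).trans (le_of_eq ?_)
        rw [← Finset.mul_sum, ← hBy]; field_simp
      have pc := pinelis_count (m := m) hn₁ W (√(K / n₁ * Bmax)) (K * B / n₁ ^ 2) (L + Real.log 2)
        hW0 hWb (sqrt_nonneg _) hWs hV0 (by have := Real.log_pos (show (1:ℝ) < 2 by norm_num); linarith)
      refine ⟨_, pc.trans (le_of_eq ?_), fun ω hω => Or.inr ?_⟩
      · rw [neg_add, exp_add, hexpL, Real.exp_neg, exp_log (by norm_num)]; ring
      · simp only [Set.mem_ofPred_eq, not_lt] at hω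
        -- numeric part
        have h1γ : 0 < 1 - γ := by linarith
        obtain ⟨hα1, hm4'⟩ := num_m hK1 hL0 hβK hγ0 h1γ hm' hα0 hLB0
        set r : ℝ := n₁ * Bmax / (m * B) with hr
        have hr0 : 0 ≤ r := by positivity
        have hu : 2 * (n₁ * Bmax - B) / (m * B) * L ≤ 1 := by
          have h0 : 0 ≤ n₁ * Bmax - B := by linarith
          have h1 : √(2 * (n₁ * Bmax - B) / (m * B) * L) ≤ 1 := by
            have : 0 ≤ 2 * (n₁ * Bmax - B) / (3 * m * B) * L := by positivity
            linarith
          have := (sqrt_le_iff.1 h1).2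
          linarith
        have hrL : r * L ≤ 3 / 4 := by
          have e : r * L = (2 * (n₁ * Bmax - B) / (m * B) * L) / 2 + L / m := by
            rw [hr]; field_simp; ring
          have : L / m ≤ 1 / 4 := by rw [div_le_iff₀ hm']; linarith
          rw [e]; linarith
        have nt := numeric_tail L r hL1 hr0 hrL
        have e1 : √(2 * V * (L + Real.log 2)) = √V * √(2 * (L + Real.log 2)) := by
          rw [← sqrt_mul hV0.le]; congr 1; ring
        have e2 : √(K / n₁ * Bmax) = √V * √r := by
          rw [← sqrt_mul hV0.le]; congr 1
          rw [hV, hr]; field_simp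
        rw [e1, e2] at hω
        have h3 : ‖∑ k, W (ω k)‖ ≤ √V * τ := by
          refine hω.trans ?_
          calc _ = √V * (√(2 * (L + Real.log 2)) + √r * (L + Real.log 2) / 3) := by ring
            _ ≤ _ := by gcongr
        calc ‖∑ k, W (ω k)‖ ^ 2 ≤ (√V * τ) ^ 2 := by gcongr
          _ = _ := by rw [mul_pow, sq_sqrt hV0.le]; ring
  -- the good event
  have hsub : (S1 ∪ S2 ∪ S3 ∪ S4)ᶜ ⊆ S := by
    intro ω hω
    simp only [Set.mem_compl_iff, Set.mem_union, not_or] at hω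
    obtain ⟨⟨⟨h1, h2⟩, h3⟩, h4⟩ := hω
    simp only [hS1, Set.mem_ofPred_eq, not_lt] at h1
    simp only [hS2, Set.mem_ofPred_eq, not_lt, Finset.sum_neg_distrib] at h2
    simp only [hS4, Set.mem_ofPred_eq, not_exists, not_lt] at h4
    have h1γ : 0 < 1 - γ := by linarith
    set g := (1 - γ) * (m / n₁ : ℝ) with hg
    have hg0 : 0 < g := by positivity
    obtain ⟨f1, f2, f3, f4⟩ := residual_facts (fun k => A (ω k)) (fun k => b (ω k)) g hg0 h4 _ rfl _ rfl
    have hsumX : ∑ k, X (ω k) = ∑ k, ∑ i, ‖b (ω k) i‖ ^ 2 - m * B / n₁ := by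
      simp only [hX, hy]; rw [Finset.sum_sub_distrib]; simp; ring
    have hbL : 0 ≤ (Bmax - B / n₁) * L / 3 := by positivity
    refine ⟨f1, ?_, ?_⟩
    · rcases hS3 ω h3 with h | h
      · have : LB / n₁ * B ≤ 0 := by
          apply mul_nonpos_of_nonpos_of_nonneg _ hBpos.le
          exact div_nonpos_of_nonpos_of_nonneg h hn₁'.le
        exact this.trans (by linarith)
      · have h5 := f4.trans (div_le_div_of_nonneg_right h hg0.le)
        have e1 : τ ^ 2 * V / g = τ ^ 2 * (K / (1 - γ)) * (B / n₁) := by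
          rw [hV, hg]; field_simp
        have e2 : LB / n₁ * B = m * B / n₁ - α * m * B / n₁ - β * (K / (1 - γ)) * (B / n₁) := by
          rw [hLB]; ring
        rw [e1] at h5
        rw [e2]
        have hKγ : 1 ≤ K / (1 - γ) := by rw [le_div_iff₀ h1γ]; linarith
        have hβτ : L / 3 ≤ β - τ ^ 2 := by
          rw [hβ, hτ]; exact (num_beta L hL0.le).2
        have h6 : L / 3 ≤ (β - τ ^ 2) * (K / (1 - γ)) :=
          hβτ.trans (le_mul_of_one_le_right (by linarith) hKγ)
        have h7 : L / 3 * (B / n₁) ≤ (β - τ ^ 2) * (K / (1 - γ)) * (B / n₁) := by gcongr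
        linarith
    · have e2 : (1 + α) * (m / n₁) * B = m * B / n₁ + α * m * B / n₁ := by ring
      rw [e2]
      linarith
  have hcount : ((S1 ∪ S2 ∪ S3 ∪ S4).ncard : ℝ) ≤ 4 * δ * n₁ ^ m := by
    have u1 := Set.ncard_union_le (S1 ∪ S2 ∪ S3) S4
    have u2 := Set.ncard_union_le (S1 ∪ S2) S3
    have u3 := Set.ncard_union_le S1 S2
    have : (S1 ∪ S2 ∪ S3 ∪ S4).ncard ≤ S1.ncard + S2.ncard + S3.ncard + S4.ncard := by omega
    have h' : ((S1 ∪ S2 ∪ S3 ∪ S4).ncard : ℝ) ≤ S1.ncard + S2.ncard + S3.ncard + S4.ncard := by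
      exact_mod_cast this
    rw [hexpL] at bad1 bad2
    linarith
  have hcompl := Set.ncard_add_ncard_compl (S1 ∪ S2 ∪ S3 ∪ S4)
  have hle := Set.ncard_le_ncard hsub (Set.toFinite S)
  have hcard : (Nat.card (Fin m → Fin n₁) : ℝ) = n₁ ^ m := by simp
  rw [le_div_iff₀ hN]
  have h1 : ((S1 ∪ S2 ∪ S3 ∪ S4).ncard : ℝ) + ((S1 ∪ S2 ∪ S3 ∪ S4)ᶜ.ncard : ℝ) = n₁ ^ m := by
    rw [← hcard]; exact_mod_cast hcompl
  have h2 : ((S1 ∪ S2 ∪ S3 ∪ S4)ᶜ.ncard : ℝ) ≤ S.ncard := by exact_mod_cast hle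
  linarith
end

section
/- Theorem 2 (elementwise-sampling energy estimation). Let δ > 0 and suppose the sample size m satisfies m ≥ (8/3)·d·μ(S)·log(2d/δ) and γ := √(8dμ(S)·log(2d/δ)/(3m)) < 1. Let y ∈ ℝ^N be a nonzero vector with Uᵀy = 0, and define α := √(2(N‖y‖_∞² − ‖y‖₂²)/(m‖y‖₂²)·log(1/δ)) + (2(N‖y‖_∞² − ‖y‖₂²)/(3m‖y‖₂²))·log(1/δ) and β := (1 + 2√(log(1/δ)))². Then with probability at least 1 − 4δ the matrix U_Ωᵀ U_Ω is invertible and, with P_Ω := U_Ω (U_Ωᵀ U_Ω)⁻¹ U_Ωᵀ, ((m(1−α) − dμ(S)·β/(1−γ))/N)·‖y‖₂² ≤ ‖y_Ω − P_Ω y_Ω‖₂² ≤ (1+α)·(m/N)·‖y‖₂². -/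
open Matrix
open scoped BigOperators

lemma aux_exp_bound (u : ℝ) : (1 - u / 3) * (Real.exp u - 1 - u) ≤ u ^ 2 / 2 := by
  set g : ℝ → ℝ := fun u => u + (1/3) * (Real.exp u - 1 - u) - (1 - u / 3) * (Real.exp u - 1) with hg
  set h : ℝ → ℝ := fun u => u ^ 2 / 2 - (1 - u / 3) * (Real.exp u - 1 - u) with hh
  have dg : ∀ u, HasDerivAt g ((1 + (u - 1) * Real.exp u) / 3) u := by
    intro u
    have h1 := (hasDerivAt_id u)
    have h2 := Real.hasDerivAt_exp u
    have := (h1.add (((h2.sub_const 1).sub h1).const_mul (1/3))).sub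
      ((((h1.div_const 3).const_sub 1)).mul (h2.sub_const 1))
    refine this.congr_deriv ?_
    simp
    ring
  have dh : ∀ u, HasDerivAt h (g u) u := by
    intro u
    have h1 := (hasDerivAt_id u)
    have h2 := Real.hasDerivAt_exp u
    have := ((h1.pow 2).div_const 2).sub
      ((((h1.div_const 3).const_sub 1)).mul ((h2.sub_const 1).sub h1))
    refine this.congr_deriv ?_
    simp [hg]
    ring
  have mg : Monotone g := by
    apply monotone_of_deriv_nonneg (fun u => (dg u).differentiableAt)
    intro u
    rw [(dg u).deriv]
    have h1 := Real.add_one_le_exp (-u)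
    have h2 := Real.exp_pos u
    have h3 : Real.exp (-u) * Real.exp u = 1 := by rw [← Real.exp_add]; simp
    nlinarith
  have g0 : g 0 = 0 := by simp [hg]
  have h0 : h 0 = 0 := by simp [hh]
  have hc : Continuous h := continuous_iff_continuousAt.2 fun u => (dh u).continuousAt
  have key : 0 ≤ h u := by
    rcases le_total 0 u with hu | hu
    · have : MonotoneOn h (Set.Ici 0) := by
        apply monotoneOn_of_deriv_nonneg (convex_Ici 0) hc.continuousOn
          (fun u _ => (dh u).differentiableAt.differentiableWithinAt)
        intro x hx
        rw [interior_Ici] at hx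
        rw [(dh x).deriv, ← g0]
        exact mg (le_of_lt hx)
      rw [← h0]; exact this (by simp) hu hu
    · have : AntitoneOn h (Set.Iic 0) := by
        apply antitoneOn_of_deriv_nonpos (convex_Iic 0) hc.continuousOn
          (fun u _ => (dh u).differentiableAt.differentiableWithinAt)
        intro x hx
        rw [interior_Iic] at hx
        rw [(dh x).deriv, ← g0]
        exact mg (le_of_lt hx)
      rw [← h0]; exact this hu (by simp) hu
  simp only [hh] at key
  linarith

lemma aux_exp_bound2 (u w : ℝ) (huw : u ≤ w) (hw : w < 3) :
    Real.exp u - 1 - u ≤ u ^ 2 / (2 * (1 - w / 3)) := by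
  have h1 := aux_exp_bound u
  have h2 := Real.add_one_le_exp u
  rw [le_div_iff₀ (by linarith)]
  nlinarith

/-- optimisation of the Bernstein exponent -/
lemma aux_opt (V M t : ℝ) (hV : 0 < V) (hM : 0 ≤ M) (ht : 0 < t) :
    0 < t / (V + t * M / 3) ∧ t / (V + t * M / 3) * M < 3 ∧
    -(t / (V + t * M / 3) * t) +
      (t / (V + t * M / 3)) ^ 2 * V / (2 * (1 - t / (V + t * M / 3) * M / 3))
      = - (t ^ 2 / (2 * (V + t * M / 3))) := by
  have hW : 0 < V + t * M / 3 := by positivity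
  refine ⟨by positivity, ?_, ?_⟩
  · rw [div_mul_eq_mul_div, div_lt_iff₀ hW]; nlinarith
  · have h1 : 1 - t / (V + t * M / 3) * M / 3 = V / (V + t * M / 3) := by
      field_simp; ring
    rw [h1]
    field_simp
    ring

lemma aux_markov {Ω : Type*} [Fintype Ω] (f : Ω → ℝ) (hf : ∀ ω, 0 ≤ f ω) (c : ℝ)
    (B : Finset Ω) (hB : ∀ ω ∈ B, c ≤ f ω) : (B.card : ℝ) * c ≤ ∑ ω, f ω := by
  calc (B.card : ℝ) * c = ∑ ω ∈ B, c := by simp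
    _ ≤ ∑ ω ∈ B, f ω := Finset.sum_le_sum hB
    _ ≤ _ := Finset.sum_le_sum_of_subset_of_nonneg (Finset.subset_univ _) (fun ω _ _ => hf ω)

/-- scalar Bernstein -/
lemma aux_bernstein (N m : ℕ) (Z : Fin N → ℝ) (v M L : ℝ) (hm : 0 < m) (hv : 0 < v) (hM : 0 ≤ M)
    (hL : 0 < L) (h0 : ∑ i, Z i = 0) (h2 : ∑ i, Z i ^ 2 ≤ N * v) (hZ : ∀ i, Z i ≤ M)
    (B : Finset (Fin m → Fin N))
    (hB : ∀ ω ∈ B, Real.sqrt (2 * (m * v) * L) + 2 / 3 * M * L ≤ ∑ k, Z (ω k)) :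
    (B.card : ℝ) ≤ Real.exp (-L) * (N : ℝ) ^ m := by
  set V : ℝ := m * v with hV
  have hVp : 0 < V := by positivity
  set s := Real.sqrt (2 * V * L) with hs
  have hs2 : s ^ 2 = 2 * V * L := Real.sq_sqrt (by positivity)
  have hsp : 0 < s := Real.sqrt_pos.2 (by positivity)
  set t := s + 2 / 3 * M * L with ht
  have htp : 0 < t := by positivity
  obtain ⟨hl, hlM, hopt⟩ := aux_opt V M t hVp hM htp
  set l := t / (V + t * M / 3) with hldef
  have hstep : ∑ i, Real.exp (l * Z i) ≤ N * Real.exp (l ^ 2 * v / (2 * (1 - l * M / 3))) := by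
    have hpos : 0 < 2 * (1 - l * M / 3) := by linarith
    calc ∑ i, Real.exp (l * Z i) ≤ ∑ i, (1 + l * Z i + l ^ 2 * Z i ^ 2 / (2 * (1 - l * M / 3))) := by
          apply Finset.sum_le_sum
          intro i _
          have := aux_exp_bound2 (l * Z i) (l * M) (by have := hZ i; gcongr) hlM
          rw [mul_pow] at this
          linarith
      _ = N + l ^ 2 * (∑ i, Z i ^ 2) / (2 * (1 - l * M / 3)) := by
          rw [Finset.sum_add_distrib, Finset.sum_add_distrib, ← Finset.mul_sum, h0,
            ← Finset.sum_div, ← Finset.mul_sum]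
          simp
      _ ≤ N + l ^ 2 * (N * v) / (2 * (1 - l * M / 3)) := by gcongr
      _ = N * (l ^ 2 * v / (2 * (1 - l * M / 3)) + 1) := by ring
      _ ≤ _ := by gcongr; exact Real.add_one_le_exp _
  have hmk := aux_markov (fun ω : Fin m → Fin N => Real.exp (l * ∑ k, Z (ω k)))
    (fun ω => (Real.exp_pos _).le) (Real.exp (l * t)) B (by
      intro ω hω
      apply Real.exp_le_exp.2
      have := hB ω hω
      gcongr)
  have hsum : ∑ ω : Fin m → Fin N, Real.exp (l * ∑ k, Z (ω k)) = (∑ i, Real.exp (l * Z i)) ^ m := by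
    rw [Fintype.sum_pow]
    apply Finset.sum_congr rfl
    intro ω _
    rw [Finset.mul_sum, Real.exp_sum]
  rw [hsum] at hmk
  have h3 : (∑ i, Real.exp (l * Z i)) ^ m ≤
      (N : ℝ) ^ m * Real.exp (l ^ 2 * V / (2 * (1 - l * M / 3))) := by
    calc _ ≤ (N * Real.exp (l ^ 2 * v / (2 * (1 - l * M / 3)))) ^ m := by
          apply pow_le_pow_left₀ (Finset.sum_nonneg fun i _ => (Real.exp_pos _).le) hstep
      _ = _ := by
          rw [mul_pow, ← Real.exp_nat_mul, hV]
          congr 2; ring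
  have h4 : (B.card : ℝ) ≤ (N : ℝ) ^ m * Real.exp (- (t ^ 2 / (2 * (V + t * M / 3)))) := by
    rw [← hopt, Real.exp_add, Real.exp_neg]
    have := hmk.trans h3
    rw [← le_div_iff₀ (Real.exp_pos _)] at this
    refine this.trans (le_of_eq ?_)
    field_simp
  refine h4.trans ?_
  rw [mul_comm]
  gcongr
  rw [le_div_iff₀ (by positivity)]
  have : 0 ≤ M * L * s := by positivity
  rw [ht]
  nlinarith

lemma aux_cosh_convex (w x y p : ℝ) (hp0 : 0 ≤ p) (hp1 : p ≤ 1)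
    (h : w ^ 2 = p * x ^ 2 + (1 - p) * y ^ 2) :
    Real.cosh w ≤ p * Real.cosh x + (1 - p) * Real.cosh y := by
  have h1 := Real.hasSum_cosh w
  have h2 := ((Real.hasSum_cosh x).mul_left p).add ((Real.hasSum_cosh y).mul_left (1 - p))
  refine hasSum_le ?_ h1 h2
  intro n
  have hc := (convexOn_pow (𝕜 := ℝ) n).2 (x := x ^ 2) (y := y ^ 2) (sq_nonneg x) (sq_nonneg y)
    hp0 (by linarith : 0 ≤ 1 - p) (by ring)
  simp only [smul_eq_mul] at hc
  rw [← h] at hc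
  simp only [← pow_mul] at hc
  have hf : (0:ℝ) < ((2 * n).factorial : ℝ) := by positivity
  rw [← mul_div_assoc, ← mul_div_assoc, ← add_div]
  gcongr

lemma aux_cosh_step {E : Type*} [NormedAddCommGroup E] [InnerProductSpace ℝ E] (s x : E) :
    Real.cosh ‖s + x‖ ≤ Real.cosh ‖s‖ + Real.sinh ‖s‖ / ‖s‖ * inner ℝ s x
      + Real.cosh ‖s‖ * (Real.exp ‖x‖ - 1 - ‖x‖) := by
  set a := ‖s‖ with ha
  set b := ‖x‖ with hb
  have ha0 : 0 ≤ a := norm_nonneg _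
  have hb0 : 0 ≤ b := norm_nonneg _
  have hcs : |inner ℝ s x| ≤ a * b := abs_real_inner_le_norm s x
  obtain ⟨q, hq, hqe⟩ : ∃ q : ℝ, |q| ≤ 1 ∧ inner ℝ s x = q * (a * b) := by
    by_cases hab : a * b = 0
    · refine ⟨0, by simp, ?_⟩
      rw [hab] at hcs
      have := abs_nonpos_iff.1 hcs
      simp [this]
    · have : 0 < a * b := lt_of_le_of_ne (by positivity) (Ne.symm hab)
      refine ⟨inner ℝ s x / (a * b), ?_, (div_mul_cancel₀ _ hab).symm⟩
      rw [abs_div, abs_of_pos this, div_le_one this]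
      exact hcs
  have hq' := abs_le.1 hq
  have hn : ‖s + x‖ ^ 2 = (1 + q) / 2 * (a + b) ^ 2 + (1 - (1 + q) / 2) * (a - b) ^ 2 := by
    rw [norm_add_sq_real, hqe]; ring
  have h1 := aux_cosh_convex _ _ _ _ (by linarith) (by linarith) hn
  rw [Real.cosh_add, Real.cosh_sub] at h1
  have h2 : Real.sinh a / a * inner ℝ s x = Real.sinh a * q * b := by
    rw [hqe]
    by_cases h : a = 0
    · simp [h]
    · field_simp
  rw [h2]
  have h3 : Real.exp b = Real.cosh b + Real.sinh b := (Real.cosh_add_sinh b).symm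
  have h4 : b ≤ Real.sinh b := Real.self_le_sinh_iff.2 hb0
  have h5 : Real.sinh a ≤ Real.cosh a := (Real.sinh_lt_cosh a).le
  have h6 : 0 ≤ Real.sinh a := Real.sinh_nonneg_iff.2 ha0
  have h7 : q * Real.sinh a ≤ Real.cosh a := by nlinarith
  have h8 : q * Real.sinh a * (Real.sinh b - b) ≤ Real.cosh a * (Real.sinh b - b) :=
    mul_le_mul_of_nonneg_right h7 (by linarith)
  rw [h3]
  nlinarith

lemma aux_cosh_iter {E : Type*} [NormedAddCommGroup E] [InnerProductSpace ℝ E] (N : ℕ)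
    (x : Fin N → E) (h0 : ∑ i, x i = 0) (m : ℕ) :
    ∑ ω : Fin m → Fin N, Real.cosh ‖∑ k, x (ω k)‖ ≤
      (∑ i, (Real.exp ‖x i‖ - ‖x i‖)) ^ m := by
  induction m with
  | zero => simp
  | succ m ih =>
    rw [← (Fin.consEquiv (fun _ => Fin N)).sum_comp, Fintype.sum_prod_type_right, pow_succ]
    have hpos : 0 ≤ ∑ i, (Real.exp ‖x i‖ - ‖x i‖) := Finset.sum_nonneg fun i _ => by
      have := Real.add_one_le_exp ‖x i‖
      linarith
    refine le_trans ?_ (mul_le_mul_of_nonneg_right ih hpos)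
    rw [Finset.sum_mul]
    apply Finset.sum_le_sum
    intro ω _
    set s := ∑ k, x (ω k) with hs
    calc _ = ∑ i, Real.cosh ‖s + x i‖ := by
          apply Finset.sum_congr rfl
          intro i _
          simp [Fin.consEquiv, Fin.sum_univ_succ, hs, add_comm]
      _ ≤ ∑ i, (Real.cosh ‖s‖ + Real.sinh ‖s‖ / ‖s‖ * inner ℝ s (x i)
            + Real.cosh ‖s‖ * (Real.exp ‖x i‖ - 1 - ‖x i‖)) :=
          Finset.sum_le_sum fun i _ => aux_cosh_step s (x i)
      _ = Real.sinh ‖s‖ / ‖s‖ * inner ℝ s (∑ i, x i) +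
            ∑ i, Real.cosh ‖s‖ * (Real.exp ‖x i‖ - ‖x i‖) := by
          rw [inner_sum, Finset.mul_sum, ← Finset.sum_add_distrib]
          apply Finset.sum_congr rfl
          intro i _
          ring
      _ = _ := by rw [h0, inner_zero_right, mul_zero, zero_add, Finset.mul_sum]

/-- vector Bernstein (Pinelis) -/
lemma aux_pinelis {E : Type*} [NormedAddCommGroup E] [InnerProductSpace ℝ E] (N m : ℕ)
    (x : Fin N → E) (v M t : ℝ) (hm : 0 < m) (hv : 0 < v) (hM : 0 ≤ M) (ht : 0 < t)
    (h0 : ∑ i, x i = 0) (h2 : ∑ i, ‖x i‖ ^ 2 ≤ N * v) (hx : ∀ i, ‖x i‖ ≤ M)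
    (B : Finset (Fin m → Fin N))
    (hB : ∀ ω ∈ B, t ≤ ‖∑ k, x (ω k)‖) :
    (B.card : ℝ) ≤ 2 * Real.exp (- (t ^ 2 / (2 * (m * v + t * M / 3)))) * (N : ℝ) ^ m := by
  set V : ℝ := m * v with hV
  have hVp : 0 < V := by positivity
  obtain ⟨hl, hlM, hopt⟩ := aux_opt V M t hVp hM ht
  set l := t / (V + t * M / 3) with hldef
  have hnl : ∀ z : E, ‖l • z‖ = l * ‖z‖ := fun z => by
    rw [norm_smul, Real.norm_of_nonneg hl.le]
  have hit := aux_cosh_iter N (fun i => l • x i) (by rw [← Finset.smul_sum, h0, smul_zero]) m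
  simp only [← Finset.smul_sum, hnl] at hit
  have hstep : ∑ i, (Real.exp (l * ‖x i‖) - l * ‖x i‖)
      ≤ N * Real.exp (l ^ 2 * v / (2 * (1 - l * M / 3))) := by
    have hpos : 0 < 2 * (1 - l * M / 3) := by linarith
    calc _ ≤ ∑ i, (1 + l ^ 2 * ‖x i‖ ^ 2 / (2 * (1 - l * M / 3))) := by
          apply Finset.sum_le_sum
          intro i _
          have := aux_exp_bound2 (l * ‖x i‖) (l * M) (by have := hx i; gcongr) hlM
          rw [mul_pow] at this
          linarith
      _ = N + l ^ 2 * (∑ i, ‖x i‖ ^ 2) / (2 * (1 - l * M / 3)) := by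
          rw [Finset.sum_add_distrib, ← Finset.sum_div, ← Finset.mul_sum]
          simp
      _ ≤ N + l ^ 2 * (N * v) / (2 * (1 - l * M / 3)) := by gcongr
      _ = N * (l ^ 2 * v / (2 * (1 - l * M / 3)) + 1) := by ring
      _ ≤ _ := by gcongr; exact Real.add_one_le_exp _
  have hmk := aux_markov (fun ω : Fin m → Fin N => Real.cosh (l * ‖∑ k, x (ω k)‖))
    (fun ω => (Real.cosh_pos _).le) (Real.exp (l * t) / 2) B (by
      intro ω hω
      have h1 := hB ω hω
      have h2 : Real.exp (l * t) ≤ Real.exp (l * ‖∑ k, x (ω k)‖) := by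
        apply Real.exp_le_exp.2; gcongr
      rw [Real.cosh_eq]
      have := Real.exp_pos (-(l * ‖∑ k, x (ω k)‖))
      linarith)
  have h3 : (∑ i, (Real.exp (l * ‖x i‖) - l * ‖x i‖)) ^ m ≤
      (N : ℝ) ^ m * Real.exp (l ^ 2 * V / (2 * (1 - l * M / 3))) := by
    calc _ ≤ (N * Real.exp (l ^ 2 * v / (2 * (1 - l * M / 3)))) ^ m := by
          apply pow_le_pow_left₀ (Finset.sum_nonneg fun i _ => ?_) hstep
          have := Real.add_one_le_exp (l * ‖x i‖)
          linarith
      _ = _ := by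
          rw [mul_pow, ← Real.exp_nat_mul, hV]
          congr 2; ring
  rw [← hopt, Real.exp_add, Real.exp_neg]
  have := hmk.trans (hit.trans h3)
  rw [← le_div_iff₀ (by positivity)] at this
  refine this.trans (le_of_eq ?_)
  field_simp

/-- spectral synthesis -/
def auxSp {d : ℕ} (Q : Matrix (Fin d) (Fin d) ℝ) (f : Fin d → ℝ) : Matrix (Fin d) (Fin d) ℝ :=
  Q * diagonal f * Qᵀ

lemma auxSp_mul {d : ℕ} (Q : Matrix (Fin d) (Fin d) ℝ) (hQ : Qᵀ * Q = 1) (f g : Fin d → ℝ) :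
    auxSp Q f * auxSp Q g = auxSp Q (fun i => f i * g i) := by
  unfold auxSp
  calc Q * diagonal f * Qᵀ * (Q * diagonal g * Qᵀ)
      = Q * diagonal f * (Qᵀ * Q) * diagonal g * Qᵀ := by simp only [Matrix.mul_assoc]
    _ = Q * (diagonal f * diagonal g) * Qᵀ := by rw [hQ]; simp only [Matrix.mul_assoc, Matrix.mul_one]
    _ = _ := by rw [diagonal_mul_diagonal]

lemma auxSp_one {d : ℕ} (Q : Matrix (Fin d) (Fin d) ℝ) (hQ : Qᵀ * Q = 1) :
    auxSp Q (fun _ => 1) = 1 := by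
  unfold auxSp
  have : diagonal (fun _ : Fin d => (1:ℝ)) = 1 := diagonal_one
  rw [this, Matrix.mul_one]
  exact mul_eq_one_comm.1 hQ

lemma auxSp_quad {d : ℕ} (Q : Matrix (Fin d) (Fin d) ℝ) (f x : Fin d → ℝ) :
    x ⬝ᵥ (auxSp Q f *ᵥ x) = ∑ i, f i * (Qᵀ *ᵥ x) i ^ 2 := by
  unfold auxSp
  rw [← Matrix.mulVec_mulVec, ← Matrix.mulVec_mulVec, Matrix.dotProduct_mulVec, ← Matrix.mulVec_transpose]
  simp only [dotProduct, mulVec_diagonal]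
  apply Finset.sum_congr rfl
  intro i _
  ring

lemma auxSp_trace_mul {d : ℕ} (Q Q' : Matrix (Fin d) (Fin d) ℝ) (f g : Fin d → ℝ) :
    trace (auxSp Q f * auxSp Q' g) = ∑ i, ∑ j, f i * g j * (Qᵀ * Q') i j ^ 2 := by
  unfold auxSp
  have h1 : Q * diagonal f * Qᵀ * (Q' * diagonal g * Q'ᵀ)
      = Q * (diagonal f * (Qᵀ * Q') * diagonal g * Q'ᵀ) := by simp only [Matrix.mul_assoc]
  rw [h1, trace_mul_comm]
  have h2 : diagonal f * (Qᵀ * Q') * diagonal g * Q'ᵀ * Q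
      = diagonal f * (Qᵀ * Q') * diagonal g * (Qᵀ * Q')ᵀ := by
    rw [transpose_mul, transpose_transpose]; simp only [Matrix.mul_assoc]
  rw [h2, trace]
  apply Finset.sum_congr rfl
  intro i _
  rw [diag_apply, mul_apply]
  apply Finset.sum_congr rfl
  intro j _
  rw [mul_diagonal, diagonal_mul, transpose_apply]
  ring

lemma auxSp_trace {d : ℕ} (Q : Matrix (Fin d) (Fin d) ℝ) (hQ : Qᵀ * Q = 1) (f : Fin d → ℝ) :
    trace (auxSp Q f) = ∑ i, f i := by
  unfold auxSp
  rw [Matrix.mul_assoc, trace_mul_comm, Matrix.mul_assoc, hQ, Matrix.mul_one, trace_diagonal]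

lemma aux_spectral {d : ℕ} (A : Matrix (Fin d) (Fin d) ℝ) (hA : Aᵀ = A) :
    ∃ (Q : Matrix (Fin d) (Fin d) ℝ) (a : Fin d → ℝ), Qᵀ * Q = 1 ∧ A = auxSp Q a := by
  have hH : A.IsHermitian := by
    rw [Matrix.IsHermitian, conjTranspose_eq_transpose_of_trivial]; exact hA
  refine ⟨hH.eigenvectorUnitary, hH.eigenvalues, ?_, ?_⟩
  · have := (Matrix.mem_unitaryGroup_iff').1 hH.eigenvectorUnitary.2
    rw [star_eq_conjTranspose, conjTranspose_eq_transpose_of_trivial] at this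
    exact this
  · have := hH.spectral_theorem
    rw [Unitary.conjStarAlgAut_apply] at this
    conv_lhs => rw [this]
    unfold auxSp
    rw [star_eq_conjTranspose, conjTranspose_eq_transpose_of_trivial]
    rfl

lemma aux_logmean (s t : ℝ) :
    (s - t) * (Real.exp s - Real.exp t) ≤ (s - t) ^ 2 * (Real.exp s + Real.exp t) / 2 := by
  wlog h : t ≤ s generalizing s t
  · have := this t s (by linarith)
    nlinarith
  have key : ∀ x : ℝ, 0 ≤ x → Real.exp x - 1 ≤ x * (Real.exp x + 1) / 2 := by
    intro x hx
    let g : ℝ → ℝ := fun x => x * (Real.exp x + 1) / 2 - (Real.exp x - 1)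
    have dg : ∀ x, HasDerivAt g ((1 + (x - 1) * Real.exp x) / 2) x := by
      intro u
      have h1 := (hasDerivAt_id u)
      have h2 := Real.hasDerivAt_exp u
      have := ((h1.mul (h2.add_const 1)).div_const 2).sub (h2.sub_const 1)
      refine this.congr_deriv ?_
      simp
      ring
    have mg : Monotone g := by
      apply monotone_of_deriv_nonneg (fun u => (dg u).differentiableAt)
      intro u
      rw [(dg u).deriv]
      have h1 := Real.add_one_le_exp (-u)
      have h2 := Real.exp_pos u
      have h3 : Real.exp (-u) * Real.exp u = 1 := by rw [← Real.exp_add]; simp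
      nlinarith
    have := mg hx
    simp only [g] at this
    simp at this
    linarith
  have h1 := key (s - t) (by linarith)
  have h2 : Real.exp s = Real.exp (s - t) * Real.exp t := by rw [← Real.exp_add]; simp
  have h3 : Real.exp s - Real.exp t ≤ (s - t) * (Real.exp s + Real.exp t) / 2 := by
    rw [h2]
    have := mul_le_mul_of_nonneg_right h1 (Real.exp_pos t).le
    linarith
  have := mul_le_mul_of_nonneg_left h3 (by linarith : 0 ≤ s - t)
  linarith

/-- mean value trace inequality -/
lemma aux_mvt {d : ℕ} (Q Q' : Matrix (Fin d) (Fin d) ℝ) (hQ : Qᵀ * Q = 1) (hQ' : Q'ᵀ * Q' = 1)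
    (a a' : Fin d → ℝ) (θ : ℝ) (hθ : 0 < θ) (A A' E E' : Matrix (Fin d) (Fin d) ℝ)
    (hA : A = auxSp Q a) (hA' : A' = auxSp Q' a')
    (hE : E = auxSp Q (fun i => Real.exp (-θ * a i)))
    (hE' : E' = auxSp Q' (fun i => Real.exp (-θ * a' i))) :
    trace ((A - A') * (E' - E)) ≤ θ / 2 * trace ((A - A') * (A - A') * (E + E')) := by
  set C := Qᵀ * Q' with hC
  have T := auxSp_trace_mul Q Q'
  have o := auxSp_one Q hQ
  have o' := auxSp_one Q' hQ'
  have TQ : ∀ f : Fin d → ℝ, trace (auxSp Q f) = ∑ i, ∑ j, f i * 1 * C i j ^ 2 := by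
    intro f
    rw [← T, o', Matrix.mul_one]
  have TQ' : ∀ f : Fin d → ℝ, trace (auxSp Q' f) = ∑ i, ∑ j, 1 * f j * C i j ^ 2 := by
    intro f
    rw [← T (fun _ => 1), o, Matrix.one_mul]
  have e1 : trace ((A - A') * (E' - E)) = ∑ i, ∑ j,
      ((a i - a' j) * (Real.exp (-θ * a' j) - Real.exp (-θ * a i))) * C i j ^ 2 := by
    have t1 : trace (A * E') = ∑ i, ∑ j, a i * Real.exp (-θ * a' j) * C i j ^ 2 := by
      rw [hA, hE', T]
    have t2 : trace (A * E) = ∑ i, ∑ j, (a i * Real.exp (-θ * a i)) * 1 * C i j ^ 2 := by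
      rw [hA, hE, auxSp_mul Q hQ, TQ]
    have t3 : trace (A' * E') = ∑ i, ∑ j, 1 * (a' j * Real.exp (-θ * a' j)) * C i j ^ 2 := by
      rw [hA', hE', auxSp_mul Q' hQ', TQ']
    have t4 : trace (A' * E) = ∑ i, ∑ j, Real.exp (-θ * a i) * a' j * C i j ^ 2 := by
      rw [trace_mul_comm, hA', hE, T]
    have : (A - A') * (E' - E) = A * E' - A * E - A' * E' + A' * E := by noncomm_ring
    rw [this, trace_add, trace_sub, trace_sub, t1, t2, t3, t4]
    simp only [← Finset.sum_add_distrib, ← Finset.sum_sub_distrib]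
    refine Finset.sum_congr rfl fun i _ => Finset.sum_congr rfl fun j _ => ?_
    ring
  have e2 : trace ((A - A') * (A - A') * (E + E')) = ∑ i, ∑ j,
      ((a i - a' j) ^ 2 * (Real.exp (-θ * a' j) + Real.exp (-θ * a i))) * C i j ^ 2 := by
    have t1 : trace (A * A * E) = ∑ i, ∑ j, ((a i * a i) * Real.exp (-θ * a i)) * 1 * C i j ^ 2 := by
      rw [hA, hE, auxSp_mul Q hQ, auxSp_mul Q hQ, TQ]
    have t2 : trace (A * A' * E) = ∑ i, ∑ j, (Real.exp (-θ * a i) * a i) * a' j * C i j ^ 2 := by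
      rw [trace_mul_comm, ← Matrix.mul_assoc, hA, hE, hA', auxSp_mul Q hQ, T]
    have t3 : trace (A' * A * E) = ∑ i, ∑ j, (a i * Real.exp (-θ * a i)) * a' j * C i j ^ 2 := by
      rw [Matrix.mul_assoc, trace_mul_comm, hA, hE, hA', auxSp_mul Q hQ, T]
    have t4 : trace (A' * A' * E) = ∑ i, ∑ j, Real.exp (-θ * a i) * (a' j * a' j) * C i j ^ 2 := by
      rw [trace_mul_comm, hE, hA', auxSp_mul Q' hQ', T]
    have t5 : trace (A * A * E') = ∑ i, ∑ j, (a i * a i) * Real.exp (-θ * a' j) * C i j ^ 2 := by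
      rw [hA, hE', auxSp_mul Q hQ, T]
    have t6 : trace (A * A' * E') = ∑ i, ∑ j, a i * (a' j * Real.exp (-θ * a' j)) * C i j ^ 2 := by
      rw [Matrix.mul_assoc, hA, hE', hA', auxSp_mul Q' hQ', T]
    have t7 : trace (A' * A * E') = ∑ i, ∑ j, a i * (Real.exp (-θ * a' j) * a' j) * C i j ^ 2 := by
      rw [Matrix.mul_assoc, trace_mul_comm, Matrix.mul_assoc, hA, hE', hA', auxSp_mul Q' hQ', T]
    have t8 : trace (A' * A' * E') = ∑ i, ∑ j, 1 * ((a' j * a' j) * Real.exp (-θ * a' j)) * C i j ^ 2 := by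
      rw [hE', hA', auxSp_mul Q' hQ', auxSp_mul Q' hQ', TQ']
    have : (A - A') * (A - A') * (E + E') = A * A * E - A * A' * E - A' * A * E + A' * A' * E
      + A * A * E' - A * A' * E' - A' * A * E' + A' * A' * E' := by noncomm_ring
    rw [this]
    simp only [trace_add, trace_sub]
    rw [t1, t2, t3, t4, t5, t6, t7, t8]
    simp only [← Finset.sum_add_distrib, ← Finset.sum_sub_distrib]
    refine Finset.sum_congr rfl fun i _ => Finset.sum_congr rfl fun j _ => ?_
    ring
  rw [e1, e2, Finset.mul_sum]
  refine Finset.sum_le_sum fun i _ => ?_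
  rw [Finset.mul_sum]
  refine Finset.sum_le_sum fun j _ => ?_
  rw [← mul_assoc]
  refine mul_le_mul_of_nonneg_right ?_ (sq_nonneg _)
  have := aux_logmean (-θ * a' j) (-θ * a i)
  have h : θ * ((a i - a' j) * (Real.exp (-θ * a' j) - Real.exp (-θ * a i)))
     ≤ θ * (θ / 2 * ((a i - a' j) ^ 2 * (Real.exp (-θ * a' j) + Real.exp (-θ * a i)))) := by
    nlinarith
  exact le_of_mul_le_mul_left h hθ

lemma aux_swap {N m : ℕ} (k : Fin m) (F : (Fin m → Fin N) → (Fin m → Fin N) → ℝ) :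
    ∑ ω, ∑ i, F ω (Function.update ω k i) = ∑ ω, ∑ i, F (Function.update ω k i) ω := by
  rw [← Fintype.sum_prod_type', ← Fintype.sum_prod_type']
  let e : (Fin m → Fin N) × Fin N → (Fin m → Fin N) × Fin N :=
    fun p => (Function.update p.1 k p.2, p.1 k)
  have he : Function.Involutive e := by
    rintro ⟨ω, i⟩
    simp [e]
  refine Fintype.sum_equiv (he.toPerm e) _ _ ?_
  rintro ⟨ω, i⟩
  simp [e]

lemma aux_chernoff_step {N d m : ℕ} (W : Fin N → Matrix (Fin d) (Fin d) ℝ) (r : Fin N → ℝ)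
    (ρ θ : ℝ) (hθ : 0 < θ) (hW1 : ∑ i, W i = 1) (hWW : ∀ i, W i * W i = r i • W i)
    (hr : ∀ i, r i ≤ ρ)
    (Q : (Fin m → Fin N) → Matrix (Fin d) (Fin d) ℝ) (a : (Fin m → Fin N) → Fin d → ℝ)
    (A E : (Fin m → Fin N) → Matrix (Fin d) (Fin d) ℝ)
    (hAW : ∀ ω, A ω = ∑ k, W (ω k))
    (hQ : ∀ ω, (Q ω)ᵀ * Q ω = 1) (hA : ∀ ω, A ω = auxSp (Q ω) (a ω))
    (hE : ∀ ω, E ω = auxSp (Q ω) (fun i => Real.exp (-θ * a ω i)))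
    (hpos : ∀ i ω, 0 ≤ trace (W i * E ω)) :
    (1 - θ * ρ / 2) * (m * ∑ ω, trace (E ω)) ≤ (1 + θ * ρ / 2) * (N * ∑ ω, trace (A ω * E ω)) := by
  have hk : ∀ k : Fin m, (∑ ω, trace (E ω)) - N * ∑ ω, trace (W (ω k) * E ω) ≤
      θ / 2 * (N * ρ * ∑ ω, trace (W (ω k) * E ω) + ρ * ∑ ω, trace (E ω)) := by
    intro k
    set T := ∑ ω, trace (W (ω k) * E ω) with hT
    set M := ∑ ω, trace (E ω) with hM
    have hdiff : ∀ ω i, A ω - A (Function.update ω k i) =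
        W (ω k) - W ((Function.update ω k i) k) := by
      intro ω i
      rw [hAW, hAW, ← Finset.sum_sub_distrib, Finset.sum_eq_single k]
      · intro b _ hb
        simp [hb]
      · simp
    have S1 : ∑ ω, ∑ i : Fin N, trace (W (ω k) * E ω) = N * T := by
      simp [hT, Finset.mul_sum]
    have hsumW : ∀ X : Matrix (Fin d) (Fin d) ℝ, ∑ i, trace (W i * X) = trace X := by
      intro X
      rw [← trace_sum, ← Matrix.sum_mul, hW1, Matrix.one_mul]
    have S2 : ∑ ω, ∑ i, trace (W ((Function.update ω k i) k) * E ω) = M := by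
      rw [hM]
      refine Finset.sum_congr rfl fun ω _ => ?_
      simp only [Function.update_self]
      exact hsumW _
    have S3 : ∑ ω, ∑ i, trace (W (ω k) * E (Function.update ω k i)) = M := by
      rw [← S2]; exact aux_swap k (fun ω ω' => trace (W (ω k) * E ω'))
    have S4 : ∑ ω, ∑ i, trace (W ((Function.update ω k i) k) * E (Function.update ω k i)) = N * T := by
      rw [← S1]; exact aux_swap k (fun ω ω' => trace (W (ω' k) * E ω'))
    have L1 : ∑ ω, ∑ i, trace ((A ω - A (Function.update ω k i)) *
        (E (Function.update ω k i) - E ω)) = 2 * (M - N * T) := by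
      have : 2 * (M - N * T) = M - N * T - N * T + M := by ring
      rw [this]
      nth_rewrite 1 [← S3]
      nth_rewrite 1 [← S1]
      nth_rewrite 1 [← S4]
      nth_rewrite 1 [← S2]
      simp only [← Finset.sum_add_distrib, ← Finset.sum_sub_distrib]
      refine Finset.sum_congr rfl fun ω _ => Finset.sum_congr rfl fun i _ => ?_
      rw [hdiff, sub_mul, mul_sub, mul_sub, trace_sub, trace_sub, trace_sub]
      ring
    have L2 : ∑ ω, ∑ i, trace ((A ω - A (Function.update ω k i)) *
        (A ω - A (Function.update ω k i)) * (E ω + E (Function.update ω k i))) =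
        2 * ∑ ω, ∑ i, trace ((A ω - A (Function.update ω k i)) *
          (A ω - A (Function.update ω k i)) * E ω) := by
      rw [two_mul]
      nth_rewrite 2 [aux_swap k (fun ω ω' => trace ((A ω - A ω') * (A ω - A ω') * E ω))]
      simp only [← Finset.sum_add_distrib]
      refine Finset.sum_congr rfl fun ω _ => Finset.sum_congr rfl fun i _ => ?_
      rw [mul_add, trace_add, ← neg_sub (A (Function.update ω k i)) (A ω), neg_mul_neg]
    have L3 : ∑ ω, ∑ i, trace ((A ω - A (Function.update ω k i)) *
          (A ω - A (Function.update ω k i)) * E ω) ≤ N * ρ * T + ρ * M := by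
      rw [hT, hM, Finset.mul_sum, Finset.mul_sum, ← Finset.sum_add_distrib]
      refine Finset.sum_le_sum fun ω _ => ?_
      simp only [hdiff, Function.update_self]
      have e : ∀ i, trace ((W (ω k) - W i) * (W (ω k) - W i) * E ω) =
          r (ω k) * trace (W (ω k) * E ω) + r i * trace (W i * E ω)
          - trace (W i * (E ω * W (ω k))) - trace (W i * (W (ω k) * E ω)) := by
        intro i
        have : (W (ω k) - W i) * (W (ω k) - W i) * E ω =
          W (ω k) * W (ω k) * E ω + W i * W i * E ω - W (ω k) * (W i * E ω)
            - W i * (W (ω k) * E ω) := by noncomm_ring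
        rw [this, hWW, hWW, trace_sub, trace_sub, trace_add, smul_mul_assoc, smul_mul_assoc,
          trace_smul, trace_smul, smul_eq_mul, smul_eq_mul, trace_mul_comm (W (ω k)) (W i * E ω),
          Matrix.mul_assoc (W i)]
      rw [Finset.sum_congr rfl fun i _ => e i]
      simp only [Finset.sum_sub_distrib, Finset.sum_add_distrib, hsumW]
      rw [trace_mul_comm (E ω) (W (ω k))]
      have p1 := hpos (ω k) ω
      have p2 : ∑ i, r i * trace (W i * E ω) ≤ ρ * trace (E ω) := by
        rw [← hsumW (E ω), Finset.mul_sum]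
        exact Finset.sum_le_sum fun i _ => mul_le_mul_of_nonneg_right (hr i) (hpos i ω)
      have p3 : ∑ i : Fin N, r (ω k) * trace (W (ω k) * E ω) ≤ N * ρ * trace (W (ω k) * E ω) := by
        simp only [Finset.sum_const, Finset.card_univ, Fintype.card_fin, nsmul_eq_mul]
        rw [mul_assoc]
        gcongr
        exact hr _
      linarith
    have L4 : ∑ ω, ∑ i, trace ((A ω - A (Function.update ω k i)) *
        (E (Function.update ω k i) - E ω)) ≤ ∑ ω, ∑ i, θ / 2 * trace ((A ω - A (Function.update ω k i)) *
        (A ω - A (Function.update ω k i)) * (E ω + E (Function.update ω k i))) :=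
      Finset.sum_le_sum fun ω _ => Finset.sum_le_sum fun i _ =>
        aux_mvt _ _ (hQ ω) (hQ _) _ _ θ hθ _ _ _ _ (hA _) (hA _) (hE _) (hE _)
    simp only [← Finset.mul_sum] at L4
    rw [L1, L2] at L4
    have := mul_le_mul_of_nonneg_left L3 hθ.le
    linarith
  have hs := Finset.sum_le_sum (s := Finset.univ) fun k _ => hk k
  have hD : ∑ k : Fin m, ∑ ω, trace (W (ω k) * E ω) = ∑ ω, trace (A ω * E ω) := by
    rw [Finset.sum_comm]
    refine Finset.sum_congr rfl fun ω _ => ?_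
    rw [hAW, Matrix.sum_mul, trace_sum]
  rw [Finset.sum_sub_distrib, ← Finset.mul_sum, ← Finset.mul_sum, Finset.sum_add_distrib,
    ← Finset.mul_sum, hD] at hs
  simp only [Finset.sum_const, Finset.card_univ, Fintype.card_fin, nsmul_eq_mul] at hs
  linarith

lemma aux_chernoff {N d m : ℕ} (hN : 0 < N) (U : Matrix (Fin N) (Fin d) ℝ) (hU : Uᵀ * U = 1)
    (ρ θ : ℝ) (hθ : 0 ≤ θ) (hρ0 : 0 ≤ ρ)
    (hr : ∀ i, U i ⬝ᵥ U i ≤ ρ)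
    (Q : (Fin m → Fin N) → Matrix (Fin d) (Fin d) ℝ) (a : (Fin m → Fin N) → Fin d → ℝ)
    (hQ : ∀ ω, (Q ω)ᵀ * Q ω = 1)
    (hA : ∀ ω, ∑ k, vecMulVec (U (ω k)) (U (ω k)) = auxSp (Q ω) (a ω)) :
    ∑ ω, ∑ i, Real.exp (-θ * a ω i) ≤
      (N : ℝ) ^ m * d * Real.exp (-((m / N) * (θ - θ ^ 2 * ρ / 2))) := by
  have hNr : (0:ℝ) < N := by exact_mod_cast hN
  set Φ : ℝ → ℝ := fun θ => ∑ ω, ∑ i, Real.exp (-θ * a ω i) with hΦ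
  set D : ℝ → ℝ := fun θ => ∑ ω, ∑ i, a ω i * Real.exp (-θ * a ω i) with hDdef
  have hW1 : ∑ i, vecMulVec (U i) (U i) = 1 := by
    rw [← hU]
    ext p q
    simp [Matrix.sum_apply, vecMulVec_apply, Matrix.mul_apply]
  have hquad : ∀ (u : Fin d → ℝ) (X : Matrix (Fin d) (Fin d) ℝ),
      trace (vecMulVec u u * X) = u ⬝ᵥ (X *ᵥ u) := by
    intro u X
    rw [trace_mul_comm, mul_vecMulVec, trace_vecMulVec, dotProduct_comm]
  have hineq : ∀ θ, 0 < θ → (m / N) * (1 - θ * ρ) * Φ θ ≤ D θ := by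
    intro θ hθ
    have := aux_chernoff_step (fun i => vecMulVec (U i) (U i)) (fun i => U i ⬝ᵥ U i) ρ θ hθ hW1
      (by intro i; simp [vecMulVec_mul_vecMulVec]) hr Q a _
      (fun ω => auxSp (Q ω) (fun i => Real.exp (-θ * a ω i))) (fun ω => rfl) hQ hA (fun ω => rfl)
      (by
        intro i ω
        rw [hquad, auxSp_quad]
        exact Finset.sum_nonneg fun i _ => by positivity)
    have h1 : ∑ ω, trace (auxSp (Q ω) (fun i => Real.exp (-θ * a ω i))) = Φ θ :=
      Finset.sum_congr rfl fun ω _ => auxSp_trace _ (hQ ω) _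
    have h2 : ∑ ω : Fin m → Fin N, trace ((∑ k, vecMulVec (U (ω k)) (U (ω k))) *
        auxSp (Q ω) (fun i => Real.exp (-θ * a ω i))) = D θ :=
      Finset.sum_congr rfl fun ω _ => by rw [hA, auxSp_mul _ (hQ ω), auxSp_trace _ (hQ ω)]
    rw [h1, h2] at this
    have hΦ0 : 0 ≤ Φ θ := Finset.sum_nonneg fun ω _ => Finset.sum_nonneg fun i _ => (Real.exp_pos _).le
    set x := θ * ρ / 2 with hx
    have hx0 : 0 ≤ x := by positivity
    have hx2 : θ * ρ = 2 * x := by rw [hx]; ring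
    rw [hx2]
    have h3 : (1 + x) * (m * (1 - 2 * x) * Φ θ) ≤ (1 + x) * (N * D θ) := by
      have : 0 ≤ x ^ 2 * (m * Φ θ) := mul_nonneg (sq_nonneg x) (mul_nonneg (Nat.cast_nonneg m) hΦ0)
      nlinarith
    have h4 := le_of_mul_le_mul_left h3 (by positivity)
    have h5 : (m / N : ℝ) * (1 - 2 * x) * Φ θ = (m * (1 - 2 * x) * Φ θ) / N := by ring
    rw [h5, div_le_iff₀ hNr]
    linarith
  have dΦ : ∀ θ, HasDerivAt Φ (-D θ) θ := by
    intro θ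
    have : HasDerivAt Φ (∑ ω, ∑ i, Real.exp (-θ * a ω i) * (-1 * a ω i)) θ := by
      refine HasDerivAt.fun_sum fun ω _ => HasDerivAt.fun_sum fun i _ => ?_
      exact ((hasDerivAt_id θ).neg.mul_const (a ω i)).exp
    refine this.congr_deriv ?_
    rw [hDdef, ← Finset.sum_neg_distrib]
    refine Finset.sum_congr rfl fun ω _ => ?_
    rw [← Finset.sum_neg_distrib]
    refine Finset.sum_congr rfl fun i _ => ?_
    ring
  set h : ℝ → ℝ := fun θ => Φ θ * Real.exp ((m / N) * (θ - θ ^ 2 * ρ / 2)) with hh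
  have dh : ∀ θ, HasDerivAt h (-D θ * Real.exp ((m / N) * (θ - θ ^ 2 * ρ / 2)) +
      Φ θ * (Real.exp ((m / N) * (θ - θ ^ 2 * ρ / 2)) * ((m / N) * (1 - θ * ρ)))) θ := by
    intro θ
    have h1 := hasDerivAt_id θ
    have h2 := ((h1.sub (((h1.pow 2).mul_const ρ).div_const 2)).const_mul (m / N : ℝ)).exp
    refine ((dΦ θ).mul h2).congr_deriv ?_
    simp
    left
    left
    ring
  have anti : AntitoneOn h (Set.Ici 0) := by
    apply antitoneOn_of_deriv_nonpos (convex_Ici 0)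
      (fun x _ => (dh x).continuousAt.continuousWithinAt)
      (fun u _ => (dh u).differentiableAt.differentiableWithinAt)
    intro x hx
    rw [interior_Ici] at hx
    rw [(dh x).deriv]
    have h1 := hineq x hx
    have h2 := Real.exp_pos ((m / N : ℝ) * (x - x ^ 2 * ρ / 2))
    have := mul_le_mul_of_nonneg_right h1 h2.le
    linarith
  have hfin := anti (Set.self_mem_Ici) hθ hθ
  have h0 : h 0 = (N : ℝ) ^ m * d := by
    simp [hh, hΦ]
  rw [h0] at hfin
  rw [Real.exp_neg, ← div_eq_mul_inv, le_div_iff₀ (Real.exp_pos _)]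
  exact hfin

lemma aux_le_of_sq {a b : ℝ} (h : a ^ 2 ≤ b ^ 2) (hb : 0 ≤ b) : a ≤ b :=
  (le_abs_self a).trans (abs_le_of_sq_le_sq h hb)

lemma aux_upper (N m : ℕ) (hN : 0 < N) (hm : 0 < m) (y : Fin N → ℝ) (e ymax L : ℝ) (hL : 0 < L)
    (he : 0 < e) (hY : ∑ i, y i ^ 2 = N * e) (hy : ∀ i, y i ^ 2 ≤ ymax) (hmax : e ≤ ymax) :
    (((Finset.univ.filter fun ω : Fin m → Fin N =>
      m * e + (Real.sqrt (2 * (m * (e * (ymax - e))) * L) + 2 / 3 * (ymax - e) * L)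
        < ∑ k, y (ω k) ^ 2).card : ℕ) : ℝ) ≤ Real.exp (-L) * (N : ℝ) ^ m := by
  have hZ0 : ∑ i, (y i ^ 2 - e) = 0 := by
    rw [Finset.sum_sub_distrib, hY]; simp
  have hS : ∀ ω : Fin m → Fin N, ∑ k, (y (ω k) ^ 2 - e) = ∑ k, y (ω k) ^ 2 - m * e := by
    intro ω; rw [Finset.sum_sub_distrib]; simp
  rcases hmax.eq_or_lt with h | h
  · have : (Finset.univ.filter fun ω : Fin m → Fin N =>
      m * e + (Real.sqrt (2 * (m * (e * (ymax - e))) * L) + 2 / 3 * (ymax - e) * L)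
        < ∑ k, y (ω k) ^ 2) = ∅ := by
      rw [Finset.filter_eq_empty_iff]
      intro ω _
      rw [← h]
      simp
      calc ∑ k, y (ω k) ^ 2 ≤ ∑ k : Fin m, e := Finset.sum_le_sum fun k _ => by rw [h]; exact hy _
        _ = m * e := by simp
    rw [this]
    simp
    positivity
  · have hp : 0 < ymax - e := by linarith
    refine aux_bernstein N m (fun i => y i ^ 2 - e) (e * (ymax - e)) (ymax - e) L hm
      (by positivity) hp.le hL hZ0 ?_ (fun i => by have := hy i; linarith) _ ?_
    · calc ∑ i, (y i ^ 2 - e) ^ 2 ≤ ∑ i, ((ymax - 2 * e) * y i ^ 2 + e ^ 2) := by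
            refine Finset.sum_le_sum fun i _ => ?_
            have := hy i
            nlinarith [sq_nonneg (y i)]
        _ = _ := by
            rw [Finset.sum_add_distrib, ← Finset.mul_sum, hY]
            simp
            ring
    · intro ω hω
      rw [hS]
      have := (Finset.mem_filter.1 hω).2
      linarith

lemma aux_lower (N m : ℕ) (hN : 0 < N) (hm : 0 < m) (y : Fin N → ℝ) (e ymax L : ℝ) (hL : 0 < L)
    (he : 0 < e) (hY : ∑ i, y i ^ 2 = N * e) (hy : ∀ i, y i ^ 2 ≤ ymax) (hmax : e ≤ ymax) :
    (((Finset.univ.filter fun ω : Fin m → Fin N =>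
      ∑ k, y (ω k) ^ 2 <
      m * e - (Real.sqrt (2 * (m * (e * (ymax - e))) * L) + 2 / 3 * e * L)).card : ℕ) : ℝ)
        ≤ Real.exp (-L) * (N : ℝ) ^ m := by
  have hZ0 : ∑ i, (e - y i ^ 2) = 0 := by
    rw [Finset.sum_sub_distrib, hY]; simp
  have hS : ∀ ω : Fin m → Fin N, ∑ k, (e - y (ω k) ^ 2) = m * e - ∑ k, y (ω k) ^ 2 := by
    intro ω; rw [Finset.sum_sub_distrib]; simp
  rcases hmax.eq_or_lt with h | h
  · have : (Finset.univ.filter fun ω : Fin m → Fin N =>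
      ∑ k, y (ω k) ^ 2 <
      m * e - (Real.sqrt (2 * (m * (e * (ymax - e))) * L) + 2 / 3 * e * L)) = ∅ := by
      rw [Finset.filter_eq_empty_iff]
      intro ω _
      have hz := (Finset.sum_eq_zero_iff_of_nonneg
        (fun i _ => by have := hy i; linarith : ∀ i ∈ Finset.univ, 0 ≤ e - y i ^ 2)).1 hZ0
      have : ∑ k, (e - y (ω k) ^ 2) = 0 :=
        Finset.sum_eq_zero fun k _ => hz (ω k) (Finset.mem_univ _)
      rw [hS] at this
      have h1 := Real.sqrt_nonneg (2 * (m * (e * (ymax - e))) * L)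
      have h2 : 0 ≤ 2 / 3 * e * L := by positivity
      rw [not_lt]
      linarith
    rw [this]
    simp
    positivity
  · have hp : 0 < ymax - e := by linarith
    refine aux_bernstein N m (fun i => e - y i ^ 2) (e * (ymax - e)) e L hm
      (by positivity) he.le hL hZ0 ?_ (fun i => by have := sq_nonneg (y i); linarith) _ ?_
    · calc ∑ i, (e - y i ^ 2) ^ 2 ≤ ∑ i, ((ymax - 2 * e) * y i ^ 2 + e ^ 2) := by
            refine Finset.sum_le_sum fun i _ => ?_
            have := hy i
            nlinarith [sq_nonneg (y i)]
        _ = _ := by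
            rw [Finset.sum_add_distrib, ← Finset.mul_sum, hY]
            simp
            ring
    · intro ω hω
      rw [hS]
      have := (Finset.mem_filter.1 hω).2
      linarith

/-- numeric inequality for the vector tail -/
lemma aux_num (s τ r : ℝ) (hs : 1.1 ≤ s) (hτ0 : 0 ≤ τ) (hr : r * s ≤ 1)
    (hτ : τ ^ 2 = 1 + 4 * s + 10 / 3 * s ^ 2) :
    2 * (1 + τ * r / 3) * (s ^ 2 + 0.7) ≤ τ ^ 2 := by
  have hτ1 : τ ≤ 1 + 2 * s := by
    apply aux_le_of_sq _ (by linarith)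
    nlinarith
  have h1 : τ * (r * s) ≤ 1 + 2 * s := by
    have : τ * (r * s) ≤ τ * 1 := mul_le_mul_of_nonneg_left hr hτ0
    linarith
  have h2 : s * (2 * (1 + τ * r / 3) * (s ^ 2 + 0.7)) ≤ s * τ ^ 2 := by
    have : s * (2 * (1 + τ * r / 3) * (s ^ 2 + 0.7)) =
      2 * (s + τ * (r * s) / 3) * (s ^ 2 + 0.7) := by ring
    rw [this, hτ]
    have : 2 * (s + τ * (r * s) / 3) * (s ^ 2 + 0.7) ≤ 2 * (s + (1 + 2 * s) / 3) * (s ^ 2 + 0.7) := by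
      gcongr
    nlinarith
  exact le_of_mul_le_mul_left h2 (by linarith)

lemma aux_vec (N d m : ℕ) (hN : 0 < N) (hm : 0 < m) (U : Matrix (Fin N) (Fin d) ℝ)
    (y : Fin N → ℝ) (hyperp : Uᵀ *ᵥ y = 0) (ρ e ymax L : ℝ) (hρ : 0 < ρ) (he : 0 < e)
    (hr : ∀ i, U i ⬝ᵥ U i ≤ ρ) (hL : 1.3 ≤ L)
    (hY : ∑ i, y i ^ 2 = N * e) (hy : ∀ i, y i ^ 2 ≤ ymax)
    (hrL : ymax * L ≤ m * e) :
    (((Finset.univ.filter fun ω : Fin m → Fin N =>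
      m * (ρ * e) * (1 + 4 * Real.sqrt L + 10 / 3 * L) <
        ∑ j, (∑ k, y (ω k) * U (ω k) j) ^ 2).card : ℕ) : ℝ) ≤ Real.exp (-L) * (N : ℝ) ^ m := by
  set x : Fin N → EuclideanSpace ℝ (Fin d) := fun i => WithLp.toLp 2 (fun j => y i * U i j) with hx
  have hmr : (0:ℝ) < m := by exact_mod_cast hm
  have hymax : 0 ≤ ymax := (sq_nonneg _).trans (hy ⟨0, hN⟩)
  set s := Real.sqrt L with hsdef
  have hs2 : s ^ 2 = L := Real.sq_sqrt (by linarith)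
  have hs : 1.1 ≤ s := Real.le_sqrt_of_sq_le (by norm_num; linarith)
  set τ := Real.sqrt (1 + 4 * s + 10 / 3 * s ^ 2) with hτdef
  have hτ2 : τ ^ 2 = 1 + 4 * s + 10 / 3 * s ^ 2 := Real.sq_sqrt (by positivity)
  have hτp : 0 < τ := Real.sqrt_pos.2 (by positivity)
  set V : ℝ := m * (ρ * e) with hV
  have hVp : 0 < V := by positivity
  set w := Real.sqrt V with hw
  have hw2 : w ^ 2 = V := Real.sq_sqrt hVp.le
  have hwp : 0 < w := Real.sqrt_pos.2 hVp
  set M := Real.sqrt (ymax * ρ) with hM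
  have hM2 : M ^ 2 = ymax * ρ := Real.sq_sqrt (by positivity)
  have hM0 : 0 ≤ M := Real.sqrt_nonneg _
  have hnx : ∀ i, ‖x i‖ ^ 2 = y i ^ 2 * (U i ⬝ᵥ U i) := by
    intro i
    rw [EuclideanSpace.real_norm_sq_eq]
    simp only [hx, dotProduct, Finset.mul_sum]
    refine Finset.sum_congr rfl fun j _ => ?_
    ring
  have hns : ∀ ω : Fin m → Fin N, ‖∑ k, x (ω k)‖ ^ 2 = ∑ j, (∑ k, y (ω k) * U (ω k) j) ^ 2 := by
    intro ω
    rw [EuclideanSpace.real_norm_sq_eq]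
    simp [hx]
  have hx0 : ∑ i, x i = 0 := by
    ext j
    have := congrFun hyperp j
    simp only [mulVec, dotProduct, transpose_apply, Pi.zero_apply] at this
    simp only [hx, WithLp.ofLp_sum, Finset.sum_apply]
    simpa [mul_comm] using this
  have hrr : ∀ i, 0 ≤ U i ⬝ᵥ U i := fun i => by
    simp only [dotProduct]; exact Finset.sum_nonneg fun j _ => mul_self_nonneg _
  refine (aux_pinelis N m x (ρ * e) M (τ * w) hm (by positivity) hM0 (by positivity) hx0 ?_ ?_ _ ?_).trans ?_
  · calc ∑ i, ‖x i‖ ^ 2 ≤ ∑ i, ρ * y i ^ 2 := by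
          refine Finset.sum_le_sum fun i _ => ?_
          rw [hnx, mul_comm]
          exact mul_le_mul_of_nonneg_right (hr i) (sq_nonneg _)
      _ = _ := by rw [← Finset.mul_sum, hY]; ring
  · intro i
    apply aux_le_of_sq _ hM0
    rw [hnx, hM2]
    exact mul_le_mul (hy i) (hr i) (hrr i) hymax
  · intro ω hω
    have h1 := (Finset.mem_filter.1 hω).2
    apply aux_le_of_sq _ (norm_nonneg _)
    rw [hns, mul_pow, hτ2, hw2, hs2]
    linarith
  · gcongr
    have h2 : (2:ℝ) ≤ Real.exp 0.7 := by
      have : Real.log 2 ≤ 0.7 := by have := Real.log_two_lt_d9; linarith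
      exact (Real.log_le_iff_le_exp (by norm_num)).1 this
    have h3 : L + 0.7 ≤ (τ * w) ^ 2 / (2 * (V + τ * w * M / 3)) := by
      rw [le_div_iff₀ (by positivity)]
      have hrs : M / w * s ≤ 1 := by
        rw [div_mul_eq_mul_div, div_le_one hwp]
        apply aux_le_of_sq _ hwp.le
        rw [mul_pow, hM2, hs2, hw2, hV]
        nlinarith
      have := aux_num s τ (M / w) hs hτp.le hrs hτ2
      have h4 := mul_le_mul_of_nonneg_left this (sq_nonneg w)
      have h5 : w ^ 2 * (2 * (1 + τ * (M / w) / 3) * (s ^ 2 + 0.7)) =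
          (L + 0.7) * (2 * (V + τ * w * M / 3)) := by
        rw [hs2, ← hw2]; field_simp
      rw [h5] at h4
      linarith
    calc 2 * Real.exp (-((τ * w) ^ 2 / (2 * (V + τ * w * M / 3))))
        ≤ Real.exp 0.7 * Real.exp (-(L + 0.7)) := by gcongr
      _ = Real.exp (-L) := by rw [← Real.exp_add]; congr 1; ring

lemma aux_residual {d m : ℕ} (V : Matrix (Fin m) (Fin d) ℝ) (z : Fin m → ℝ)
    (Q : Matrix (Fin d) (Fin d) ℝ) (a : Fin d → ℝ) (hQ : Qᵀ * Q = 1) (hG : Vᵀ * V = auxSp Q a)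
    (c : ℝ) (hc : 0 < c) (ha : ∀ i, c ≤ a i) :
    IsUnit (Vᵀ * V) ∧
    ∑ k, z k ^ 2 - (∑ j, (Vᵀ *ᵥ z) j ^ 2) / c ≤
      ∑ k, (z k - (V *ᵥ ((Vᵀ * V)⁻¹ *ᵥ (Vᵀ *ᵥ z))) k) ^ 2 ∧
    ∑ k, (z k - (V *ᵥ ((Vᵀ * V)⁻¹ *ᵥ (Vᵀ *ᵥ z))) k) ^ 2 ≤ ∑ k, z k ^ 2 := by
  have hap : ∀ i, 0 < a i := fun i => hc.trans_le (ha i)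
  set G := Vᵀ * V with hGdef
  have hinv : G * auxSp Q (fun i => (a i)⁻¹) = 1 := by
    rw [hG, auxSp_mul Q hQ]
    have : (fun i => a i * (a i)⁻¹) = fun _ => (1:ℝ) := by
      ext i; exact mul_inv_cancel₀ (hap i).ne'
    rw [this, auxSp_one Q hQ]
  have hGi : G⁻¹ = auxSp Q (fun i => (a i)⁻¹) := inv_eq_right_inv hinv
  have hunit : IsUnit G := IsUnit.of_mul_eq_one _ hinv
  set b := Vᵀ *ᵥ z with hb
  set g := G⁻¹ *ᵥ b with hg
  have hGg : G *ᵥ g = b := by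
    rw [hg, mulVec_mulVec, hGi, hinv, one_mulVec]
  have hzV : ∀ x, z ⬝ᵥ (V *ᵥ x) = b ⬝ᵥ x := by
    intro x
    rw [dotProduct_mulVec, hb, mulVec_transpose]
  have hVV : (V *ᵥ g) ⬝ᵥ (V *ᵥ g) = b ⬝ᵥ g := by
    rw [dotProduct_mulVec, ← mulVec_transpose, mulVec_mulVec, ← hGdef, hGg]
  have hR : ∑ k, (z k - (V *ᵥ g) k) ^ 2 = ∑ k, z k ^ 2 - b ⬝ᵥ g := by
    have : ∑ k, (z k - (V *ᵥ g) k) ^ 2 = ∑ k, z k ^ 2 - 2 * (z ⬝ᵥ (V *ᵥ g)) + (V *ᵥ g) ⬝ᵥ (V *ᵥ g) := by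
      simp only [dotProduct, Finset.mul_sum, ← Finset.sum_sub_distrib, ← Finset.sum_add_distrib]
      refine Finset.sum_congr rfl fun k _ => ?_
      ring
    rw [this, hVV, hzV]; ring
  have hbg : b ⬝ᵥ g = ∑ i, (a i)⁻¹ * (Qᵀ *ᵥ b) i ^ 2 := by
    rw [hg, hGi, auxSp_quad]
  have hbb : ∑ i, (Qᵀ *ᵥ b) i ^ 2 = ∑ j, b j ^ 2 := by
    have := auxSp_quad Q (fun _ => 1) b
    rw [auxSp_one Q hQ, one_mulVec] at this
    simp only [one_mul] at this
    rw [← this]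
    simp only [dotProduct]
    refine Finset.sum_congr rfl fun k _ => ?_
    ring
  refine ⟨hunit, ?_, ?_⟩
  · rw [hR, hbg]
    have : ∑ i, (a i)⁻¹ * (Qᵀ *ᵥ b) i ^ 2 ≤ (∑ j, b j ^ 2) / c := by
      rw [← hbb, Finset.sum_div]
      refine Finset.sum_le_sum fun i _ => ?_
      rw [div_eq_inv_mul]
      have := ha i
      gcongr
    linarith
  · rw [hR, hbg]
    have : 0 ≤ ∑ i, (a i)⁻¹ * (Qᵀ *ᵥ b) i ^ 2 := Finset.sum_nonneg fun i _ => by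
      have := hap i
      positivity
    linarith

lemma aux_coherence {N d : ℕ} (U : Matrix (Fin N) (Fin d) ℝ) (hU : Uᵀ * U = 1) (i : Fin N) :
    ∑ j, ((U * Uᵀ) j i) ^ 2 = U i ⬝ᵥ U i := by
  have h : (U * Uᵀ) * (U * Uᵀ) = U * Uᵀ := by
    rw [Matrix.mul_assoc, ← Matrix.mul_assoc Uᵀ, hU, Matrix.one_mul]
  have h1 := congrFun (congrFun h i) i
  rw [Matrix.mul_apply] at h1
  have h2 : (U * Uᵀ) i i = U i ⬝ᵥ U i := by simp [Matrix.mul_apply, dotProduct]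
  rw [← h2, ← h1]
  refine Finset.sum_congr rfl fun j _ => ?_
  have : (U * Uᵀ) i j = (U * Uᵀ) j i := by simp [Matrix.mul_apply, mul_comm]
  rw [this]; ring
lemma aux_mineig {N d m : ℕ} (hN : 0 < N) (hd : 0 < d) (hm : 0 < m)
    (U : Matrix (Fin N) (Fin d) ℝ) (hU : Uᵀ * U = 1)
    (D γ δ : ℝ) (hD : 0 < D) (hγ0 : 0 ≤ γ) (hδ : 0 < δ) (hδ1 : δ < 1)
    (hγ2 : γ ^ 2 = 8 * D * Real.log (2 * d / δ) / (3 * m))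
    (hr : ∀ i, U i ⬝ᵥ U i ≤ D / N)
    (Q : (Fin m → Fin N) → Matrix (Fin d) (Fin d) ℝ) (a : (Fin m → Fin N) → Fin d → ℝ)
    (hQ : ∀ ω, (Q ω)ᵀ * Q ω = 1)
    (hA : ∀ ω, ∑ k, vecMulVec (U (ω k)) (U (ω k)) = auxSp (Q ω) (a ω))
    (B : Finset (Fin m → Fin N)) (hB : ∀ ω ∈ B, ∃ i, a ω i < (1 - γ) * m / N) :
    (B.card : ℝ) ≤ δ * (N : ℝ) ^ m := by
  have hNr : (0:ℝ) < N := by exact_mod_cast hN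
  have hmr : (0:ℝ) < m := by exact_mod_cast hm
  have hd1 : (1:ℝ) ≤ d := by exact_mod_cast hd
  set θ := γ * N / D with hθ
  have hθ0 : 0 ≤ θ := by positivity
  have h1 := aux_chernoff hN U hU (D / N) θ hθ0 (by positivity) hr Q a hQ hA
  have h2 := aux_markov (fun ω => ∑ i, Real.exp (-θ * a ω i))
    (fun ω => Finset.sum_nonneg fun i _ => (Real.exp_pos _).le)
    (Real.exp (-θ * ((1 - γ) * m / N))) B (by
      intro ω hω
      obtain ⟨i, hi⟩ := hB ω hω
      refine le_trans ?_ (Finset.single_le_sum (f := fun i => Real.exp (-θ * a ω i))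
        (fun i _ => (Real.exp_pos _).le) (Finset.mem_univ i))
      apply Real.exp_le_exp.2
      have := mul_le_mul_of_nonneg_left hi.le hθ0
      linarith)
  have h3 := h2.trans h1
  rw [← le_div_iff₀ (Real.exp_pos _), mul_div_assoc, ← Real.exp_sub] at h3
  have hX : 0 < 2 * d / δ := by positivity
  have hlog : 0 ≤ Real.log (2 * d / δ) := by
    apply Real.log_nonneg
    rw [le_div_iff₀ hδ]
    linarith
  have h4 : -(↑m / ↑N * (θ - θ ^ 2 * (D / ↑N) / 2)) - -θ * ((1 - γ) * ↑m / ↑N)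
      = - (m * γ ^ 2 / (2 * D)) := by
    rw [hθ]; field_simp; ring
  have h5 : m * γ ^ 2 / (2 * D) = 4 / 3 * Real.log (2 * d / δ) := by
    rw [hγ2]; field_simp; ring
  rw [h4, h5] at h3
  have h6 : Real.exp (-(4 / 3 * Real.log (2 * d / δ))) ≤ δ / (2 * d) := by
    calc _ ≤ Real.exp (-Real.log (2 * d / δ)) := by
          apply Real.exp_le_exp.2; linarith
      _ = _ := by rw [Real.exp_neg, Real.exp_log hX, inv_div]
  calc (B.card : ℝ) ≤ (N:ℝ) ^ m * d * Real.exp (-(4 / 3 * Real.log (2 * d / δ))) := h3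
    _ ≤ (N:ℝ) ^ m * d * (δ / (2 * d)) := by gcongr
    _ = (δ * (N:ℝ) ^ m) / 2 := by field_simp
    _ ≤ _ := by
      have : 0 ≤ δ * (N:ℝ) ^ m := by positivity
      linarith

set_option maxHeartbeats 2000000

/-- **Theorem 2 (elementwise-sampling energy estimation).**
`U` is an `N × d` real matrix with orthonormal columns, `μS` is the coherence of its
column space `S` (with `P = UUᵀ` the orthogonal projection onto `S`), and `y` is a
nonzero vector orthogonal to `S`.  Sampling with replacement is modeled by the uniform
distribution on the finite sample space `Fin m → Fin N`, probabilities being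
`#(event) / N ^ m`. -/
theorem tensor_matched_subspace_elementwise_energy_estimation
    (N d m : ℕ) (hN : 0 < N) (hd : 0 < d) (hdN : d ≤ N) (hm : 0 < m)
    (δ : ℝ) (hδ : 0 < δ)
    (U : Matrix (Fin N) (Fin d) ℝ)
    (hU : Uᵀ * U = 1)
    (μS : ℝ)
    (hμS : IsGreatest
      (Set.range fun i : Fin N => (N / d : ℝ) * ∑ j, ((U * Uᵀ) j i) ^ 2) μS)
    (y : Fin N → ℝ) (hy : y ≠ 0)
    (hyperp : Uᵀ *ᵥ y = 0)
    (ymax : ℝ)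
    (hymax : IsGreatest (Set.range fun i : Fin N => y i ^ 2) ymax)
    (hsize : (8 / 3 : ℝ) * d * μS * Real.log (2 * d / δ) ≤ m)
    (γ α β : ℝ)
    (hγ : γ = Real.sqrt (8 * d * μS * Real.log (2 * d / δ) / (3 * m)))
    (hγ1 : γ < 1)
    (hα : α = Real.sqrt (2 * (N * ymax - ∑ i, y i ^ 2) / (m * ∑ i, y i ^ 2)
                * Real.log (1 / δ))
            + 2 * (N * ymax - ∑ i, y i ^ 2) / (3 * m * ∑ i, y i ^ 2)
                * Real.log (1 / δ))
    (hβ : β = (1 + 2 * Real.sqrt (Real.log (1 / δ))) ^ 2) :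
    1 - 4 * δ ≤
      (Set.ncard {ω : Fin m → Fin N |
        let UΩ : Matrix (Fin m) (Fin d) ℝ := Matrix.of fun k l => U (ω k) l
        let yΩ : Fin m → ℝ := fun k => y (ω k)
        let G : Matrix (Fin d) (Fin d) ℝ := UΩᵀ * UΩ
        let R : ℝ := ∑ k, (yΩ k - (UΩ *ᵥ (G⁻¹ *ᵥ (UΩᵀ *ᵥ yΩ))) k) ^ 2
        IsUnit G ∧
        (m * (1 - α) - d * μS * β / (1 - γ)) / N * ∑ i, y i ^ 2 ≤ R ∧
        R ≤ (1 + α) * (m / N) * ∑ i, y i ^ 2} : ℝ) / (N : ℝ) ^ m := by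
  have hNr : (0:ℝ) < N := by exact_mod_cast hN
  have hmr : (0:ℝ) < m := by exact_mod_cast hm
  have hd1 : (1:ℝ) ≤ d := by exact_mod_cast hd
  have hdr : (0:ℝ) < d := by linarith
  by_cases hδ4 : 1 ≤ 4 * δ
  · exact le_trans (by linarith) (div_nonneg (Nat.cast_nonneg _) (by positivity))
  have hδ1 : δ < 1 / 4 := by linarith
  -- the coherence
  set D : ℝ := d * μS with hDdef
  have hr : ∀ i, U i ⬝ᵥ U i ≤ D / N := by
    intro i
    have h1 := hμS.2 ⟨i, rfl⟩
    simp only [aux_coherence U hU] at h1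
    rw [hDdef, le_div_iff₀ hNr]
    have h2 := mul_le_mul_of_nonneg_left h1 hdr.le
    have h3 : (d:ℝ) * (N / d * (U i ⬝ᵥ U i)) = U i ⬝ᵥ U i * N := by field_simp
    linarith
  have hsumr : ∑ i, U i ⬝ᵥ U i = (d : ℝ) := by
    have h1 : trace (Uᵀ * U) = (d : ℝ) := by rw [hU]; simp
    rw [← h1]
    simp only [trace, diag_apply, Matrix.mul_apply, transpose_apply, dotProduct]
    exact Finset.sum_comm
  have hD1 : 1 ≤ D := by
    have h1 : ∑ i, U i ⬝ᵥ U i ≤ ∑ i : Fin N, D / N := Finset.sum_le_sum fun i _ => hr i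
    have h2 : ∑ i : Fin N, D / (N:ℝ) = D := by
      simp; field_simp
    rw [hsumr, h2] at h1
    linarith
  have hD0 : 0 < D := by linarith
  -- the signal
  set Y := ∑ i, y i ^ 2 with hYdef
  have hYp : 0 < Y := by
    obtain ⟨i, hi⟩ := Function.ne_iff.1 hy
    have h1 : y i ^ 2 ≤ Y := Finset.single_le_sum (f := fun i => y i ^ 2)
      (fun i _ => sq_nonneg _) (Finset.mem_univ i)
    have h2 : 0 < y i ^ 2 := by
      have : y i ≠ 0 := hi
      positivity
    linarith
  obtain ⟨e, he⟩ : ∃ e, e = Y / N := ⟨_, rfl⟩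
  have hYe : Y = N * e := by rw [he]; field_simp
  have hep : 0 < e := by rw [he]; positivity
  have hyle : ∀ i, y i ^ 2 ≤ ymax := fun i => hymax.2 ⟨i, rfl⟩
  have hmax : e ≤ ymax := by
    have h1 : Y ≤ ∑ i : Fin N, ymax := Finset.sum_le_sum fun i _ => hyle i
    simp at h1
    rw [hYe] at h1
    exact le_of_mul_le_mul_left h1 hNr
  -- logarithms
  set L := Real.log (1 / δ) with hLdef
  have hexpL : Real.exp (-L) = δ := by
    rw [hLdef, Real.exp_neg, Real.exp_log (by positivity)]; simp
  have hL : 1.3 ≤ L := by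
    have h1 : Real.log 4 ≤ L := by
      apply Real.log_le_log (by norm_num)
      rw [le_div_iff₀ hδ]; linarith
    have h2 : Real.log 4 = 2 * Real.log 2 := by
      rw [show (4:ℝ) = 2 ^ 2 by norm_num, Real.log_pow]; norm_num
    have := Real.log_two_gt_d9
    norm_num at *
    linarith
  have hL0 : 0 < L := by norm_num at hL; linarith
  have hLL : L ≤ Real.log (2 * d / δ) := by
    apply Real.log_le_log (by positivity)
    gcongr
    linarith
  have hLm : 8 / 3 * L ≤ m := by
    have h1 : 1 * L ≤ D * Real.log (2 * d / δ) := by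
      apply mul_le_mul hD1 hLL hL0.le hD0.le
    have h2 : (8 / 3 : ℝ) * d * μS * Real.log (2 * d / δ) = 8 / 3 * (D * Real.log (2 * d / δ)) := by
      rw [hDdef]; ring
    rw [h2] at hsize
    linarith
  have hγ0 : 0 ≤ γ := by rw [hγ]; exact Real.sqrt_nonneg _
  have hγ2 : γ ^ 2 = 8 * D * Real.log (2 * d / δ) / (3 * m) := by
    rw [hγ, Real.sq_sqrt]
    · rw [hDdef]; ring
    · have h1 : 8 * (d:ℝ) * μS = 8 * D := by rw [hDdef]; ring
      rw [h1]
      have : 0 < Real.log (2 * d / δ) := by linarith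
      positivity
  have hγp : 0 < 1 - γ := by linarith
  -- alpha
  have hαe : m * e * α = Real.sqrt (2 * (m * (e * (ymax - e))) * L) + 2 / 3 * (ymax - e) * L := by
    have h1 : Real.sqrt (2 * (N * ymax - Y) / (m * Y) * L) * (m * e) =
        Real.sqrt (2 * (m * (e * (ymax - e))) * L) := by
      have h2 : (m * e : ℝ) = Real.sqrt ((m * e) ^ 2) := (Real.sqrt_sq (by positivity)).symm
      nth_rewrite 1 [h2]
      rw [← Real.sqrt_mul' _ (by positivity)]
      congr 1
      rw [hYe]
      field_simp
    rw [hα, mul_add, ← h1, hYe]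
    field_simp
  have hα1 : α < 1 → ymax * L ≤ m * e := by
    intro h
    have h0 : 0 ≤ 2 / 3 * (ymax - e) * L := by
      have : 0 ≤ ymax - e := by linarith
      positivity
    have h1 : Real.sqrt (2 * (m * (e * (ymax - e))) * L) < m * e := by
      have : m * e * α < m * e * 1 := mul_lt_mul_of_pos_left h (by positivity)
      linarith
    rw [Real.sqrt_lt' (by positivity)] at h1
    have h2 : (m * e) * (2 * (ymax - e) * L) < (m * e) * (m * e) := by linarith
    have h3 := lt_of_mul_lt_mul_left h2 (by positivity)
    have h4 := mul_le_mul_of_nonneg_left hLm hep.le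
    have : 0 ≤ m * e := by positivity
    linarith
  have hα0 : 0 ≤ α := by
    have h0 : 0 ≤ 2 / 3 * (ymax - e) * L := by
      have : 0 ≤ ymax - e := by linarith
      positivity
    have h1 := Real.sqrt_nonneg (2 * (m * (e * (ymax - e))) * L)
    have h2 : 0 ≤ m * e * α := by linarith
    exact nonneg_of_mul_nonneg_right h2 (by positivity)
  -- spectral decompositions
  have hspec : ∀ ω : Fin m → Fin N, ∃ (Q : Matrix (Fin d) (Fin d) ℝ) (a : Fin d → ℝ),
      Qᵀ * Q = 1 ∧ ∑ k, vecMulVec (U (ω k)) (U (ω k)) = auxSp Q a := by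
    intro ω
    apply aux_spectral
    rw [transpose_sum]
    exact Finset.sum_congr rfl fun k _ => by rw [transpose_vecMulVec]
  choose Q a hQ hA using hspec
  classical
  -- the bad events
  set B1 := (Finset.univ.filter fun ω : Fin m → Fin N =>
      m * e + (Real.sqrt (2 * (m * (e * (ymax - e))) * L) + 2 / 3 * (ymax - e) * L)
        < ∑ k, y (ω k) ^ 2) with hB1
  set B2 := (Finset.univ.filter fun ω : Fin m → Fin N =>
      ∑ k, y (ω k) ^ 2 <
      m * e - (Real.sqrt (2 * (m * (e * (ymax - e))) * L) + 2 / 3 * e * L)) with hB2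
  set B3 := (Finset.univ.filter fun ω : Fin m → Fin N => ∃ i, a ω i < (1 - γ) * m / N) with hB3
  obtain ⟨B4, hB4c, hB4⟩ : ∃ B4 : Finset (Fin m → Fin N), (B4.card : ℝ) ≤ δ * (N:ℝ) ^ m ∧
      (α < 1 → ∀ ω, ω ∉ B4 → ∑ j, (∑ k, y (ω k) * U (ω k) j) ^ 2 ≤
        m * (D / N * e) * (1 + 4 * Real.sqrt L + 10 / 3 * L)) := by
    by_cases h : α < 1
    · refine ⟨Finset.univ.filter fun ω : Fin m → Fin N =>
        m * (D / N * e) * (1 + 4 * Real.sqrt L + 10 / 3 * L) <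
          ∑ j, (∑ k, y (ω k) * U (ω k) j) ^ 2, ?_, ?_⟩
      rotate_left
      · intro _ ω hω
        by_contra hcon
        exact hω (Finset.mem_filter.2 ⟨Finset.mem_univ ω, not_le.1 hcon⟩)
      · rw [← hexpL]
        exact aux_vec N d m hN hm U y hyperp (D / N) e ymax L (by positivity) hep hr hL hYe hyle (hα1 h)
    · exact ⟨∅, by simp; positivity, fun h' => absurd h' h⟩
  have hB1c : (B1.card : ℝ) ≤ δ * (N:ℝ) ^ m := by
    rw [← hexpL]; exact aux_upper N m hN hm y e ymax L hL0 hep hYe hyle hmax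
  have hB2c : (B2.card : ℝ) ≤ δ * (N:ℝ) ^ m := by
    rw [← hexpL]; exact aux_lower N m hN hm y e ymax L hL0 hep hYe hyle hmax
  have hB3c : (B3.card : ℝ) ≤ δ * (N:ℝ) ^ m :=
    aux_mineig hN hd hm U hU D γ δ hD0 hγ0 hδ (by linarith) hγ2 hr Q a hQ hA B3
      (fun ω hω => (Finset.mem_filter.1 hω).2)
  have hpw : (0:ℝ) < (N:ℝ) ^ m := by positivity
  rw [le_div_iff₀ hpw]
  have hcard : (N:ℝ) ^ m - 4 * (δ * (N:ℝ) ^ m) ≤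
      (((B1 ∪ B2 ∪ B3 ∪ B4)ᶜ : Finset (Fin m → Fin N)).card : ℝ) := by
    have h1 : ((B1 ∪ B2 ∪ B3 ∪ B4).card : ℝ) ≤ B1.card + B2.card + B3.card + B4.card := by
      have h2 := Finset.card_union_le (B1 ∪ B2 ∪ B3) B4
      have h3 := Finset.card_union_le (B1 ∪ B2) B3
      have h4 := Finset.card_union_le B1 B2
      exact_mod_cast (by omega : (B1 ∪ B2 ∪ B3 ∪ B4).card ≤ B1.card + B2.card + B3.card + B4.card)
    have h5 : ((B1 ∪ B2 ∪ B3 ∪ B4).card : ℝ) +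
        (((B1 ∪ B2 ∪ B3 ∪ B4)ᶜ : Finset (Fin m → Fin N)).card : ℝ) = (N:ℝ) ^ m := by
      have := Finset.card_add_card_compl (B1 ∪ B2 ∪ B3 ∪ B4)
      simp only [Fintype.card_pi, Fintype.card_fin, Finset.prod_const, Finset.card_univ] at this
      exact_mod_cast this
    linarith
  refine le_trans (by linarith) (hcard.trans ?_)
  rw [← Set.ncard_coe_finset]
  refine Nat.cast_le.2 (Set.ncard_le_ncard ?_ (Set.toFinite _))
  intro ω hω
  have hω' : ω ∉ B1 ∪ B2 ∪ B3 ∪ B4 := Finset.mem_compl.1 (Finset.mem_coe.1 hω)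
  simp only [Finset.mem_union, not_or] at hω'
  obtain ⟨⟨⟨n1, n2⟩, n3⟩, n4⟩ := hω'
  simp only [hB1, hB2, hB3, Finset.mem_filter, Finset.mem_univ, true_and, not_lt, not_exists]
    at n1 n2 n3
  have hc : 0 < (1 - γ) * m / N := by positivity
  set UΩ : Matrix (Fin m) (Fin d) ℝ := Matrix.of fun k l => U (ω k) l with hUΩ
  have hG : UΩᵀ * UΩ = auxSp (Q ω) (a ω) := by
    rw [← hA]
    ext p q
    simp [hUΩ, Matrix.sum_apply, vecMulVec_apply, Matrix.mul_apply]
  obtain ⟨g1, g2, g3⟩ := aux_residual UΩ (fun k => y (ω k)) (Q ω) (a ω) (hQ ω) hG _ hc n3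
  refine ⟨g1, ?_, ?_⟩
  · by_cases h : α < 1
    · refine le_trans ?_ g2
      have h4 := hB4 h ω n4
      have hb : ∑ j, (UΩᵀ *ᵥ fun k => y (ω k)) j ^ 2 = ∑ j, (∑ k, y (ω k) * U (ω k) j) ^ 2 := by
        refine Finset.sum_congr rfl fun j _ => ?_
        simp [hUΩ, mulVec, dotProduct, mul_comm]
      rw [hb]
      have h5 : (∑ j, (∑ k, y (ω k) * U (ω k) j) ^ 2) / ((1 - γ) * m / N) ≤
          D * e / (1 - γ) * (1 + 4 * Real.sqrt L + 10 / 3 * L) := by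
        rw [div_le_iff₀ hc]
        refine h4.trans (le_of_eq ?_)
        field_simp
      have hβ' : β = (1 + 4 * Real.sqrt L + 10 / 3 * L) + 2 / 3 * L := by
        have := Real.sq_sqrt hL0.le
        rw [hβ, add_sq, mul_pow, this]; ring
      have h6 : e * (2 / 3 * L) ≤ D * e / (1 - γ) * (2 / 3 * L) := by
        have : e ≤ D * e / (1 - γ) := by
          rw [le_div_iff₀ hγp]
          nlinarith
        gcongr
      have h7 : (m * (1 - α) - D * β / (1 - γ)) / N * Y =
          m * e - m * e * α - D * e / (1 - γ) * (1 + 4 * Real.sqrt L + 10 / 3 * L)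
            - D * e / (1 - γ) * (2 / 3 * L) := by
        rw [hYe, hβ']; field_simp; ring
      rw [h7, hαe]
      have h8 : 0 ≤ 2 / 3 * (ymax - e) * L := by
        have : 0 ≤ ymax - e := by linarith
        positivity
      linarith
    · refine le_trans ?_ (Finset.sum_nonneg fun k _ => sq_nonneg _)
      refine mul_nonpos_of_nonpos_of_nonneg (div_nonpos_of_nonpos_of_nonneg ?_ hNr.le) hYp.le
      have h1 : m * (1 - α) ≤ 0 := mul_nonpos_of_nonneg_of_nonpos hmr.le (by linarith)
      have h2 : 0 ≤ D * β / (1 - γ) := by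
        have : 0 ≤ β := by rw [hβ]; positivity
        positivity
      linarith
  · refine g3.trans (n1.trans (le_of_eq ?_))
    rw [← hαe, hYe]
    field_simp
end

section
/- Lemma 3 (invertibility of the sampled Gram matrix, tubal-sampling). Let δ > 0 and suppose γ := √(8c²n₂μ·log(2n₂n₃/δ)/(3m)) < 1. Then with probability at least 1 − δ, the matrix G := Σ_{k=1}^m A_{Ω(k)}ᴴ A_{Ω(k)} is invertible and its inverse satisfies ‖G⁻¹‖ ≤ n₁/((1−γ)·m), where ‖·‖ is the operator (spectral) norm. -/
open Matrix
open scoped BigOperators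

/-- The operator (spectral) norm of a square complex matrix. -/
noncomputable def matrixOpNorm {n : ℕ} (M : Matrix (Fin n) (Fin n) ℂ) : ℝ :=
  ‖Matrix.toEuclideanCLM (𝕜 := ℂ) M‖

section TubalAux
open scoped ComplexOrder

lemma norm_pow_sub_pow_le_aux {𝔸 : Type*} [NormedRing 𝔸] [NormOneClass 𝔸] (U V : 𝔸) (K : ℝ)
    (hU : ‖U‖ ≤ K) (hV : ‖V‖ ≤ K) (n : ℕ) :
    ‖U ^ (n+1) - V ^ (n+1)‖ ≤ (n+1) * ‖U - V‖ * K ^ n := by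
  have hK : 0 ≤ K := (norm_nonneg _).trans hU
  induction n with
  | zero => simp
  | succ n ih =>
    have e : U ^ (n+1+1) - V ^ (n+1+1) = U * (U ^ (n+1) - V^(n+1)) + (U - V) * V^(n+1) := by
      rw [pow_succ' U (n+1), pow_succ' V (n+1)]; noncomm_ring
    rw [e]
    have h1 : ‖V ^ (n+1)‖ ≤ K ^ (n+1) := (norm_pow_le _ _).trans (pow_le_pow_left₀ (norm_nonneg _) hV _)
    calc _ ≤ ‖U‖ * ‖U ^ (n+1) - V^(n+1)‖ + ‖U - V‖ * ‖V^(n+1)‖ :=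
          (norm_add_le _ _).trans (add_le_add (norm_mul_le _ _) (norm_mul_le _ _))
      _ ≤ K * ((n+1) * ‖U - V‖ * K ^ n) + ‖U - V‖ * K^(n+1) := by gcongr
      _ = _ := by push_cast; ring

open NormedSpace in
lemma norm_exp_le_aux {𝔸 : Type*} [NormedRing 𝔸] [NormOneClass 𝔸] [NormedAlgebra ℝ 𝔸] [CompleteSpace 𝔸] (x : 𝔸) :
    ‖exp x‖ ≤ Real.exp ‖x‖ := by
  let _ : NormedAlgebra ℚ 𝔸 := NormedAlgebra.restrictScalars ℚ ℝ 𝔸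
  rw [congrFun (exp_eq_tsum (𝕂 := ℝ)) x]
  have h : HasSum (fun k : ℕ => ‖x‖ ^ k / (k.factorial : ℝ)) (Real.exp ‖x‖) := by
    rw [Real.exp_eq_exp_ℝ]
    exact exp_series_hasSum_exp' (𝕂 := ℝ) ‖x‖ |>.congr_fun (fun k => by simp [div_eq_inv_mul])
  refine tsum_of_norm_bounded h fun k => ?_
  rw [norm_smul, div_eq_inv_mul]
  gcongr
  · simp
  · exact norm_pow_le _ _

open NormedSpace Filter Topology in
lemma trotter_aux {𝔸 : Type*} [NormedRing 𝔸] [NormOneClass 𝔸] [NormedAlgebra ℝ 𝔸] [CompleteSpace 𝔸]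
    (a b : 𝔸) :
    Tendsto (fun n : ℕ => (exp ((1/((n:ℝ)+1)) • a) * exp ((1/((n:ℝ)+1)) • b)) ^ (n+1)) atTop
      (𝓝 (exp (a + b))) := by
  let _ : NormedAlgebra ℚ 𝔸 := NormedAlgebra.restrictScalars ℚ ℝ 𝔸
  set f : ℝ → 𝔸 := fun t => exp (t • a) * exp (t • b) - exp (t • (a+b)) with hf
  have hd : HasDerivAt f 0 0 := by
    have h1 := hasDerivAt_exp_smul_const (𝕂 := ℝ) a (0:ℝ)
    have h2 := hasDerivAt_exp_smul_const (𝕂 := ℝ) b (0:ℝ)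
    have h3 := hasDerivAt_exp_smul_const (𝕂 := ℝ) (a+b) (0:ℝ)
    refine ((h1.mul h2).sub h3).congr_deriv ?_
    simp [exp_zero]
  have ht : Tendsto (fun n : ℕ => (1/((n:ℝ)+1))) atTop (𝓝[≠] 0) := by
    refine tendsto_nhdsWithin_iff.2 ⟨tendsto_one_div_add_atTop_nhds_zero_nat, .of_forall fun n => ?_⟩
    simp; positivity
  have h0 := (hasDerivAt_iff_tendsto_slope.1 hd).comp ht
  rw [tendsto_iff_norm_sub_tendsto_zero]
  have h1 : Tendsto (fun n : ℕ => ‖slope f 0 (1/((n:ℝ)+1))‖ * Real.exp (‖a‖+‖b‖)) atTop (𝓝 0) := by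
    simpa using h0.norm.mul_const (Real.exp (‖a‖+‖b‖))
  refine squeeze_zero (fun _ => norm_nonneg _) (fun n => ?_) h1
  set t : ℝ := 1/((n:ℝ)+1) with htt
  have htp : 0 < t := by positivity
  have hE : exp (a+b) = exp (t • (a+b)) ^ (n+1) := by
    rw [← NormedSpace.exp_nsmul]
    congr 1
    rw [← Nat.cast_smul_eq_nsmul ℝ, smul_smul]
    rw [htt]; push_cast
    rw [mul_one_div_cancel (by positivity), one_smul]
  have hs : ‖slope f 0 t‖ = (n+1) * ‖f t‖ := by
    have : f 0 = 0 := by simp [hf]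
    rw [slope_def_module, this, norm_smul]
    simp [htt]
    left; positivity
  rw [hE, hs]
  have key := norm_pow_sub_pow_le_aux (exp (t • a) * exp (t • b)) (exp (t • (a+b)))
    (Real.exp (t * (‖a‖ + ‖b‖))) ?_ ?_ n
  · refine key.trans ?_
    gcongr
    rw [← Real.exp_nat_mul]
    apply Real.exp_le_exp.2
    rw [← mul_assoc]
    apply mul_le_of_le_one_left (by positivity)
    rw [htt, mul_one_div, div_le_one (by positivity)]
    linarith
  · calc _ ≤ ‖exp (t•a)‖ * ‖exp (t•b)‖ := norm_mul_le _ _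
      _ ≤ Real.exp ‖t•a‖ * Real.exp ‖t•b‖ := by gcongr <;> exact norm_exp_le_aux _
      _ = _ := by rw [← Real.exp_add, norm_smul, norm_smul, Real.norm_of_nonneg htp.le]; ring_nf
  · refine (norm_exp_le_aux _).trans (Real.exp_le_exp.2 ?_)
    rw [norm_smul, Real.norm_of_nonneg htp.le]
    gcongr
    exact norm_add_le _ _


/-- Cauchy-Schwarz for the trace. -/
lemma trace_cs_aux {n : Type*} [Fintype n] (C D : Matrix n n ℂ) :
    ‖(C * D).trace‖ ^ 2 ≤ (C * Cᴴ).trace.re * (D * Dᴴ).trace.re := by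
  have hC : ∀ C : Matrix n n ℂ, (C * Cᴴ).trace.re = ∑ p : n × n, ‖C p.1 p.2‖ ^ 2 := by
    intro C
    simp only [trace, diag, mul_apply, conjTranspose_apply, Complex.re_sum, Fintype.sum_prod_type]
    refine Finset.sum_congr rfl fun i _ => Finset.sum_congr rfl fun j _ => ?_
    rw [Complex.star_def, Complex.mul_conj, Complex.normSq_eq_norm_sq, Complex.ofReal_re]
  have hD : (D * Dᴴ).trace.re = ∑ p : n × n, ‖D p.2 p.1‖ ^ 2 := by
    rw [hC, Fintype.sum_prod_type, Finset.sum_comm, Fintype.sum_prod_type]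
  rw [hC, hD]
  have h1 : ‖(C * D).trace‖ ≤ ∑ p : n × n, ‖C p.1 p.2‖ * ‖D p.2 p.1‖ := by
    rw [Fintype.sum_prod_type]
    simp only [trace, diag, mul_apply]
    refine (norm_sum_le _ _).trans (Finset.sum_le_sum fun i _ => ?_)
    refine (norm_sum_le _ _).trans (Finset.sum_le_sum fun j _ => ?_)
    rw [norm_mul]
  calc _ ≤ (∑ p : n × n, ‖C p.1 p.2‖ * ‖D p.2 p.1‖)^2 := by gcongr
    _ ≤ _ := Finset.sum_mul_sq_le_sq_mul_sq _ _ _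

lemma trace_pow_comm_aux {n : Type*} [Fintype n] [DecidableEq n] (C D : Matrix n n ℂ) (k : ℕ) :
    ((C * D) ^ k).trace = ((D * C) ^ k).trace := by
  cases k with
  | zero => simp
  | succ k =>
    have : (C * D) ^ (k+1) = C * ((D * C) ^ k * D) := by
      have h : SemiconjBy C (D*C) (C*D) := by simp [SemiconjBy, mul_assoc]
      rw [← mul_assoc, (h.pow_right k).eq, mul_assoc, pow_succ]
    rw [this, trace_mul_comm, pow_succ, mul_assoc]

lemma trace_words_aux {n : Type*} [Fintype n] [DecidableEq n] (k : ℕ) : ∀ C D : Matrix n n ℂ,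
    ‖((C * D) ^ (2^k)).trace‖ ^ 2 ≤
      (((C * Cᴴ) ^ (2^k)).trace.re) * (((D * Dᴴ) ^ (2^k)).trace.re) := by
  induction k with
  | zero => intro C D; simpa using trace_cs_aux C D
  | succ k ih =>
    intro C D
    have h1 := ih (C * D) (C * D)
    have e1 : (C * D) * (C * D) = (C*D)^2 := (sq _).symm
    have e2 : (((C * D) * (C * D)ᴴ) ^ (2^k)).trace = (((Cᴴ * C) * (D * Dᴴ)) ^ (2^k)).trace := by
      rw [conjTranspose_mul, mul_assoc, trace_pow_comm_aux C]
      rw [← mul_assoc D, mul_assoc (D * Dᴴ), trace_pow_comm_aux (D * Dᴴ)]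
    have h2 := ih (Cᴴ * C) (D * Dᴴ)
    have hh : ∀ E : Matrix n n ℂ, E.IsHermitian → E * Eᴴ = E ^ 2 := fun E hE => by rw [hE.eq, sq]
    rw [hh _ (isHermitian_conjTranspose_mul_self C), hh _ (isHermitian_mul_conjTranspose_self D),
      ← pow_mul, ← pow_mul, ← pow_succ', trace_pow_comm_aux Cᴴ C] at h2
    rw [e1, ← pow_mul, ← pow_succ', e2] at h1
    refine le_trans ?_ h2
    refine h1.trans ?_
    rw [← sq, sq_le_sq, abs_of_nonneg (norm_nonneg _)]
    exact Complex.abs_re_le_norm _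

lemma trace_GT_pow_aux {n : Type*} [Fintype n] [DecidableEq n] (k : ℕ) : ∀ X Y : Matrix n n ℂ, X.IsHermitian → Y.IsHermitian →
    (((X * Y) ^ (2^(k+1))).trace).re ≤ (X ^ (2^(k+1)) * Y ^ (2^(k+1))).trace.re := by
  have base : ∀ k, ∀ X Y : Matrix n n ℂ, X.IsHermitian → Y.IsHermitian →
    (((X * Y) ^ (2^(k+1))).trace).re ≤ ((X^2 * Y^2) ^ (2^k)).trace.re := by
    intro k X Y hX hY
    have h := trace_words_aux k (X*Y) (X*Y)
    have e2 : (((X * Y) * (X * Y)ᴴ) ^ (2^k)).trace = ((X^2 * Y^2) ^ (2^k)).trace := by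
      rw [conjTranspose_mul, hX.eq, hY.eq, mul_assoc, trace_pow_comm_aux X, ← mul_assoc Y, mul_assoc (Y * Y), trace_pow_comm_aux (Y*Y), ← sq, ← sq]
    rw [← sq (X*Y), ← pow_mul, ← pow_succ', e2, ← sq] at h
    have hp : 0 ≤ ((X^2 * Y^2) ^ (2^k)).trace.re := by
      rw [← e2]
      exact (Complex.nonneg_iff.1 ((posSemidef_self_mul_conjTranspose (X*Y)).pow _).trace_nonneg).1
    exact (Complex.re_le_norm _).trans (abs_le_of_sq_le_sq' h hp).2
  induction k with
  | zero => intro X Y hX hY; simpa using base 0 X Y hX hY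
  | succ k ih =>
    intro X Y hX hY
    refine (base (k+1) X Y hX hY).trans ?_
    refine (ih _ _ (hX.pow 2) (hY.pow 2)).trans ?_
    rw [← pow_mul, ← pow_mul, ← pow_succ']

open NormedSpace Filter Topology in
open scoped Matrix.Norms.L2Operator in
lemma golden_thompson_aux {n : Type*} [Fintype n] [DecidableEq n] [Nonempty n]
    (A B : Matrix n n ℂ) (hA : A.IsHermitian) (hB : B.IsHermitian) :
    (exp (A + B)).trace.re ≤ (exp A * exp B).trace.re := by
  have h := trotter_aux A B
  have hs : Tendsto (fun k : ℕ => 2 ^ (k+1) - 1) atTop atTop := by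
    refine tendsto_atTop_mono (fun k => ?_) tendsto_id
    have : k + 1 < 2 ^ (k+1) := Nat.lt_two_pow_self
    simp; omega
  have h2 := h.comp hs
  have hc : Continuous (fun M : Matrix n n ℂ => M.trace.re) :=
    Complex.continuous_re.comp (Continuous.matrix_trace continuous_id)
  have h3 := (hc.tendsto _).comp h2
  refine le_of_tendsto h3 (.of_forall fun k => ?_)
  have e1 : 2 ^ (k+1) - 1 + 1 = 2 ^ (k+1) := Nat.sub_add_cancel Nat.one_le_two_pow
  have e2 : (((2 ^ (k+1) - 1 : ℕ) : ℝ) + 1) = ((2 ^ (k+1) : ℕ) : ℝ) := by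
    exact_mod_cast congrArg (Nat.cast (R := ℝ)) e1
  simp only [Function.comp_apply, e1, e2]
  set t : ℝ := 1 / ((2 ^ (k+1) : ℕ) : ℝ) with ht
  have ht' : ∀ M : Matrix n n ℂ, exp (t • M) ^ (2 ^ (k+1)) = exp M := by
    intro M
    rw [← Matrix.exp_nsmul]
    congr 1
    rw [← Nat.cast_smul_eq_nsmul ℝ, smul_smul, ht, mul_one_div_cancel (by positivity), one_smul]
  have hH : ∀ M : Matrix n n ℂ, M.IsHermitian → (exp (t • M)).IsHermitian := by
    intro M hM
    apply IsHermitian.exp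
    rw [IsHermitian, conjTranspose_smul, hM.eq]; simp
  have := trace_GT_pow_aux k _ _ (hH A hA) (hH B hB)
  rwa [ht', ht'] at this

lemma exp_spectral_aux {n : Type*} [Fintype n] [DecidableEq n] (H : Matrix n n ℂ)
    (hH : H.IsHermitian) (θ : ℝ) :
    NormedSpace.exp ((-θ) • H) = (hH.eigenvectorUnitary : Matrix n n ℂ) *
      diagonal (fun i => ((Real.exp (-θ * hH.eigenvalues i) : ℝ) : ℂ)) *
      (hH.eigenvectorUnitary : Matrix n n ℂ)ᴴ := by
  set U : Matrix n n ℂ := (hH.eigenvectorUnitary : Matrix n n ℂ) with hU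
  have h1 : U * Uᴴ = 1 := Unitary.coe_mul_star_self hH.eigenvectorUnitary
  have hinv : Uᴴ = U⁻¹ := (inv_eq_right_inv h1).symm
  have hunit : IsUnit U := IsUnit.of_mul_eq_one _ h1
  have hs : H = U * diagonal (fun i => (hH.eigenvalues i : ℂ)) * U⁻¹ := by
    rw [← hinv]
    exact hH.spectral_theorem
  have : (-θ) • H = U * diagonal (fun i => ((-θ * hH.eigenvalues i : ℝ) : ℂ)) * U⁻¹ := by
    conv_lhs => rw [hs]
    rw [← smul_mul_assoc, ← mul_smul_comm]
    congr 2
    rw [← diagonal_smul]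
    congr 1; ext i; simp
  rw [this, Matrix.exp_conj _ _ hunit, hinv, Matrix.exp_diagonal]
  congr 3
  ext i
  rw [Pi.coe_exp, ← Complex.exp_eq_exp_ℂ, Complex.ofReal_exp]

lemma trace_exp_aux {n : Type*} [Fintype n] [DecidableEq n] (H : Matrix n n ℂ)
    (hH : H.IsHermitian) (θ : ℝ) :
    (NormedSpace.exp ((-θ) • H)).trace.re = ∑ i, Real.exp (-θ * hH.eigenvalues i) := by
  rw [exp_spectral_aux H hH θ, trace_mul_cycle]
  have : (hH.eigenvectorUnitary : Matrix n n ℂ)ᴴ * (hH.eigenvectorUnitary : Matrix n n ℂ) = 1 :=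
    Unitary.coe_star_mul_self hH.eigenvectorUnitary
  rw [this, one_mul, trace_diagonal, Complex.re_sum]
  rfl

lemma exp_le_aux {n : Type*} [Fintype n] [DecidableEq n] (X : Matrix n n ℂ)
    (hX : X.PosSemidef) (R θ κ : ℝ) (hR : 0 < R) (hκ : κ = (1 - Real.exp (-(θ * R))) / R)
    (htr : X.trace.re ≤ R) :
    (1 - κ • X - NormedSpace.exp ((-θ) • X)).PosSemidef := by
  have hH := hX.1
  set U : Matrix n n ℂ := (hH.eigenvectorUnitary : Matrix n n ℂ) with hU
  have h1 : U * Uᴴ = 1 := Unitary.coe_mul_star_self hH.eigenvectorUnitary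
  have hs : X = U * diagonal (fun i => (hH.eigenvalues i : ℂ)) * Uᴴ := hH.spectral_theorem
  have hk : κ • X = U * diagonal (fun i => ((κ * hH.eigenvalues i : ℝ) : ℂ)) * Uᴴ := by
    conv_lhs => rw [hs]
    rw [← smul_mul_assoc, ← mul_smul_comm]
    congr 2
    rw [← diagonal_smul]
    congr 1; ext i; simp
  have h0 : (1 : Matrix n n ℂ) = U * diagonal (fun _ => 1) * Uᴴ := by
    rw [diagonal_one, mul_one, h1]
  have hsum : ∑ i, hH.eigenvalues i = X.trace.re := by
    rw [hH.trace_eq_sum_eigenvalues]; simp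
  rw [exp_spectral_aux X hH θ, hk, ← hU, h0, ← sub_mul, ← mul_sub, ← sub_mul, ← mul_sub,
    diagonal_sub, diagonal_sub]
  apply PosSemidef.mul_mul_conjTranspose_same
  apply PosSemidef.diagonal
  intro i
  have hl0 : 0 ≤ hH.eigenvalues i := hX.eigenvalues_nonneg i
  have hlR : hH.eigenvalues i ≤ R := by
    refine le_trans ?_ (hsum.trans_le htr)
    exact Finset.single_le_sum (fun j _ => hX.eigenvalues_nonneg j) (Finset.mem_univ i)
  set l := hH.eigenvalues i
  have hconv := convexOn_exp.2 (Set.mem_univ (0:ℝ)) (Set.mem_univ (-(θ*R)))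
    (show 0 ≤ 1 - l / R by rw [sub_nonneg, div_le_one hR]; exact hlR)
    (show 0 ≤ l / R by positivity) (by ring)
  have e : (1 - l / R) • (0:ℝ) + (l / R) • (-(θ*R)) = -θ * l := by
    simp only [smul_eq_mul]; field_simp; ring
  rw [e] at hconv
  simp only [smul_eq_mul, Real.exp_zero] at hconv
  have : 0 ≤ 1 - κ * l - Real.exp (-θ * l) := by
    have : κ * l = (1 - Real.exp (-(θ*R))) * (l / R) := by rw [hκ]; ring
    rw [this]; linarith
  simp only [Pi.zero_apply]
  exact_mod_cast this

lemma trace_mul_nonneg_aux {n : Type*} [Fintype n] [DecidableEq n] (P Q : Matrix n n ℂ)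
    (hP : P.IsHermitian) (hQ : Q.PosSemidef) : 0 ≤ (P * P * Q).trace.re := by
  have h := (hQ.mul_mul_conjTranspose_same P).trace_nonneg
  rw [hP.eq, trace_mul_comm, ← mul_assoc] at h
  exact (Complex.nonneg_iff.1 h).1

open scoped Matrix.Norms.L2Operator in
lemma trace_exp_mul_nonneg_aux {n : Type*} [Fintype n] [DecidableEq n] (S Q : Matrix n n ℂ)
    (hS : S.IsHermitian) (hQ : Q.PosSemidef) : 0 ≤ (NormedSpace.exp S * Q).trace.re := by
  have : NormedSpace.exp S = NormedSpace.exp ((1/2:ℝ) • S) * NormedSpace.exp ((1/2:ℝ) • S) := by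
    rw [← Matrix.exp_add_of_commute _ _ (Commute.refl _), ← add_smul]
    norm_num
  rw [this]
  apply trace_mul_nonneg_aux _ _ _ hQ
  apply IsHermitian.exp
  rw [IsHermitian, conjTranspose_smul, hS.eq]; simp

lemma chernoff_trace_aux {n : Type*} [Fintype n] [DecidableEq n] [Nonempty n] {n₁ : ℕ}
    (X : Fin n₁ → Matrix n n ℂ) (hX : ∀ j, (X j).PosSemidef) (hsum : ∑ j, X j = 1)
    (R θ κ : ℝ) (hR : 0 < R) (hκ : κ = (1 - Real.exp (-(θ * R))) / R)
    (htr : ∀ j, (X j).trace.re ≤ R) (hκn : κ ≤ n₁) (m : ℕ) :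
    ∑ ω : Fin m → Fin n₁, (NormedSpace.exp ((-θ) • ∑ k, X (ω k))).trace.re ≤
      Fintype.card n * ((n₁ : ℝ) - κ) ^ m := by
  induction m with
  | zero => simp [NormedSpace.exp_zero]
  | succ m ih =>
    have hstep : ∀ ω : Fin m → Fin n₁,
        ∑ j, (NormedSpace.exp ((-θ) • (X j + ∑ k, X (ω k)))).trace.re ≤
          ((n₁ : ℝ) - κ) * (NormedSpace.exp ((-θ) • ∑ k, X (ω k))).trace.re := by
      intro ω
      set S := ∑ k, X (ω k) with hS
      have hSH : S.IsHermitian := (posSemidef_sum _ fun k _ => hX (ω k)).1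
      have hsm : ∀ M : Matrix n n ℂ, M.IsHermitian → ((-θ) • M).IsHermitian := by
        intro M hM
        rw [IsHermitian, conjTranspose_smul, hM.eq]; simp
      set E := NormedSpace.exp ((-θ) • S) with hE
      have h1 : ∀ j, (NormedSpace.exp ((-θ) • (X j + S))).trace.re ≤
          (E * (1 - κ • X j)).trace.re := by
        intro j
        rw [add_comm, smul_add]
        refine (golden_thompson_aux _ _ (hsm _ hSH) (hsm _ (hX j).1)).trans ?_
        have := trace_exp_mul_nonneg_aux _ _ (hsm _ hSH) (exp_le_aux (X j) (hX j) R θ κ hR hκ (htr j))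
        rw [mul_sub, trace_sub, Complex.sub_re] at this
        linarith
      refine (Finset.sum_le_sum fun j _ => h1 j).trans_eq ?_
      rw [← Complex.re_sum, ← trace_sum, ← Finset.mul_sum, Finset.sum_sub_distrib,
        ← Finset.smul_sum, hsum, mul_sub, trace_sub]
      have h3 : (∑ _j : Fin n₁, (1 : Matrix n n ℂ)) = (n₁ : ℝ) • 1 := by
        rw [Finset.sum_const, Finset.card_univ, Fintype.card_fin, ← Nat.cast_smul_eq_nsmul ℝ]
      rw [h3]
      simp
      ring
    rw [← (Fin.consEquiv (fun _ => Fin n₁)).sum_comp, Fintype.sum_prod_type, Finset.sum_comm]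
    simp only [Fin.consEquiv_apply, Fin.sum_univ_succ, Fin.cons_zero, Fin.cons_succ]
    refine (Finset.sum_le_sum fun ω _ => hstep ω).trans ?_
    rw [← Finset.mul_sum]
    calc _ ≤ ((n₁ : ℝ) - κ) * (Fintype.card n * ((n₁ : ℝ) - κ) ^ m) :=
          mul_le_mul_of_nonneg_left ih (by linarith)
      _ = _ := by ring

open scoped Matrix.Norms.L2Operator in
lemma inv_bound_aux {d : ℕ} (G : Matrix (Fin d) (Fin d) ℂ) (hG : G.IsHermitian) (t : ℝ) (ht : 0 < t)
    (h : ∀ i, t ≤ hG.eigenvalues i) : IsUnit G ∧ matrixOpNorm G⁻¹ ≤ 1 / t := by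
  set U : Matrix (Fin d) (Fin d) ℂ := (hG.eigenvectorUnitary : Matrix (Fin d) (Fin d) ℂ) with hU
  have h1 : U * Uᴴ = 1 := Unitary.coe_mul_star_self hG.eigenvectorUnitary
  have h2 : Uᴴ * U = 1 := Unitary.coe_star_mul_self hG.eigenvectorUnitary
  have hs : G = U * diagonal (fun i => (hG.eigenvalues i : ℂ)) * Uᴴ := hG.spectral_theorem
  set D : Matrix (Fin d) (Fin d) ℂ := diagonal (fun i => ((hG.eigenvalues i)⁻¹ : ℂ)) with hD
  have hGD : G * (U * D * Uᴴ) = 1 := by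
    calc _ = U * diagonal (fun i => (hG.eigenvalues i : ℂ)) * (Uᴴ * U) * D * Uᴴ := by
          conv_lhs => rw [hs]
          simp only [mul_assoc]
      _ = 1 := by
          rw [h2, mul_one, mul_assoc U, hD, diagonal_mul_diagonal]
          have : (fun i => (hG.eigenvalues i : ℂ) * ((hG.eigenvalues i)⁻¹ : ℂ)) = fun _ => 1 := by
            ext i
            apply mul_inv_cancel₀
            have := ht.trans_le (h i)
            exact_mod_cast this.ne'
          rw [this, diagonal_one, mul_one, h1]
  refine ⟨IsUnit.of_mul_eq_one _ hGD, ?_⟩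
  rw [inv_eq_right_inv hGD]
  change ‖U * D * Uᴴ‖ ≤ _
  have e1 : ‖U * D * Uᴴ‖ = ‖D‖ := by
    have := CStarRing.norm_mul_coe_unitary (U * D) (star hG.eigenvectorUnitary)
    refine Eq.trans this ?_
    exact CStarRing.norm_coe_unitary_mul hG.eigenvectorUnitary D
  rw [e1, hD, l2_opNorm_diagonal]
  refine (pi_norm_le_iff_of_nonneg (by positivity)).2 fun i => ?_
  have := ht.trans_le (h i)
  rw [norm_inv, Complex.norm_real, Real.norm_of_nonneg this.le, one_div]
  gcongr
  exact h i

end TubalAux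

open scoped ComplexOrder in
set_option maxHeartbeats 1000000 in
/-- **Lemma 3 (invertibility of the sampled Gram matrix, tubal-sampling).**
Sampling with replacement is modeled by the uniform distribution on the finite
sample space `Fin m → Fin n₁`, probabilities being `#(event) / n₁ ^ m`. -/
theorem tubal_sampling_gram_invertibility
    (n₁ n₂ n₃ m : ℕ) (hn₁ : 0 < n₁) (hn₂ : 0 < n₂) (hn₃ : 0 < n₃) (hm : 0 < m)
    (c μ δ : ℝ) (hc : 0 < c) (hμ : 1 ≤ μ) (hδ : 0 < δ)
    (A : Fin n₁ → Matrix (Fin n₃) (Fin (n₂ * n₃)) ℂ)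
    (hA : ∑ j, (A j)ᴴ * A j = 1)
    (hAF : ∀ j, ∑ i, ∑ l, ‖A j i l‖ ^ 2 ≤ c ^ 2 * n₂ * μ / n₁)
    (γ : ℝ)
    (hγ : γ = Real.sqrt (8 * c ^ 2 * n₂ * μ * Real.log (2 * n₂ * n₃ / δ) / (3 * m)))
    (hγ1 : γ < 1) :
    1 - δ ≤
      (Set.ncard {ω : Fin m → Fin n₁ |
        let G : Matrix (Fin (n₂ * n₃)) (Fin (n₂ * n₃)) ℂ := ∑ k, (A (ω k))ᴴ * A (ω k)
        IsUnit G ∧ matrixOpNorm G⁻¹ ≤ n₁ / ((1 - γ) * m)} : ℝ) / (n₁ : ℝ) ^ m := by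
  classical
  by_cases hδ1 : 1 ≤ δ
  · refine le_trans (by linarith : 1 - δ ≤ 0) (by positivity)
  push Not at hδ1
  have hd : 0 < n₂ * n₃ := Nat.mul_pos hn₂ hn₃
  have _ : Nonempty (Fin (n₂ * n₃)) := ⟨⟨0, hd⟩⟩
  have hn₁' : (0:ℝ) < n₁ := by exact_mod_cast hn₁
  have hn₂' : (0:ℝ) < n₂ := by exact_mod_cast hn₂
  have hm' : (0:ℝ) < m := by exact_mod_cast hm
  have hd' : (1:ℝ) ≤ n₂ * n₃ := by exact_mod_cast hd
  set B : ℝ := c ^ 2 * n₂ * μ with hB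
  have hBpos : 0 < B := by positivity
  set L : ℝ := Real.log (2 * n₂ * n₃ / δ) with hL
  have hargpos : (0:ℝ) < 2 * n₂ * n₃ / δ := by
    apply div_pos _ hδ
    nlinarith
  have hLpos : 0 < L := by
    apply Real.log_pos
    rw [lt_div_iff₀ hδ]
    nlinarith
  have hγsq : γ ^ 2 = 8 * B * L / (3 * m) := by
    rw [hγ, Real.sq_sqrt]
    · rw [hB]; ring
    · have : 8 * c ^ 2 * n₂ * μ * L / (3 * m) = 8 * B * L / (3 * m) := by rw [hB]; ring
      rw [this]; positivity
  have hγ0 : 0 ≤ γ := by rw [hγ]; exact Real.sqrt_nonneg _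
  set X : Fin n₁ → Matrix (Fin (n₂ * n₃)) (Fin (n₂ * n₃)) ℂ := fun j => (A j)ᴴ * A j with hXdef
  have hX : ∀ j, (X j).PosSemidef := fun j => posSemidef_conjTranspose_mul_self _
  set R : ℝ := B / n₁ with hRdef
  have hR : 0 < R := by positivity
  have htr : ∀ j, (X j).trace.re ≤ R := by
    intro j
    refine le_trans (le_of_eq ?_) (hAF j)
    rw [Finset.sum_comm]
    simp only [hXdef, trace, diag, mul_apply, conjTranspose_apply, Complex.re_sum]
    refine Finset.sum_congr rfl fun i _ => Finset.sum_congr rfl fun l _ => ?_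
    rw [mul_comm, Complex.star_def, Complex.mul_conj, Complex.normSq_eq_norm_sq, Complex.ofReal_re]
  have hdB : 1 ≤ B := by
    have h1 : (∑ j, X j).trace.re ≤ B := by
      rw [trace_sum, Complex.re_sum]
      refine (Finset.sum_le_sum fun j _ => htr j).trans_eq ?_
      simp [hRdef]; field_simp
    rw [show ∑ j, X j = 1 from hA] at h1
    simp at h1
    linarith
  set θ : ℝ := γ / R with hθ
  have hθR : θ * R = γ := by rw [hθ]; field_simp
  set κ : ℝ := (1 - Real.exp (-(θ * R))) / R with hκ
  have hκn : κ ≤ n₁ := by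
    rw [hκ, div_le_iff₀ hR, hRdef, mul_div_cancel₀ _ hn₁'.ne']
    have := Real.exp_pos (-(θ * R))
    linarith
  have hC := chernoff_trace_aux X hX hA R θ κ hR hκ htr hκn m
  set t : ℝ := (1 - γ) * m / n₁ with ht
  have htpos : 0 < t := by
    have : 0 < 1 - γ := by linarith
    positivity
  set good : Set (Fin m → Fin n₁) := {ω : Fin m → Fin n₁ |
        let G : Matrix (Fin (n₂ * n₃)) (Fin (n₂ * n₃)) ℂ := ∑ k, (A (ω k))ᴴ * A (ω k)
        IsUnit G ∧ matrixOpNorm G⁻¹ ≤ n₁ / ((1 - γ) * m)} with hgood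
  have hbad : ∀ ω, ω ∉ good →
      Real.exp (-θ * t) ≤ (NormedSpace.exp ((-θ) • ∑ k, X (ω k))).trace.re := by
    intro ω hω
    have hG : (∑ k, X (ω k)).IsHermitian := (posSemidef_sum _ fun k _ => hX (ω k)).1
    rw [trace_exp_aux _ hG]
    by_contra hcon
    apply hω
    have key : ∀ i, t ≤ hG.eigenvalues i := by
      intro i
      by_contra hi
      push Not at hi
      apply hcon
      refine le_trans ?_ (Finset.single_le_sum (f := fun i => Real.exp (-θ * hG.eigenvalues i))
        (fun j _ => (Real.exp_pos _).le) (Finset.mem_univ i))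
      apply Real.exp_le_exp.2
      have hθ0 : 0 ≤ θ := by positivity
      nlinarith
    have := inv_bound_aux _ hG t htpos key
    refine ⟨this.1, this.2.trans_eq ?_⟩
    rw [ht, one_div_div]
  have hnn : ∀ ω : Fin m → Fin n₁,
      0 ≤ (NormedSpace.exp ((-θ) • ∑ k, X (ω k))).trace.re := by
    intro ω
    rw [trace_exp_aux _ (posSemidef_sum _ fun k _ => hX (ω k)).1]
    positivity
  have hcount : ((goodᶜ).ncard : ℝ) * Real.exp (-θ * t) ≤
      ((n₂ * n₃ : ℕ) : ℝ) * ((n₁ : ℝ) - κ) ^ m := by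
    rw [Set.ncard_eq_toFinset_card']
    refine le_trans ?_ (hC.trans_eq (by simp))
    rw [← nsmul_eq_mul, ← Finset.sum_const]
    refine le_trans (Finset.sum_le_sum fun ω hω => hbad ω (by simpa using hω)) ?_
    exact Finset.sum_le_sum_of_subset_of_nonneg (Finset.subset_univ _) fun ω _ _ => hnn ω
  have htot : (good.ncard : ℝ) + (goodᶜ).ncard = (n₁ : ℝ) ^ m := by
    have := Set.ncard_add_ncard_compl good
    rw [Nat.card_eq_fintype_card] at this
    simp only [Fintype.card_fun, Fintype.card_fin] at this
    exact_mod_cast this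
  have hexp : Real.exp (-γ) ≤ 1 - γ + γ ^ 2 / 2 := by
    have h1 := Real.quadratic_le_exp_of_nonneg hγ0
    rw [Real.exp_neg, inv_le_iff_one_le_mul₀ (Real.exp_pos _)]
    have h2 : 0 ≤ 1 - γ + γ ^ 2 / 2 := by nlinarith [sq_nonneg γ]
    refine le_trans ?_ (mul_le_mul_of_nonneg_left h1 h2)
    nlinarith [sq_nonneg (γ ^ 2)]
  have hpow : ((n₁ : ℝ) - κ) ^ m ≤ (n₁ : ℝ) ^ m * Real.exp (-(κ * m / n₁)) := by
    have h1 : (n₁ : ℝ) - κ ≤ n₁ * Real.exp (-(κ / n₁)) := by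
      have := Real.add_one_le_exp (-(κ / n₁))
      calc (n₁ : ℝ) - κ = n₁ * (-(κ / n₁) + 1) := by field_simp; ring
        _ ≤ _ := by gcongr
    refine (pow_le_pow_left₀ (by linarith) h1 m).trans_eq ?_
    rw [mul_pow, ← Real.exp_nat_mul]
    congr 2
    ring
  have hfin : ((n₂ * n₃ : ℕ) : ℝ) * Real.exp (-(κ * m / n₁)) ≤ δ * Real.exp (-θ * t) := by
    have hex : -(κ * m / n₁) ≤ -L + -θ * t := by
      have e1 : κ * m / n₁ = (1 - Real.exp (-γ)) * (m / B) := by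
        rw [hκ, hθR, hRdef]; field_simp
      have e2 : -θ * t = -(γ * (1 - γ)) * (m / B) := by
        rw [hθ, ht, hRdef]; field_simp
      have e3 : γ ^ 2 * (m / B) = 8 / 3 * L := by
        rw [hγsq]; field_simp
      rw [e1, e2]
      have hmB : 0 < m / B := by positivity
      have := mul_le_mul_of_nonneg_right hexp hmB.le
      nlinarith
    calc _ ≤ ((n₂ * n₃ : ℕ) : ℝ) * Real.exp (-L + -θ * t) := by gcongr
      _ = (((n₂ * n₃ : ℕ) : ℝ) * (2 * n₂ * n₃ / δ)⁻¹) * Real.exp (-θ * t) := by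
          rw [Real.exp_add, Real.exp_neg, hL, Real.exp_log hargpos]; ring
      _ ≤ _ := by
          gcongr
          rw [inv_div, ← mul_div_assoc, div_le_iff₀ (by nlinarith)]
          push_cast
          nlinarith
  have hbadle : ((goodᶜ).ncard : ℝ) ≤ δ * (n₁ : ℝ) ^ m := by
    refine le_of_mul_le_mul_right ?_ (Real.exp_pos (-θ * t))
    refine hcount.trans ?_
    calc _ ≤ ((n₂ * n₃ : ℕ) : ℝ) * ((n₁ : ℝ) ^ m * Real.exp (-(κ * m / n₁))) := by gcongr
      _ = (n₁ : ℝ) ^ m * (((n₂ * n₃ : ℕ) : ℝ) * Real.exp (-(κ * m / n₁))) := by ring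
      _ ≤ (n₁ : ℝ) ^ m * (δ * Real.exp (-θ * t)) := by gcongr
      _ = _ := by ring
  rw [le_div_iff₀ (by positivity)]
  linarith
end
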